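/- arXiv:0710.0862 — 4 statements merged into one kernel-verified Lean document; each statement's English description precedes it below -/
import Mathlib

section
/- Every m×(n,m) pair (B,A) of complex matrices is feedback similar to a direct sum of pairs of the following three forms: ([1,0,…,0]^T, J_k(0)), a k×(1,k) pair; (0_{k,0}, J_k(λ)) with λ ∈ ℂ, a k×(0,k) pair; and (0_{0,1}, 0_{0,0}), a 0×(1,0) pair. Moreover, this direct sum is determined by (B,A) uniquely up to permutation of the summands. -/
open Matrix

/-- An `m×(n,m)` pair: a pair `(B, A)` with `B ∈ ℂ^{m×n}` and `A ∈ ℂ^{m×m}`. -/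
abbrev PairT (m n : ℕ) :=
  Matrix (Fin m) (Fin n) ℂ × Matrix (Fin m) (Fin m) ℂ

/-- Feedback similarity of `m×(n,m)` pairs: `(B,A)` and `(B',A')` are feedback similar if
`B' = S⁻¹BP` and `A' = S⁻¹(AS + BU)` for some invertible `S, P` and some `U`. -/
def FSP {m n : ℕ} (X Y : PairT m n) : Prop :=
  ∃ (S : Matrix (Fin m) (Fin m) ℂ) (P : Matrix (Fin n) (Fin n) ℂ)
    (U : Matrix (Fin n) (Fin m) ℂ),
    IsUnit S ∧ IsUnit P ∧ Y.1 = S⁻¹ * X.1 * P ∧ Y.2 = S⁻¹ * (X.2 * S + X.1 * U)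

/-- An `m×(n,m,m)` triple: a triple `(C, B, A)` with `C ∈ ℂ^{m×n}` and `B, A ∈ ℂ^{m×m}`. -/
abbrev TripleT (m n : ℕ) :=
  Matrix (Fin m) (Fin n) ℂ × Matrix (Fin m) (Fin m) ℂ × Matrix (Fin m) (Fin m) ℂ

/-- Feedback similarity of `m×(n,m,m)` triples: `(C,B,A)` and `(C',B',A')` are feedback
similar if `C' = S⁻¹CP`, `B' = S⁻¹(BS + CV)`, `A' = S⁻¹(AS + CU)` for some invertible
`S, P` and some `U, V`. -/
def FST {m n : ℕ} (X Y : TripleT m n) : Prop :=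
  ∃ (S : Matrix (Fin m) (Fin m) ℂ) (P : Matrix (Fin n) (Fin n) ℂ)
    (U V : Matrix (Fin n) (Fin m) ℂ),
    IsUnit S ∧ IsUnit P ∧ Y.1 = S⁻¹ * X.1 * P ∧
    Y.2.1 = S⁻¹ * (X.2.1 * S + X.1 * V) ∧ Y.2.2 = S⁻¹ * (X.2.2 * S + X.1 * U)

/-- Frobenius norm of a complex matrix. -/
noncomputable def fnorm {p q : ℕ} (M : Matrix (Fin p) (Fin q) ℂ) : ℝ :=
  Real.sqrt (∑ i, ∑ j, ‖M i j‖ ^ 2)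

/-- Norm of a pair: `‖(B,A)‖ = ‖B‖ + ‖A‖`. -/
noncomputable def pnorm {m n : ℕ} (X : PairT m n) : ℝ := fnorm X.1 + fnorm X.2

/-- Norm of a triple: `‖(C,B,A)‖ = ‖C‖ + ‖B‖ + ‖A‖`. -/
noncomputable def tnorm {m n : ℕ} (X : TripleT m n) : ℝ :=
  fnorm X.1 + fnorm X.2.1 + fnorm X.2.2

/-- The possible indecomposable summands:
`jz k` is the `k×(1,k)` pair `([1,0,…,0]^T, J_k(0))`,
`jl k λ` is the `k×(0,k)` pair `(0_{k,0}, J_k(λ))`,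
`zc` is the `0×(1,0)` pair `(0_{0,1}, 0_{0,0})`. -/
inductive Summand : Type
  | jz : ℕ → Summand
  | jl : ℕ → ℂ → Summand
  | zc : Summand

/-- Number of rows of a summand. -/
def rowsS : Summand → ℕ
  | .jz k => k
  | .jl k _ => k
  | .zc => 0

/-- Number of columns of the `B`-part of a summand. -/
def colsS : Summand → ℕ
  | .jz _ => 1
  | .jl _ _ => 0
  | .zc => 1

/-- A summand is valid if the size of its Jordan block is at least 1. -/
def validS : Summand → Prop
  | .jz k => 1 ≤ k
  | .jl k _ => 1 ≤ k
  | .zc => True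

/-- The `k×k` lower Jordan block `J_k(λ)`. -/
def Jmat (k : ℕ) (lam : ℂ) : Matrix (Fin k) (Fin k) ℂ := fun i j =>
  if (i:ℕ) = (j:ℕ) then lam else if (i:ℕ) = (j:ℕ) + 1 then 1 else 0

/-- The `B`-part of a summand. -/
def sB : (s : Summand) → Matrix (Fin (rowsS s)) (Fin (colsS s)) ℂ
  | .jz _ => fun i _ => if (i:ℕ) = 0 then 1 else 0
  | .jl _ _ => 0
  | .zc => 0

/-- The `A`-part of a summand. -/
def sA : (s : Summand) → Matrix (Fin (rowsS s)) (Fin (rowsS s)) ℂ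
  | .jz k => Jmat k 0
  | .jl k lam => Jmat k lam
  | .zc => 0

/-- Total number of rows of a list of summands. -/
def rowsL : List Summand → ℕ
  | [] => 0
  | s :: L => rowsS s + rowsL L

/-- Total number of `B`-columns of a list of summands. -/
def colsL : List Summand → ℕ
  | [] => 0
  | s :: L => colsS s + colsL L

/-- Block-diagonal direct sum of two (possibly empty) matrices. -/
def bdiag {a b c d : ℕ} (M : Matrix (Fin a) (Fin b) ℂ) (N : Matrix (Fin c) (Fin d) ℂ) :
    Matrix (Fin (a + c)) (Fin (b + d)) ℂ := fun i j =>
  if hi : (i:ℕ) < a then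
    if hj : (j:ℕ) < b then M ⟨i, hi⟩ ⟨j, hj⟩ else 0
  else
    if hj : (j:ℕ) < b then 0
    else N ⟨(i:ℕ) - a, by have := i.isLt; omega⟩ ⟨(j:ℕ) - b, by have := j.isLt; omega⟩

/-- `B`-part of the direct sum of a list of summands. -/
def dsB : (L : List Summand) → Matrix (Fin (rowsL L)) (Fin (colsL L)) ℂ
  | [] => 0
  | s :: L => bdiag (sB s) (dsB L)

/-- `A`-part of the direct sum of a list of summands. -/
def dsA : (L : List Summand) → Matrix (Fin (rowsL L)) (Fin (rowsL L)) ℂ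
  | [] => 0
  | s :: L => bdiag (sA s) (dsA L)


/-- A linear system `B : E → V`, `A : V → V`. -/
structure Sys where
  V : Type
  E : Type
  [iV : AddCommGroup V]
  [iE : AddCommGroup E]
  [mV : Module ℂ V]
  [mE : Module ℂ E]
  B : E →ₗ[ℂ] V
  A : V →ₗ[ℂ] V

attribute [instance] Sys.iV Sys.iE Sys.mV Sys.mE

namespace Sys

/-- Feedback equivalence. -/
def Feq (X Y : Sys) : Prop :=
  ∃ (S : Y.V ≃ₗ[ℂ] X.V) (P : Y.E ≃ₗ[ℂ] X.E) (U : Y.V →ₗ[ℂ] X.E),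
    (∀ e, S (Y.B e) = X.B (P e)) ∧ ∀ v, S (Y.A v) = X.A (S v) + X.B (U v)

theorem Feq.refl (X : Sys) : Feq X X :=
  ⟨LinearEquiv.refl _ _, LinearEquiv.refl _ _, 0, by simp, by simp⟩

theorem Feq.trans {X Y Z : Sys} (h1 : Feq X Y) (h2 : Feq Y Z) : Feq X Z := by
  obtain ⟨S1, P1, U1, a1, b1⟩ := h1
  obtain ⟨S2, P2, U2, a2, b2⟩ := h2
  refine ⟨S2.trans S1, P2.trans P1, U1 ∘ₗ S2.toLinearMap + P1.toLinearMap ∘ₗ U2, ?_, ?_⟩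
  · intro e; simp [a1, a2]
  · intro v; simp [a1, b1, b2, add_assoc]

theorem Feq.of_iso {X Y : Sys} (S : Y.V ≃ₗ[ℂ] X.V) (P : Y.E ≃ₗ[ℂ] X.E)
    (hB : ∀ e, S (Y.B e) = X.B (P e)) (hA : ∀ v, S (Y.A v) = X.A (S v)) : Feq X Y :=
  ⟨S, P, 0, hB, by simpa using hA⟩

theorem Feq.of_iso' {X Y : Sys} (S : X.V ≃ₗ[ℂ] Y.V) (P : X.E ≃ₗ[ℂ] Y.E)
    (hB : ∀ e, S (X.B e) = Y.B (P e)) (hA : ∀ v, S (X.A v) = Y.A (S v)) : Feq X Y := by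
  refine Feq.of_iso S.symm P.symm ?_ ?_
  · intro e
    rw [LinearEquiv.symm_apply_eq, hB, LinearEquiv.apply_symm_apply]
  · intro e
    rw [LinearEquiv.symm_apply_eq, hA, LinearEquiv.apply_symm_apply]

/-- Direct sum. -/
def prod (X Y : Sys) : Sys where
  V := X.V × Y.V
  E := X.E × Y.E
  B := X.B.prodMap Y.B
  A := X.A.prodMap Y.A

/-- Product equivalence, with unbundled target types. -/
theorem Feq.prod {X Y X' Y' : Sys} (h1 : Feq X X') (h2 : Feq Y Y') :
    Feq (X.prod Y) (X'.prod Y') := by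
  obtain ⟨S1, P1, U1, a1, b1⟩ := h1
  obtain ⟨S2, P2, U2, a2, b2⟩ := h2
  refine ⟨S1.prodCongr S2, P1.prodCongr P2, U1.prodMap U2, ?_, ?_⟩
  · rintro ⟨e, f⟩
    exact Prod.ext (a1 e) (a2 f)
  · rintro ⟨e, f⟩
    exact Prod.ext (b1 e) (b2 f)

/-- The extended system. -/
def lift (X : Sys) : Sys where
  V := X.E × X.V
  E := X.E
  B := LinearMap.inl ℂ X.E X.V
  A := LinearMap.inr ℂ X.E X.V ∘ₗ X.B.coprod X.A

theorem Feq.lift {X Y : Sys} (h : Feq X Y) : Feq X.lift Y.lift := by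
  obtain ⟨S, P, U, a, b⟩ := h
  let T : (Y.E × Y.V) ≃ₗ[ℂ] (X.E × X.V) :=
    { toFun := fun p => (P p.1 + U p.2, S p.2)
      map_add' := by
        intro p q; ext
        · simp; abel
        · simp
      map_smul' := by intro c p; ext <;> simp
      invFun := fun q => (P.symm (q.1 - U (S.symm q.2)), S.symm q.2)
      left_inv := by intro p; simp
      right_inv := by intro p; simp }
  refine ⟨T, P, U ∘ₗ (Y.B.coprod Y.A), ?_, ?_⟩
  · intro e
    change (P e + U 0, S 0) = (P e, 0)
    simp
  · rintro ⟨e, v⟩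
    have key : ((P 0 + U (Y.B e + Y.A v), S (Y.B e + Y.A v)) : X.E × X.V)
        = (0, X.B (P e + U v) + X.A (S v)) + (U (Y.B e + Y.A v), 0) := by
      refine Prod.ext ?_ ?_
      · simp
      · simp [a, b]; abel
    exact key

theorem lift_prod (X Y : Sys) : Feq (X.prod Y).lift (X.lift.prod Y.lift) := by
  let T : ((X.E × Y.E) × (X.V × Y.V)) ≃ₗ[ℂ] ((X.E × X.V) × (Y.E × Y.V)) :=
    { Equiv.prodProdProdComm X.E Y.E X.V Y.V with
      map_add' := by intro p q; rfl
      map_smul' := by intro p q; rfl }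
  refine Feq.of_iso' (X := (X.prod Y).lift) (Y := X.lift.prod Y.lift) T
    (LinearEquiv.refl ℂ (X.E × Y.E)) ?_ ?_
  · intro e; rfl
  · intro e; rfl

/-- System of a single summand. -/
noncomputable def ofS (s : Summand) : Sys where
  V := Fin (rowsS s) → ℂ
  E := Fin (colsS s) → ℂ
  B := Matrix.toLin' (sB s)
  A := Matrix.toLin' (sA s)

/-- System of a list. -/
noncomputable def ofL (L : List Summand) : Sys where
  V := Fin (rowsL L) → ℂ
  E := Fin (colsL L) → ℂ
  B := Matrix.toLin' (dsB L)
  A := Matrix.toLin' (dsA L)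

/-- Appending vectors. -/
def appendL (a c : ℕ) : ((Fin a → ℂ) × (Fin c → ℂ)) ≃ₗ[ℂ] (Fin (a + c) → ℂ) where
  toFun p := Fin.append p.1 p.2
  map_add' p q := by
    ext i; refine Fin.addCases (fun i => ?_) (fun i => ?_) i <;> simp
  map_smul' p q := by
    ext i; refine Fin.addCases (fun i => ?_) (fun i => ?_) i <;> simp
  invFun f := (fun i => f (Fin.castAdd c i), fun i => f (Fin.natAdd a i))
  left_inv p := by ext <;> simp
  right_inv f := by
    ext i; refine Fin.addCases (fun i => ?_) (fun i => ?_) i <;> simp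

theorem bdiag_append {a b c d : ℕ} (M : Matrix (Fin a) (Fin b) ℂ) (N : Matrix (Fin c) (Fin d) ℂ)
    (x : Fin b → ℂ) (y : Fin d → ℂ) :
    Matrix.mulVec (bdiag M N) (Fin.append x y) = Fin.append (M *ᵥ x) (N *ᵥ y) := by
  ext i
  refine Fin.addCases (fun i => ?_) (fun i => ?_) i <;>
    simp [Matrix.mulVec, dotProduct, Fin.sum_univ_add, bdiag]

theorem prod_ofL (s : Summand) (L : List Summand) :
    Feq ((ofS s).prod (ofL L)) (ofL (s :: L)) := by
  refine Feq.of_iso' (X := (ofS s).prod (ofL L)) (Y := ofL (s :: L))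
    (appendL (rowsS s) (rowsL L)) (appendL (colsS s) (colsL L)) ?_ ?_
  · rintro ⟨x, y⟩
    exact (bdiag_append (sB s) (dsB L) x y).symm
  · rintro ⟨x, y⟩
    exact (bdiag_append (sA s) (dsA L) x y).symm

theorem ofL_prod (s : Summand) (L : List Summand) :
    Feq (ofL (s :: L)) ((ofS s).prod (ofL L)) := by
  refine Feq.of_iso (X := ofL (s :: L)) (Y := (ofS s).prod (ofL L))
    (appendL (rowsS s) (rowsL L)) (appendL (colsS s) (colsL L)) ?_ ?_
  · rintro ⟨x, y⟩
    exact (bdiag_append (sB s) (dsB L) x y).symm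
  · rintro ⟨x, y⟩
    exact (bdiag_append (sA s) (dsA L) x y).symm

theorem feq_of_subsingleton {X Y : Sys} [Subsingleton X.V] [Subsingleton X.E]
    [Subsingleton Y.V] [Subsingleton Y.E] : Feq X Y :=
  ⟨0, 0, 0, fun _ => Subsingleton.elim _ _, fun _ => Subsingleton.elim _ _⟩

instance : Subsingleton (ofL []).V := inferInstanceAs (Subsingleton (Fin 0 → ℂ))
instance : Subsingleton (ofL []).E := inferInstanceAs (Subsingleton (Fin 0 → ℂ))

theorem prod_subsing (X Y : Sys) [Subsingleton X.V] [Subsingleton X.E] : Feq (X.prod Y) Y := by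
  have : Unique X.V := uniqueOfSubsingleton 0
  have : Unique X.E := uniqueOfSubsingleton 0
  refine Feq.of_iso' (X := X.prod Y) (LinearEquiv.uniqueProd (R := ℂ) (M := Y.V) (M₂ := X.V))
    (LinearEquiv.uniqueProd (R := ℂ) (M := Y.E) (M₂ := X.E)) ?_ ?_
  · rintro ⟨x, y⟩; rfl
  · rintro ⟨x, y⟩; rfl

theorem subsing_prod (X Y : Sys) [Subsingleton X.V] [Subsingleton X.E] : Feq Y (X.prod Y) := by
  have : Unique X.V := uniqueOfSubsingleton 0
  have : Unique X.E := uniqueOfSubsingleton 0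
  refine Feq.of_iso (Y := X.prod Y) (LinearEquiv.uniqueProd (R := ℂ) (M := Y.V) (M₂ := X.V))
    (LinearEquiv.uniqueProd (R := ℂ) (M := Y.E) (M₂ := X.E)) ?_ ?_
  · rintro ⟨x, y⟩; rfl
  · rintro ⟨x, y⟩; rfl

theorem prod_assoc (X Y Z : Sys) : Feq ((X.prod Y).prod Z) (X.prod (Y.prod Z)) :=
  Feq.of_iso' (X := (X.prod Y).prod Z) (Y := X.prod (Y.prod Z))
    (LinearEquiv.prodAssoc ℂ X.V Y.V Z.V) (LinearEquiv.prodAssoc ℂ X.E Y.E Z.E)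
    (fun _ => rfl) (fun _ => rfl)

theorem ofL_append (L L' : List Summand) : Feq ((ofL L).prod (ofL L')) (ofL (L ++ L')) := by
  induction L with
  | nil => exact prod_subsing _ _
  | cons s L ih =>
    exact ((ofL_prod s L).prod (Feq.refl _)).trans ((prod_assoc _ _ _).trans
      (((Feq.refl _).prod ih).trans (prod_ofL s (L ++ L'))))

theorem ofS_single (s : Summand) : Feq (ofS s) (ofL [s]) := by
  refine Feq.trans ?_ (prod_ofL s [])
  have : Unique (ofL []).V := uniqueOfSubsingleton 0
  have : Unique (ofL []).E := uniqueOfSubsingleton 0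
  refine Feq.of_iso (X := ofS s) (Y := (ofS s).prod (ofL []))
    (LinearEquiv.prodUnique (R := ℂ) (M := (ofS s).V) (M₂ := (ofL []).V))
    (LinearEquiv.prodUnique (R := ℂ) (M := (ofS s).E) (M₂ := (ofL []).E)) ?_ ?_
  · rintro ⟨x, y⟩; rfl
  · rintro ⟨x, y⟩; rfl

/-- Having a canonical form. -/
def Has (X : Sys) : Prop := ∃ L, (∀ s ∈ L, validS s) ∧ Feq X (ofL L)

theorem Has.of {X Y : Sys} (h : Feq X Y) : Has Y → Has X :=
  fun ⟨L, hv, h'⟩ => ⟨L, hv, h.trans h'⟩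

theorem Has.prod {X Y : Sys} : Has X → Has Y → Has (X.prod Y) :=
  fun ⟨L, hv, h⟩ ⟨L', hv', h'⟩ => ⟨L ++ L', by
    intro s hs
    rcases List.mem_append.1 hs with h | h
    exacts [hv s h, hv' s h], (h.prod h').trans (ofL_append L L')⟩

theorem has_subsingleton {X : Sys} [Subsingleton X.V] [Subsingleton X.E] : Has X :=
  ⟨[], by simp, feq_of_subsingleton⟩

theorem has_ofS {s : Summand} (h : validS s) : Has (ofS s) :=
  ⟨[s], by simpa using h, ofS_single s⟩

theorem Jmat_mulVec (k : ℕ) (c : ℂ) (v : Fin k → ℂ) (i : Fin k) :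
    (Jmat k c *ᵥ v) i = c * v i + if h : 0 < (i : ℕ) then v ⟨i - 1, by omega⟩ else 0 := by
  simp only [Matrix.mulVec, dotProduct, Jmat]
  have : ∀ x : Fin k, (if (i:ℕ) = (x:ℕ) then c else if (i:ℕ) = (x:ℕ) + 1 then 1 else 0) * v x
      = (if i = x then c * v x else 0) + (if (i:ℕ) = (x:ℕ) + 1 then v x else 0) := by
    intro x
    by_cases h : i = x
    · subst h; simp
    · have h' : (i:ℕ) ≠ (x:ℕ) := fun h' => h (Fin.ext h')
      simp [h, h']
  simp only [this, Finset.sum_add_distrib]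
  congr 1
  · simp
  · split_ifs with h
    · rw [Finset.sum_eq_single ⟨i - 1, by omega⟩]
      · rw [if_pos]; simp; omega
      · intro b _ hb
        rw [if_neg]
        intro h'; apply hb; ext; simp; omega
      · simp
    · apply Finset.sum_eq_zero
      intro x _
      rw [if_neg]; omega

theorem jz_aux1 (k : ℕ) (e : Fin 1 → ℂ) : (Fin.cons (e 0) 0 : Fin (k + 1) → ℂ) =
    (fun i _ => if (i:ℕ) = 0 then 1 else 0 : Matrix (Fin (k + 1)) (Fin 1) ℂ) *ᵥ e := by
  ext i
  refine Fin.cases ?_ (fun i => ?_) i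
  · simp [Matrix.mulVec, dotProduct]
  · simp [Matrix.mulVec, dotProduct]

theorem jz_aux2 (k : ℕ) (e : Fin 1 → ℂ) (v : Fin k → ℂ) :
    (Fin.cons 0 ((fun i _ => if (i:ℕ) = 0 then 1 else 0 : Matrix (Fin k) (Fin 1) ℂ) *ᵥ e
      + (Jmat k 0) *ᵥ v) : Fin (k + 1) → ℂ) =
        (Jmat (k+1) 0) *ᵥ (Fin.cons (e 0) v : Fin (k+1) → ℂ) := by
  ext i
  rw [Jmat_mulVec]
  refine Fin.cases ?_ (fun i => ?_) i
  · simp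
  · simp only [Fin.cons_succ, Pi.add_apply]
    rw [Jmat_mulVec]
    rcases i with ⟨i, hi⟩
    cases i with
    | zero => simp [Matrix.mulVec, dotProduct]
    | succ i =>
      simp [Matrix.mulVec, dotProduct]
      rfl

theorem zc_aux1 (e : Fin 1 → ℂ) : e =
    (fun i _ => if (i:ℕ) = 0 then 1 else 0 : Matrix (Fin 1) (Fin 1) ℂ) *ᵥ e := by
  ext i
  have : i = 0 := Subsingleton.elim _ _
  subst this
  simp [Matrix.mulVec, dotProduct]

theorem zc_aux2 (e : Fin 1 → ℂ) : (0 : Fin 1 → ℂ) = Jmat 1 0 *ᵥ e := by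
  ext i
  rw [Jmat_mulVec]; simp

theorem has_lift_ofS (s : Summand) (h : validS s) : Has (ofS s).lift := by
  cases s with
  | jz k =>
    refine Has.of ?_ (has_ofS (s := .jz (k + 1)) (by simp [validS]))
    let T : ((Fin 1 → ℂ) × (Fin k → ℂ)) ≃ₗ[ℂ] (Fin (k + 1) → ℂ) :=
      { toFun := fun p => Fin.cons (p.1 0) p.2
        map_add' := by intro p q; ext i; refine Fin.cases ?_ (fun i => ?_) i <;> simp
        map_smul' := by intro p q; ext i; refine Fin.cases ?_ (fun i => ?_) i <;> simp
        invFun := fun f => (fun _ => f 0, fun i => f i.succ)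
        left_inv := by
          intro p; ext i
          · have : i = 0 := Subsingleton.elim _ _
            simp [this]
          · simp
        right_inv := by intro p; ext i; refine Fin.cases ?_ (fun i => ?_) i <;> simp }
    refine Feq.of_iso' (X := (ofS (.jz k)).lift) (Y := ofS (.jz (k + 1))) T
      (LinearEquiv.refl ℂ (Fin 1 → ℂ)) ?_ ?_
    · intro e; exact jz_aux1 k e
    · rintro ⟨e, v⟩; exact jz_aux2 k e v
  | jl k c =>
    refine Has.of ?_ (has_ofS h)
    have : Unique (ofS (.jl k c)).E := inferInstanceAs (Unique (Fin 0 → ℂ))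
    refine Feq.of_iso' (X := (ofS (.jl k c)).lift) (LinearEquiv.uniqueProd (R := ℂ)
      (M := (ofS (.jl k c)).V) (M₂ := (ofS (.jl k c)).E)) (LinearEquiv.refl ℂ _) ?_ ?_
    · intro e
      have : e = 0 := Subsingleton.elim (α := (ofS (.jl k c)).E) _ _
      subst this
      change (0 : (ofS (.jl k c)).V) = (ofS (.jl k c)).B 0
      simp
    · rintro ⟨e, v⟩
      have : e = 0 := Subsingleton.elim _ _
      subst this
      change (ofS (.jl k c)).B 0 + (ofS (.jl k c)).A v = (ofS (.jl k c)).A v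
      simp
  | zc =>
    refine Has.of ?_ (has_ofS (s := .jz 1) (by simp [validS]))
    have : Unique (ofS .zc).V := inferInstanceAs (Unique (Fin 0 → ℂ))
    refine Feq.of_iso' (X := (ofS .zc).lift) (Y := ofS (.jz 1)) (LinearEquiv.prodUnique (R := ℂ)
      (M := (ofS .zc).E) (M₂ := (ofS .zc).V)) (LinearEquiv.refl ℂ (Fin 1 → ℂ)) ?_ ?_
    · intro e; exact zc_aux1 e
    · rintro ⟨e, v⟩; exact zc_aux2 e

theorem has_lift_ofL (L : List Summand) (hv : ∀ s ∈ L, validS s) : Has (ofL L).lift := by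
  induction L with
  | nil =>
    have : Subsingleton (ofL []).lift.V :=
      inferInstanceAs (Subsingleton ((Fin 0 → ℂ) × (Fin 0 → ℂ)))
    have : Subsingleton (ofL []).lift.E := inferInstanceAs (Subsingleton (Fin 0 → ℂ))
    exact has_subsingleton
  | cons s L ih =>
    refine Has.of ((ofL_prod s L).lift.trans (lift_prod _ _)) ?_
    exact (has_lift_ofS s (hv s (by simp))).prod (ih fun t ht => hv t (by simp [ht]))

theorem Has.lift {X : Sys} : Has X → Has X.lift :=
  fun ⟨L, hv, h⟩ => Has.of h.lift (has_lift_ofL L hv)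


/-- The system with no inputs. -/
def auto (V : Type) [AddCommGroup V] [Module ℂ V] (A : V →ₗ[ℂ] V) : Sys where
  V := V
  E := Fin 0 → ℂ
  B := 0
  A := A

instance (V : Type) [AddCommGroup V] [Module ℂ V] (A : V →ₗ[ℂ] V) : Subsingleton (auto V A).E :=
  inferInstanceAs (Subsingleton (Fin 0 → ℂ))

theorem auto_iso {V V' : Type} [AddCommGroup V] [Module ℂ V] [AddCommGroup V'] [Module ℂ V']
    {A : V →ₗ[ℂ] V} {A' : V' →ₗ[ℂ] V'} (e : V ≃ₗ[ℂ] V') (h : ∀ v, e (A v) = A' (e v)) :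
    Feq (auto V A) (auto V' A') :=
  Feq.of_iso' (X := auto V A) (Y := auto V' A') e (LinearEquiv.refl ℂ (Fin 0 → ℂ))
    (fun _ => e.map_zero) h

theorem auto_prod {V V' : Type} [AddCommGroup V] [Module ℂ V] [AddCommGroup V'] [Module ℂ V']
    (A : V →ₗ[ℂ] V) (A' : V' →ₗ[ℂ] V') :
    Feq (auto (V × V') (A.prodMap A')) ((auto V A).prod (auto V' A')) :=
  Feq.of_iso' (X := auto (V × V') (A.prodMap A')) (Y := (auto V A).prod (auto V' A'))
    (LinearEquiv.refl ℂ (V × V'))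
    (LinearEquiv.ofSubsingleton (Fin 0 → ℂ) ((Fin 0 → ℂ) × (Fin 0 → ℂ)))
    (fun _ => rfl) (fun _ => rfl)

theorem has_pi (ι : Type) [Fintype ι] : ∀ (V : ι → Type) [∀ i, AddCommGroup (V i)]
    [∀ i, Module ℂ (V i)] (A : ∀ i, V i →ₗ[ℂ] V i) (_ : ∀ i, Has (auto (V i) (A i))),
    Has (auto (∀ i, V i) (LinearMap.pi fun i => A i ∘ₗ LinearMap.proj i)) := by
  refine Fintype.induction_empty_option (P := fun ι _ => ∀ (V : ι → Type)
    [∀ i, AddCommGroup (V i)]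
    [∀ i, Module ℂ (V i)] (A : ∀ i, V i →ₗ[ℂ] V i) (_ : ∀ i, Has (auto (V i) (A i))),
    Has (auto (∀ i, V i) (LinearMap.pi fun i => A i ∘ₗ LinearMap.proj i))) ?_ ?_ ?_ ι
  · intro α β _ e ih V _ _ A h
    refine Has.of ?_ (ih (fun a => V (e a)) (fun a => A (e a)) (fun a => h (e a)))
    refine auto_iso (LinearEquiv.piCongrLeft ℂ V e).symm ?_
    intro v
    rfl
  · intro V _ _ A h
    have : Subsingleton (auto (∀ i, V i) (LinearMap.pi fun i => A i ∘ₗ LinearMap.proj i)).V :=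
      inferInstanceAs (Subsingleton (∀ i, V i))
    exact has_subsingleton
  · intro α _ ih V _ _ A h
    refine Has.of ?_ ((h none).prod (ih (fun a => V (some a)) (fun a => A (some a))
      (fun a => h (some a))))
    refine Feq.trans ?_ (auto_prod _ _)
    let T : (∀ i, V i) ≃ₗ[ℂ] (V none × ∀ a, V (some a)) :=
      { Equiv.piOptionEquivProd with
        map_add' := by intro p q; rfl
        map_smul' := by intro p q; rfl }
    exact auto_iso T (fun _ => rfl)

open Polynomial in
/-- System of a polynomial module. -/
noncomputable def autoM (M : Type) [AddCommGroup M] [Module ℂ M] [Module ℂ[X] M]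
    [IsScalarTower ℂ ℂ[X] M] : Sys := auto M (Algebra.lsmul ℂ ℂ M (X : ℂ[X]))

open Polynomial in
theorem autoM_iso {M N : Type} [AddCommGroup M] [Module ℂ M] [Module ℂ[X] M]
    [IsScalarTower ℂ ℂ[X] M] [AddCommGroup N] [Module ℂ N] [Module ℂ[X] N]
    [IsScalarTower ℂ ℂ[X] N] (e : M ≃ₗ[ℂ[X]] N) : Feq (autoM M) (autoM N) :=
  auto_iso (e.restrictScalars ℂ) (fun v => by simp)

open Polynomial in
theorem has_block (c : ℂ) (k : ℕ) :
    Has (autoM (ℂ[X] ⧸ Submodule.span ℂ[X] {(X - C c) ^ (k + 1)})) := by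
  refine Has.of ?_ (has_ofS (s := .jl (k + 1) c) (by simp [validS]))
  set I := Submodule.span ℂ[X] {(X - C c) ^ (k + 1)} with hI
  have hz : ∀ n, k + 1 ≤ n → I.mkQ ((X - C c) ^ n) = 0 := by
    intro n hn
    rw [Submodule.mkQ_apply, Submodule.Quotient.mk_eq_zero, hI]
    exact Ideal.mem_span_singleton.2 (pow_dvd_pow _ hn)
  let T : (Fin (k + 1) → ℂ) →ₗ[ℂ] (ℂ[X] ⧸ I) :=
    Fintype.linearCombination ℂ (fun i : Fin (k + 1) => I.mkQ ((X - C c) ^ (i : ℕ)))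
  have hT : ∀ v, T v = ∑ i, v i • I.mkQ ((X - C c) ^ (i : ℕ)) := fun v => rfl
  have hsurj : Function.Surjective T := by
    intro q
    obtain ⟨f, rfl⟩ := I.mkQ_surjective q
    change I.mkQ f ∈ LinearMap.range T
    rw [← Polynomial.sum_taylor_eq f c, Polynomial.sum, map_sum]
    refine Submodule.sum_mem _ fun n _ => ?_
    rw [← smul_eq_C_mul, LinearMap.map_smul_of_tower]
    refine Submodule.smul_mem _ _ ?_
    by_cases hn : k + 1 ≤ n
    · rw [hz n hn]; exact Submodule.zero_mem _
    · refine ⟨Pi.single ⟨n, by omega⟩ 1, ?_⟩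
      simp [T]
  have hfd : Module.Finite ℂ (ℂ[X] ⧸ I) := Module.Finite.of_surjective T hsurj
  have hrk : Module.finrank ℂ (Fin (k + 1) → ℂ) = Module.finrank ℂ (ℂ[X] ⧸ I) := by
    have := finrank_quotient_span_eq_natDegree (f := (X - C c) ^ (k + 1))
    rw [natDegree_pow, natDegree_X_sub_C, mul_one] at this
    rw [Module.finrank_fin_fun]
    exact this.symm
  have hinj := (LinearMap.injective_iff_surjective_of_finrank_eq_finrank hrk).2 hsurj
  let e := LinearEquiv.ofBijective T ⟨hinj, hsurj⟩
  refine Feq.of_iso (X := autoM (ℂ[X] ⧸ I)) (Y := ofS (.jl (k + 1) c)) e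
    (LinearEquiv.refl ℂ (Fin 0 → ℂ)) ?_ ?_
  · intro x
    have : x = 0 := Subsingleton.elim (α := (Fin 0 → ℂ)) _ _
    subst this
    simp
    exact e.map_zero
  · intro (v : Fin (k + 1) → ℂ)
    have key : T (Jmat (k + 1) c *ᵥ v) = (X : ℂ[X]) • T v := by
      have h1 : ∀ n, (X : ℂ[X]) • I.mkQ ((X - C c) ^ n) =
          c • I.mkQ ((X - C c) ^ n) + I.mkQ ((X - C c) ^ (n + 1)) := by
        intro n
        rw [← LinearMap.map_smul, ← LinearMap.map_smul_of_tower I.mkQ c, ← map_add]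
        congr 1
        rw [smul_eq_C_mul, smul_eq_mul]
        ring
      rw [hT, hT, Finset.smul_sum]
      simp only [Jmat_mulVec, add_smul, Finset.sum_add_distrib]
      simp only [smul_comm (X : ℂ[X]) (_ : ℂ), h1, smul_add, Finset.sum_add_distrib]
      congr 1
      · refine Finset.sum_congr rfl fun i _ => ?_
        rw [smul_smul, mul_comm]
      · rw [Fin.sum_univ_succ, Fin.sum_univ_castSucc]
        simp [hz]
        rfl
    exact key

open Polynomial in
theorem has_quot (p : ℂ[X]) (hp : Irreducible p) (n : ℕ) :
    Has (autoM (ℂ[X] ⧸ Submodule.span ℂ[X] {p ^ n})) := by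
  cases n with
  | zero =>
    have : Subsingleton (autoM (ℂ[X] ⧸ Submodule.span ℂ[X] {p ^ 0})).V := by
      change Subsingleton (ℂ[X] ⧸ Submodule.span ℂ[X] {p ^ 0})
      rw [Submodule.Quotient.subsingleton_iff, pow_zero]
      exact Ideal.span_singleton_one
    have : Subsingleton (autoM (ℂ[X] ⧸ Submodule.span ℂ[X] {p ^ 0})).E :=
      inferInstanceAs (Subsingleton (Fin 0 → ℂ))
    exact has_subsingleton
  | succ k =>
    have hd := IsAlgClosed.degree_eq_one_of_irreducible ℂ hp
    obtain ⟨c, hc⟩ := Polynomial.exists_root_of_degree_eq_one hd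
    have hdv : (X - C c) ∣ p := dvd_iff_isRoot.2 hc
    have has : Associated (X - C c) p :=
      (irreducible_X_sub_C c).associated_of_dvd hp hdv
    refine Has.of ?_ (has_block c k)
    refine autoM_iso (Submodule.quotEquivOfEq _ _ ?_)
    exact Ideal.span_singleton_eq_span_singleton.2 (has.symm.pow_pow)

open Polynomial in
theorem has_jordan (V : Type) [AddCommGroup V] [Module ℂ V] [FiniteDimensional ℂ V]
    (A : V →ₗ[ℂ] V) : Has (auto V A) := by
  have ht : Module.IsTorsion ℂ[X] (Module.AEval' A) :=
    Module.AEval.isTorsion_of_finiteDimensional ℂ V A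
  obtain ⟨ι, _, p, hp, n, ⟨e⟩⟩ := Module.equiv_directSum_of_isTorsion ht
  classical
  have h1 : Has (autoM (Module.AEval' A)) := by
    refine Has.of (autoM_iso (e.trans (DirectSum.linearEquivFunOnFintype ℂ[X] ι _))) ?_
    refine Has.of ?_ (has_pi ι (fun i => ℂ[X] ⧸ Submodule.span ℂ[X] {p i ^ n i})
      (fun i => Algebra.lsmul ℂ ℂ _ (X : ℂ[X])) (fun i => has_quot (p i) (hp i) (n i)))
    exact auto_iso (LinearEquiv.refl ℂ _) (fun _ => rfl)
  refine Has.of ?_ h1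
  refine auto_iso (Module.AEval'.of A) ?_
  intro v
  exact (Module.AEval'.X_smul_of A v).symm

/-- The system with no states. -/
def zcs (K : Type) [AddCommGroup K] [Module ℂ K] : Sys where
  V := Fin 0 → ℂ
  E := K
  B := 0
  A := 0

theorem rowsL_replicate (n : ℕ) : rowsL (List.replicate n .zc) = 0 := by
  induction n with
  | zero => rfl
  | succ n ih => simp [List.replicate_succ, rowsL, rowsS, ih]

theorem colsL_replicate (n : ℕ) : colsL (List.replicate n .zc) = n := by
  induction n with
  | zero => rfl
  | succ n ih => simp [List.replicate_succ, colsL, colsS, ih, add_comm]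

theorem has_zcs (K : Type) [AddCommGroup K] [Module ℂ K] [FiniteDimensional ℂ K] :
    Has (zcs K) := by
  refine ⟨List.replicate (Module.finrank ℂ K) .zc, ?_, ?_⟩
  · intro s hs
    rw [List.eq_of_mem_replicate hs]
    trivial
  · have h1 : Subsingleton (Fin (rowsL (List.replicate (Module.finrank ℂ K) .zc)) → ℂ) := by
      rw [rowsL_replicate]; infer_instance
    have h2 : Subsingleton (zcs K).V := inferInstanceAs (Subsingleton (Fin 0 → ℂ))
    have e : (Fin (colsL (List.replicate (Module.finrank ℂ K) .zc)) → ℂ) ≃ₗ[ℂ] K :=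
      LinearEquiv.ofFinrankEq _ _ (by rw [Module.finrank_fin_fun, colsL_replicate])
    refine Feq.of_iso (X := zcs K) (Y := ofL _)
      (LinearEquiv.ofSubsingleton (Fin (rowsL (List.replicate (Module.finrank ℂ K) .zc)) → ℂ)
        (Fin 0 → ℂ)) e ?_ ?_
    · intro x; exact Subsingleton.elim (α := (zcs K).V) _ _
    · intro x; exact Subsingleton.elim (α := (zcs K).V) _ _

theorem reduce_zero (X : Sys) (h : X.B = 0) : Feq X ((auto X.V X.A).prod (zcs X.E)) := by
  refine Feq.of_iso (X := X) (Y := (auto X.V X.A).prod (zcs X.E))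
    (LinearEquiv.prodUnique (R := ℂ) (M := X.V) (M₂ := Fin 0 → ℂ))
    (LinearEquiv.uniqueProd (R := ℂ) (M := X.E) (M₂ := Fin 0 → ℂ)) ?_ ?_
  · intro x
    rw [h]
    rfl
  · intro x; rfl

/-- The reduced system. -/
noncomputable def red (X : Sys) (C : Submodule ℂ X.V) (hC : IsCompl (LinearMap.range X.B) C) :
    Sys where
  V := C
  E := LinearMap.range X.B
  B := LinearMap.snd ℂ _ _ ∘ₗ (Submodule.prodEquivOfIsCompl _ C hC).symm.toLinearMap ∘ₗ X.A ∘ₗ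
    (LinearMap.range X.B).subtype
  A := LinearMap.snd ℂ _ _ ∘ₗ (Submodule.prodEquivOfIsCompl _ C hC).symm.toLinearMap ∘ₗ X.A ∘ₗ
    C.subtype

theorem feq_red (X : Sys) (C : Submodule ℂ X.V) (hC : IsCompl (LinearMap.range X.B) C) :
    Feq X ((red X C hC).lift.prod (zcs (LinearMap.ker X.B))) := by
  obtain ⟨g, hg⟩ := LinearMap.exists_rightInverse_of_surjective X.B.rangeRestrict
    (LinearMap.range_rangeRestrict _)
  have hg' : ∀ w, X.B (g w) = w := fun w => congrArg Subtype.val (LinearMap.congr_fun hg w)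
  have hg'' : ∀ x, X.B (g (X.B.rangeRestrict x)) = X.B x := fun x => hg' _
  let P : (LinearMap.range X.B × LinearMap.ker X.B) ≃ₗ[ℂ] X.E :=
    LinearEquiv.ofLinearMap (g.coprod (LinearMap.ker X.B).subtype)
      (X.B.rangeRestrict.prod (LinearMap.codRestrict (LinearMap.ker X.B)
        (LinearMap.id - g ∘ₗ X.B.rangeRestrict) (by intro x; simp [hg'])))
      (by ext x; simp)
      (by
        have h1 : ∀ w, X.B.rangeRestrict (g w) = w := fun w => LinearMap.congr_fun hg w
        have h2 : ∀ x : LinearMap.ker X.B, X.B.rangeRestrict x = 0 := fun x => Subtype.ext x.2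
        ext x <;> simp [h1, h2])
  let e := Submodule.prodEquivOfIsCompl _ C hC
  have he : ∀ v, ((e.symm v).1 : X.V) + (e.symm v).2 = v := fun v => e.apply_symm_apply v
  let Q : ((LinearMap.range X.B × C) × (Fin 0 → ℂ)) ≃ₗ[ℂ] X.V :=
    (LinearEquiv.prodUnique (R := ℂ) (M := LinearMap.range X.B × C) (M₂ := Fin 0 → ℂ)).trans e
  let U : ((LinearMap.range X.B × C) × (Fin 0 → ℂ)) →ₗ[ℂ] X.E :=
    - (g ∘ₗ LinearMap.fst ℂ _ _ ∘ₗ e.symm.toLinearMap ∘ₗ X.A ∘ₗ Q.toLinearMap)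
  refine ⟨Q, P, U, ?_, ?_⟩
  · intro z
    obtain ⟨w, k⟩ : LinearMap.range X.B × LinearMap.ker X.B := z
    have key : (w : X.V) + ((0 : C) : X.V) = X.B (g w + k) := by
      rw [map_add, hg', LinearMap.mem_ker.1 k.2]; simp
    exact key
  · intro z
    obtain ⟨⟨w, c⟩, z⟩ : (LinearMap.range X.B × C) × (Fin 0 → ℂ) := z
    have key : (((0 : LinearMap.range X.B) : X.V)) +
        (((e.symm (X.A w)).2 + (e.symm (X.A c)).2 : C) : X.V) =
        X.A (w + c) + X.B (- g (e.symm (X.A (w + c))).1) := by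
      rw [map_neg, hg', ← Prod.snd_add, ← map_add, ← map_add]
      conv_rhs => enter [1]; rw [← he (X.A (w + c))]
      simp
      abel
    exact key

theorem has_all (d : ℕ) : ∀ (X : Sys) [FiniteDimensional ℂ X.V] [FiniteDimensional ℂ X.E],
    Module.finrank ℂ X.V = d → Has X := by
  induction d using Nat.strong_induction_on with
  | _ d ih =>
    intro X _ _ hd
    by_cases h0 : X.B = 0
    · exact Has.of (reduce_zero X h0) ((has_jordan _ _).prod (has_zcs _))
    · obtain ⟨C, hC⟩ := Submodule.exists_isCompl (LinearMap.range X.B)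
      refine Has.of (feq_red X C hC) (Has.prod (Has.lift ?_) (has_zcs _))
      have : FiniteDimensional ℂ (red X C hC).V := inferInstanceAs (FiniteDimensional ℂ C)
      have : FiniteDimensional ℂ (red X C hC).E :=
        inferInstanceAs (FiniteDimensional ℂ (LinearMap.range X.B))
      refine ih (Module.finrank ℂ C) ?_ _ rfl
      have h1 := Submodule.finrank_add_eq_of_isCompl hC
      have h2 : Module.finrank ℂ (LinearMap.range X.B) ≠ 0 := by
        intro h
        rw [Submodule.finrank_eq_zero, LinearMap.range_eq_bot] at h
        exact h0 h
      omega

/-- System of a pair of matrices. -/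
noncomputable def ofP {m n : ℕ} (B : Matrix (Fin m) (Fin n) ℂ) (A : Matrix (Fin m) (Fin m) ℂ) :
    Sys where
  V := Fin m → ℂ
  E := Fin n → ℂ
  B := Matrix.toLin' B
  A := Matrix.toLin' A

theorem isUnit_toMatrix {m : ℕ} (S : (Fin m → ℂ) ≃ₗ[ℂ] (Fin m → ℂ)) :
    IsUnit (LinearMap.toMatrix' S.toLinearMap) := by
  refine IsUnit.of_mul_eq_one (LinearMap.toMatrix' S.symm.toLinearMap) ?_
  rw [← LinearMap.toMatrix'_comp]
  simp

theorem fsp_of_feq {m n : ℕ} {B B' : Matrix (Fin m) (Fin n) ℂ} {A A' : Matrix (Fin m) (Fin m) ℂ}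
    (h : Feq (ofP B A) (ofP B' A')) : FSP (B, A) (B', A') := by
  obtain ⟨S, P, U, hB, hA⟩ := h
  change (Fin m → ℂ) ≃ₗ[ℂ] (Fin m → ℂ) at S
  change (Fin n → ℂ) ≃ₗ[ℂ] (Fin n → ℂ) at P
  change (Fin m → ℂ) →ₗ[ℂ] (Fin n → ℂ) at U
  have hB' : S.toLinearMap ∘ₗ Matrix.toLin' B' = Matrix.toLin' B ∘ₗ P.toLinearMap :=
    LinearMap.ext hB
  have hA' : S.toLinearMap ∘ₗ Matrix.toLin' A' =
      Matrix.toLin' A ∘ₗ S.toLinearMap + Matrix.toLin' B ∘ₗ U :=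
    LinearMap.ext hA
  have hS := isUnit_toMatrix S
  have hS' := (Matrix.isUnit_iff_isUnit_det _).1 hS
  refine ⟨LinearMap.toMatrix' S.toLinearMap, LinearMap.toMatrix' P.toLinearMap,
    LinearMap.toMatrix' U, hS, isUnit_toMatrix P, ?_, ?_⟩
  · have := congrArg LinearMap.toMatrix' hB'
    rw [LinearMap.toMatrix'_comp, LinearMap.toMatrix'_comp, LinearMap.toMatrix'_toLin',
      LinearMap.toMatrix'_toLin'] at this
    simp only
    rw [Matrix.mul_assoc, ← this, Matrix.nonsing_inv_mul_cancel_left _ _ hS']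
  · have := congrArg LinearMap.toMatrix' hA'
    rw [map_add, LinearMap.toMatrix'_comp, LinearMap.toMatrix'_comp, LinearMap.toMatrix'_comp,
      LinearMap.toMatrix'_toLin', LinearMap.toMatrix'_toLin', LinearMap.toMatrix'_toLin'] at this
    simp only
    rw [← this, Matrix.nonsing_inv_mul_cancel_left _ _ hS']

theorem feq_of_fsp {m n : ℕ} {B B' : Matrix (Fin m) (Fin n) ℂ} {A A' : Matrix (Fin m) (Fin m) ℂ}
    (h : FSP (B, A) (B', A')) : Feq (ofP B A) (ofP B' A') := by
  obtain ⟨S, P, U, hS, hP, hB, hA⟩ := h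
  have hS' := (Matrix.isUnit_iff_isUnit_det _).1 hS
  have hP' := (Matrix.isUnit_iff_isUnit_det _).1 hP
  have hB' : S * B' = B * P := by
    rw [show B' = _ from hB, Matrix.mul_assoc, Matrix.mul_nonsing_inv_cancel_left _ _ hS']
  have hA' : S * A' = A * S + B * U := by
    rw [show A' = _ from hA, Matrix.mul_nonsing_inv_cancel_left _ _ hS']
  let e : (Fin m → ℂ) ≃ₗ[ℂ] (Fin m → ℂ) := LinearEquiv.ofLinearMap (Matrix.toLin' S)
    (Matrix.toLin' S⁻¹)
    (by rw [← Matrix.toLin'_mul, Matrix.mul_nonsing_inv _ hS', Matrix.toLin'_one])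
    (by rw [← Matrix.toLin'_mul, Matrix.nonsing_inv_mul _ hS', Matrix.toLin'_one])
  let f : (Fin n → ℂ) ≃ₗ[ℂ] (Fin n → ℂ) := LinearEquiv.ofLinearMap (Matrix.toLin' P)
    (Matrix.toLin' P⁻¹)
    (by rw [← Matrix.toLin'_mul, Matrix.mul_nonsing_inv _ hP', Matrix.toLin'_one])
    (by rw [← Matrix.toLin'_mul, Matrix.nonsing_inv_mul _ hP', Matrix.toLin'_one])
  have he : ∀ v, e v = S *ᵥ v := fun v => by simp [e]
  have hf : ∀ v, f v = P *ᵥ v := fun v => by simp [f]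
  refine ⟨e, f, Matrix.toLin' U, ?_, ?_⟩
  · intro (v : Fin n → ℂ)
    have : S *ᵥ (B' *ᵥ v) = B *ᵥ (P *ᵥ v) := by
      rw [Matrix.mulVec_mulVec, Matrix.mulVec_mulVec, hB']
    rw [← he, ← hf] at this
    exact this
  · intro (v : Fin m → ℂ)
    have : S *ᵥ (A' *ᵥ v) = A *ᵥ (S *ᵥ v) + B *ᵥ (U *ᵥ v) := by
      rw [Matrix.mulVec_mulVec, Matrix.mulVec_mulVec, Matrix.mulVec_mulVec, hA',
        Matrix.add_mulVec]
    rw [← he, ← he] at this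
    exact this

theorem feq_ofL {m n : ℕ} {B : Matrix (Fin m) (Fin n) ℂ} {A : Matrix (Fin m) (Fin m) ℂ}
    {L : List Summand} (hr : rowsL L = m) (hc : colsL L = n)
    (h : FSP (B, A)
        (Matrix.reindex (finCongr hr) (finCongr hc) (dsB L),
         Matrix.reindex (finCongr hr) (finCongr hr) (dsA L))) :
    Feq (ofP B A) (ofL L) := by
  subst hr hc
  exact feq_of_fsp h

theorem fsp_ofL {m n : ℕ} {B : Matrix (Fin m) (Fin n) ℂ} {A : Matrix (Fin m) (Fin m) ℂ}
    {L : List Summand} (h : Feq (ofP B A) (ofL L)) :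
    ∃ (hr : rowsL L = m) (hc : colsL L = n), FSP (B, A)
        (Matrix.reindex (finCongr hr) (finCongr hc) (dsB L),
         Matrix.reindex (finCongr hr) (finCongr hr) (dsA L)) := by
  have hr : rowsL L = m := by
    obtain ⟨S, -⟩ := h
    have S' : (Fin (rowsL L) → ℂ) ≃ₗ[ℂ] (Fin m → ℂ) := S
    have := LinearEquiv.finrank_eq S'
    simpa using this
  have hc : colsL L = n := by
    obtain ⟨-, S, -⟩ := h
    have S' : (Fin (colsL L) → ℂ) ≃ₗ[ℂ] (Fin n → ℂ) := S
    have := LinearEquiv.finrank_eq S'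
    simpa using this
  refine ⟨hr, hc, ?_⟩
  subst hr hc
  exact fsp_of_feq h

theorem exists_form {m n : ℕ} (B : Matrix (Fin m) (Fin n) ℂ) (A : Matrix (Fin m) (Fin m) ℂ) :
    Has (ofP B A) := by
  have : FiniteDimensional ℂ (ofP B A).V := inferInstanceAs (FiniteDimensional ℂ (Fin m → ℂ))
  have : FiniteDimensional ℂ (ofP B A).E := inferInstanceAs (FiniteDimensional ℂ (Fin n → ℂ))
  exact has_all _ _ rfl

/-- One step of the invariant iteration. -/
noncomputable def step (X : Sys) (c : ℂ) (W : Submodule ℂ X.V) : Submodule ℂ X.V :=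
  LinearMap.range X.B ⊔ W.map (X.A - c • LinearMap.id)

theorem mem_step {X : Sys} {c : ℂ} {W : Submodule ℂ X.V} {v : X.V} :
    v ∈ X.step c W ↔ ∃ e, ∃ w ∈ W, X.B e + (X.A w - c • w) = v := by
  unfold step
  rw [Submodule.mem_sup]
  constructor
  · rintro ⟨_, ⟨e, rfl⟩, _, ⟨w, hw, rfl⟩, rfl⟩
    exact ⟨e, w, hw, rfl⟩
  · rintro ⟨e, w, hw, rfl⟩
    exact ⟨_, ⟨e, rfl⟩, _, ⟨w, hw, rfl⟩, rfl⟩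

/-- Iteration. -/
noncomputable def it (X : Sys) (c : ℂ) (W : Submodule ℂ X.V) : ℕ → Submodule ℂ X.V
  | 0 => W
  | j + 1 => X.step c (it X c W j)

theorem map_it {X Y : Sys} (S : Y.V ≃ₗ[ℂ] X.V) (P : Y.E ≃ₗ[ℂ] X.E) (U : Y.V →ₗ[ℂ] X.E)
    (hB : ∀ e, S (Y.B e) = X.B (P e)) (hA : ∀ v, S (Y.A v) = X.A (S v) + X.B (U v))
    (c : ℂ) (W : Submodule ℂ Y.V) (j : ℕ) :
    (Y.it c W j).map S.toLinearMap = X.it c (W.map S.toLinearMap) j := by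
  induction j with
  | zero => rfl
  | succ j ih =>
    rw [it, it, ← ih]
    ext v
    rw [mem_step, Submodule.mem_map]
    constructor
    · rintro ⟨_, hy, rfl⟩
      obtain ⟨e, w, hw, rfl⟩ := mem_step.1 hy
      refine ⟨P e + U w, S w, ⟨w, hw, rfl⟩, ?_⟩
      simp [hA, hB]
      abel
    · rintro ⟨e, _, ⟨w, hw, rfl⟩, rfl⟩
      refine ⟨_, mem_step.2 ⟨P.symm (e - U w), w, hw, rfl⟩, ?_⟩
      simp [hA, hB]
      abel

/-- First family of invariants. -/
noncomputable def dimR (X : Sys) (j : ℕ) : ℕ := Module.finrank ℂ (X.it 0 ⊥ j)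

/-- Second family of invariants. -/
noncomputable def dimQ (X : Sys) (c : ℂ) (j : ℕ) : ℕ := Module.finrank ℂ (X.it c ⊤ j)

theorem Feq.dimR {X Y : Sys} (h : Feq X Y) (j : ℕ) : X.dimR j = Y.dimR j := by
  obtain ⟨S, P, U, hB, hA⟩ := h
  have h1 := map_it S P U hB hA 0 ⊥ j
  rw [Submodule.map_bot] at h1
  unfold Sys.dimR
  rw [← h1]
  exact LinearEquiv.finrank_map_eq S _

theorem Feq.dimQ {X Y : Sys} (h : Feq X Y) (c : ℂ) (j : ℕ) : X.dimQ c j = Y.dimQ c j := by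
  obtain ⟨S, P, U, hB, hA⟩ := h
  have h1 := map_it S P U hB hA c ⊤ j
  rw [Submodule.map_top, LinearEquiv.range] at h1
  unfold Sys.dimQ
  rw [← h1]
  exact LinearEquiv.finrank_map_eq S _

theorem it_prod (X Y : Sys) (c : ℂ) (W : Submodule ℂ X.V) (W' : Submodule ℂ Y.V) (j : ℕ) :
    (X.prod Y).it c (W.prod W') j = (X.it c W j).prod (Y.it c W' j) := by
  induction j with
  | zero => rfl
  | succ j ih =>
    change (X.prod Y).step c ((X.prod Y).it c (W.prod W') j) =
      (X.step c (X.it c W j)).prod (Y.step c (Y.it c W' j))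
    rw [ih]
    apply Submodule.ext
    intro v
    obtain ⟨x, y⟩ : X.V × Y.V := v
    refine Iff.trans mem_step (Iff.trans ?_ Submodule.mem_prod.symm)
    constructor
    · rintro ⟨⟨e, f⟩, ⟨w, w'⟩, ⟨h1, h2⟩, h⟩
      exact ⟨mem_step.2 ⟨e, w, h1, congrArg Prod.fst h⟩,
        mem_step.2 ⟨f, w', h2, congrArg Prod.snd h⟩⟩
    · rintro ⟨h1, h2⟩
      obtain ⟨e, w, hw, h⟩ := mem_step.1 h1
      obtain ⟨f, w', hw', h'⟩ := mem_step.1 h2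
      exact ⟨(e, f), (w, w'), ⟨hw, hw'⟩, Prod.ext h h'⟩

theorem finrank_sprod {V V' : Type} [AddCommGroup V] [Module ℂ V] [AddCommGroup V'] [Module ℂ V']
    [FiniteDimensional ℂ V] [FiniteDimensional ℂ V'] (W : Submodule ℂ V) (W' : Submodule ℂ V') :
    Module.finrank ℂ (W.prod W') = Module.finrank ℂ W + Module.finrank ℂ W' := by
  rw [← Module.finrank_prod]
  refine LinearEquiv.finrank_eq
    { toFun := fun p => (⟨p.1.1, p.2.1⟩, ⟨p.1.2, p.2.2⟩)
      map_add' := fun _ _ => rfl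
      map_smul' := fun _ _ => rfl
      invFun := fun p => ⟨(p.1.1, p.2.1), p.1.2, p.2.2⟩
      left_inv := fun _ => rfl
      right_inv := fun _ => rfl }

theorem dimR_prod (X Y : Sys) [FiniteDimensional ℂ X.V] [FiniteDimensional ℂ Y.V] (j : ℕ) :
    (X.prod Y).dimR j = X.dimR j + Y.dimR j := by
  have h := it_prod X Y 0 ⊥ ⊥ j
  rw [Submodule.prod_bot] at h
  unfold dimR
  refine Eq.trans ?_ (finrank_sprod (X.it 0 ⊥ j) (Y.it 0 ⊥ j))
  rw [← h]
  rfl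

theorem dimQ_prod (X Y : Sys) [FiniteDimensional ℂ X.V] [FiniteDimensional ℂ Y.V] (c : ℂ) (j : ℕ) :
    (X.prod Y).dimQ c j = X.dimQ c j + Y.dimQ c j := by
  have h := it_prod X Y c ⊤ ⊤ j
  rw [Submodule.prod_top] at h
  unfold dimQ
  refine Eq.trans ?_ (finrank_sprod (X.it c ⊤ j) (Y.it c ⊤ j))
  rw [← h]
  rfl

instance (L : List Summand) : FiniteDimensional ℂ (ofL L).V :=
  inferInstanceAs (FiniteDimensional ℂ (Fin (rowsL L) → ℂ))

instance (s : Summand) : FiniteDimensional ℂ (ofS s).V :=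
  inferInstanceAs (FiniteDimensional ℂ (Fin (rowsS s) → ℂ))

theorem dimR_ofL (L : List Summand) (j : ℕ) :
    (ofL L).dimR j = (L.map fun s => (ofS s).dimR j).sum := by
  induction L with
  | nil => exact Module.finrank_zero_of_subsingleton
  | cons s L ih => rw [(ofL_prod s L).dimR, dimR_prod, ih]; simp

theorem dimQ_ofL (L : List Summand) (c : ℂ) (j : ℕ) :
    (ofL L).dimQ c j = (L.map fun s => (ofS s).dimQ c j).sum := by
  induction L with
  | nil => exact Module.finrank_zero_of_subsingleton
  | cons s L ih => rw [(ofL_prod s L).dimQ, dimQ_prod, ih]; simp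

/-- Vectors with only the first `j` coordinates nonzero. -/
def lo (k j : ℕ) : Submodule ℂ (Fin k → ℂ) where
  carrier := {v | ∀ i : Fin k, j ≤ i → v i = 0}
  add_mem' := by
    intro a b ha hb i hi
    simp [ha i hi, hb i hi]
  zero_mem' := by intro i hi; rfl
  smul_mem' := by intro c a ha i hi; simp [ha i hi]

/-- Vectors with the first `j` coordinates zero. -/
def hiS (k j : ℕ) : Submodule ℂ (Fin k → ℂ) where
  carrier := {v | ∀ i : Fin k, (i : ℕ) < j → v i = 0}
  add_mem' := by
    intro a b ha hb i hi
    simp [ha i hi, hb i hi]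
  zero_mem' := by intro i hi; rfl
  smul_mem' := by intro c a ha i hi; simp [ha i hi]

theorem finrank_lo (k j : ℕ) : Module.finrank ℂ (lo k j) = min k j := by
  rw [← Module.finrank_fin_fun ℂ (n := min k j)]
  refine LinearEquiv.finrank_eq
    { toFun := fun v i => v.1 ⟨i, by omega⟩
      map_add' := fun _ _ => rfl
      map_smul' := fun _ _ => rfl
      invFun := fun f => ⟨fun i => if h : (i : ℕ) < min k j then f ⟨i, h⟩ else 0, ?_⟩
      left_inv := ?_
      right_inv := ?_ }
  · intro i hi
    exact dif_neg (by omega)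
  · intro v
    ext i
    by_cases h : (i : ℕ) < min k j
    · simp only [dif_pos h]
    · simp only [dif_neg h]
      exact (v.2 i (by omega)).symm
  · intro f
    ext i
    simp only [i.2, dif_pos]

theorem finrank_hi (k j : ℕ) : Module.finrank ℂ (hiS k j) = k - j := by
  rw [← Module.finrank_fin_fun ℂ (n := k - j)]
  refine LinearEquiv.finrank_eq
    { toFun := fun v i => v.1 ⟨i + j, by omega⟩
      map_add' := fun _ _ => rfl
      map_smul' := fun _ _ => rfl
      invFun := fun f => ⟨fun i => if h : j ≤ (i : ℕ) then f ⟨i - j, by omega⟩ else 0, ?_⟩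
      left_inv := ?_
      right_inv := ?_ }
  · intro i hi
    exact dif_neg (by omega)
  · intro v
    ext i
    by_cases h : j ≤ (i : ℕ)
    · simp only [dif_pos h]
      exact congrArg v.1 (Fin.ext (Nat.sub_add_cancel h))
    · simp only [dif_neg h]
      exact (v.2 i (by omega)).symm
  · intro f
    ext i
    simp

theorem jz_step_lo (k j : ℕ) : (ofS (.jz k)).step 0 (lo k j) = lo k (j + 1) := by
  apply Submodule.ext
  intro (v : Fin k → ℂ)
  have hf : ∀ (e : Fin 1 → ℂ) (w : Fin k → ℂ) (i : Fin k),
      (((fun i _ => if (i:ℕ) = 0 then 1 else 0 : Matrix (Fin k) (Fin 1) ℂ) *ᵥ e) +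
      ((Jmat k 0) *ᵥ w - (0 : ℂ) • w)) i =
      if h : 0 < (i : ℕ) then w ⟨i - 1, by omega⟩ else e 0 := by
    intro e w i
    rw [Pi.add_apply, Pi.sub_apply, Jmat_mulVec]
    by_cases h : 0 < (i : ℕ)
    · simp [h, Matrix.mulVec, dotProduct, h.ne']
    · simp [Matrix.mulVec, dotProduct, show (i : ℕ) = 0 by omega]
  refine Iff.trans mem_step ?_
  constructor
  · rintro ⟨e, w, hw, rfl⟩ i hi
    refine (hf e w i).trans ?_
    rw [dif_pos (by omega)]
    exact hw _ (by simp; omega)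
  · intro hv
    refine ⟨fun _ : Fin 1 => if h : 0 < k then v ⟨0, h⟩ else 0,
      fun i : Fin k => if h : (i : ℕ) + 1 < k then v ⟨i + 1, h⟩ else 0, ?_, ?_⟩
    · intro i hi
      by_cases h : (i : ℕ) + 1 < k
      · simp only [dif_pos h]
        exact hv _ (by simp; omega)
      · simp only [dif_neg h]
    · funext i
      refine (hf _ _ i).trans ?_
      rcases i with ⟨i, hi⟩
      cases i with
      | zero =>
        simp only [lt_irrefl, dite_false]
        exact dif_pos hi
      | succ i =>
        simp only [Nat.succ_pos, dite_true]
        exact dif_pos hi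

theorem jl_step_hi (k j : ℕ) (c : ℂ) : (ofS (.jl k c)).step c (hiS k j) = hiS k (j + 1) := by
  apply Submodule.ext
  intro (v : Fin k → ℂ)
  have hf : ∀ (e : Fin 0 → ℂ) (w : Fin k → ℂ) (i : Fin k),
      (((0 : Matrix (Fin k) (Fin 0) ℂ) *ᵥ e) + ((Jmat k c) *ᵥ w - c • w)) i =
      if h : 0 < (i : ℕ) then w ⟨i - 1, by omega⟩ else 0 := by
    intro e w i
    rw [Pi.add_apply, Pi.sub_apply, Jmat_mulVec]
    simp
  refine Iff.trans mem_step ?_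
  constructor
  · rintro ⟨e, w, hw, rfl⟩ i hi
    refine (hf e w i).trans ?_
    split_ifs with h
    · exact hw _ (by simp; omega)
    · rfl
  · intro hv
    refine ⟨fun _ : Fin 0 => 0,
      fun i : Fin k => if h : (i : ℕ) + 1 < k then v ⟨i + 1, h⟩ else 0, ?_, ?_⟩
    · intro i hi
      by_cases h : (i : ℕ) + 1 < k
      · simp only [dif_pos h]
        exact hv _ (by simp; omega)
      · simp only [dif_neg h]
    · funext i
      refine (hf (fun _ => 0) _ i).trans ?_
      rcases i with ⟨i, hi⟩
      cases i with
      | zero =>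
        simp only [lt_irrefl, dite_false]
        exact (hv ⟨0, hi⟩ (by simp)).symm
      | succ i =>
        simp only [Nat.succ_pos, dite_true]
        exact dif_pos hi

theorem dimR_jz (k j : ℕ) : (ofS (.jz k)).dimR j = min k j := by
  have : (ofS (.jz k)).it 0 ⊥ j = lo k j := by
    induction j with
    | zero =>
      symm
      refine (Submodule.eq_bot_iff (p := lo k 0)).2 ?_
      intro v hv
      funext i
      exact hv i (by omega)
    | succ j ih => rw [it, ih, jz_step_lo]
  unfold dimR
  rw [this]
  exact finrank_lo k j

theorem dimR_jl (k j : ℕ) (c : ℂ) : (ofS (.jl k c)).dimR j = 0 := by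
  have : (ofS (.jl k c)).it 0 ⊥ j = ⊥ := by
    induction j with
    | zero => rfl
    | succ j ih =>
      have : (ofS (.jl k c)).B = 0 := by
        ext x
        have : x = 0 := Subsingleton.elim (α := Fin 0 → ℂ) _ _
        subst this
        rw [map_zero, map_zero]
      rw [it, ih, step, this, Submodule.map_bot, LinearMap.range_zero, sup_bot_eq]
  unfold dimR
  rw [this]
  exact finrank_bot _ _

theorem dimR_zc (j : ℕ) : (ofS .zc).dimR j = 0 := by
  have : Subsingleton (ofS .zc).V := inferInstanceAs (Subsingleton (Fin 0 → ℂ))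
  exact Module.finrank_zero_of_subsingleton

theorem dimQ_zc (c : ℂ) (j : ℕ) : (ofS .zc).dimQ c j = 0 := by
  have : Subsingleton (ofS .zc).V := inferInstanceAs (Subsingleton (Fin 0 → ℂ))
  exact Module.finrank_zero_of_subsingleton

theorem dimQ_jl_same (k j : ℕ) (c : ℂ) : (ofS (.jl k c)).dimQ c j = k - j := by
  have : (ofS (.jl k c)).it c ⊤ j = hiS k j := by
    induction j with
    | zero =>
      symm
      refine (Submodule.eq_top_iff' (p := hiS k 0)).2 ?_
      intro v i hi
      omega
    | succ j ih => rw [it, ih, jl_step_hi]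
  unfold dimQ
  rw [this]
  exact finrank_hi k j

theorem dimQ_of_top (X : Sys) (c : ℂ) (h : X.step c ⊤ = ⊤) (j : ℕ) :
    X.dimQ c j = Module.finrank ℂ X.V := by
  have : X.it c ⊤ j = ⊤ := by
    induction j with
    | zero => rfl
    | succ j ih => rw [it, ih, h]
  unfold dimQ
  rw [this]
  exact finrank_top _ _

theorem jl_inj (k : ℕ) (a c : ℂ) (hac : a ≠ c) (w : Fin k → ℂ)
    (h : Jmat k a *ᵥ w - c • w = 0) : w = 0 := by
  have key : ∀ (i : ℕ) (hi : i < k), w ⟨i, hi⟩ = 0 := by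
    intro i
    induction i with
    | zero =>
      intro hi
      have := congrFun h ⟨0, hi⟩
      rw [Pi.sub_apply, Jmat_mulVec] at this
      simp [← sub_mul, sub_eq_zero, hac] at this
      exact this
    | succ i ih =>
      intro hi
      have := congrFun h ⟨i + 1, hi⟩
      rw [Pi.sub_apply, Jmat_mulVec] at this
      simp [← sub_mul, ih (by omega), sub_eq_zero, hac] at this
      exact this
  funext i
  exact key i i.2

theorem dimQ_jl_ne (k j : ℕ) (a c : ℂ) (hac : a ≠ c) : (ofS (.jl k a)).dimQ c j = k := by
  rw [dimQ_of_top]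
  · exact Module.finrank_fin_fun ℂ
  · let f : (ofS (.jl k a)).V →ₗ[ℂ] (ofS (.jl k a)).V := (ofS (.jl k a)).A - c • LinearMap.id
    have hinj : Function.Injective f := by
      rw [injective_iff_map_eq_zero]
      intro w hw
      exact jl_inj k a c hac w hw
    have hs : Function.Surjective f := LinearMap.injective_iff_surjective.1 hinj
    have hr : LinearMap.range f = ⊤ := LinearMap.range_eq_top.2 hs
    rw [step, Submodule.map_top]
    exact (congrArg (fun W => _ ⊔ W) hr).trans (sup_top_eq _)

theorem jz_single (k : ℕ) (c : ℂ) (i : ℕ) (hi : i + 1 < k) :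
    (Jmat k 0 *ᵥ (Pi.single ⟨i, by omega⟩ 1 : Fin k → ℂ)) -
      c • (Pi.single ⟨i, by omega⟩ 1 : Fin k → ℂ) =
    (Pi.single ⟨i + 1, hi⟩ 1 : Fin k → ℂ) - c • (Pi.single ⟨i, by omega⟩ 1 : Fin k → ℂ) := by
  congr 1
  ext x
  rw [Jmat_mulVec, Pi.single_apply, Pi.single_apply]
  rcases x with ⟨x, hx⟩
  cases x with
  | zero => simp
  | succ x => simp [Pi.single_apply]

theorem dimQ_jz (k j : ℕ) (c : ℂ) : (ofS (.jz k)).dimQ c j = k := by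
  rw [dimQ_of_top]
  · exact Module.finrank_fin_fun ℂ
  · let W : Submodule ℂ (Fin k → ℂ) := (ofS (.jz k)).step c ⊤
    have key : ∀ (i : ℕ) (hi : i < k), (Pi.single ⟨i, hi⟩ 1 : Fin k → ℂ) ∈ W := by
      intro i
      induction i with
      | zero =>
        intro hi
        refine mem_step.2 ⟨(fun _ => 1 : Fin 1 → ℂ), 0, trivial, ?_⟩
        rw [map_zero, smul_zero, sub_zero, add_zero]
        have : (fun i _ => if (i:ℕ) = 0 then 1 else 0 : Matrix (Fin k) (Fin 1) ℂ) *ᵥ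
            (fun _ => 1 : Fin 1 → ℂ) = Pi.single ⟨0, hi⟩ 1 := by
          ext x
          simp [Matrix.mulVec, dotProduct, Pi.single_apply, Fin.ext_iff]
        exact this
      | succ i ih =>
        intro hi
        have h1 : (Jmat k 0 *ᵥ (Pi.single ⟨i, by omega⟩ 1 : Fin k → ℂ))
            - c • (Pi.single ⟨i, by omega⟩ 1 : Fin k → ℂ) ∈ W := by
          refine mem_step.2 ⟨0, (Pi.single ⟨i, by omega⟩ 1 : Fin k → ℂ), trivial, ?_⟩
          rw [map_zero, zero_add]
          rfl
        rw [jz_single k c i hi] at h1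
        have := W.add_mem h1 (W.smul_mem c (ih (by omega)))
        rwa [sub_add_cancel] at this
    have hW : W = ⊤ := by
      rw [Submodule.eq_top_iff']
      intro v
      rw [pi_eq_sum_univ' v]
      exact W.sum_mem fun i _ => W.smul_mem _ (key i i.2)
    exact hW

/-- Sum over a list. -/
theorem total_add {f g h : Summand → ℕ} (L : List Summand) (H : ∀ s ∈ L, f s = g s + h s) :
    (L.map f).sum = (L.map g).sum + (L.map h).sum := by
  induction L with
  | nil => rfl
  | cons s L ih =>
    have h1 := ih fun t ht => H t (by simp [ht])
    have h2 := H s (by simp)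
    simp only [List.map_cons, List.sum_cons]
    omega

open Classical in
theorem total_count (L : List Summand) (t : Summand) :
    (L.map fun s => if s = t then 1 else 0).sum = L.count t := by
  induction L with
  | nil => rfl
  | cons s L ih =>
    simp only [List.map_cons, List.sum_cons, ih, List.count_cons, beq_iff_eq]
    omega

theorem colsL_total (L : List Summand) : colsL L = (L.map colsS).sum := by
  induction L with
  | nil => rfl
  | cons s L ih => simp [colsL, ih]

/-- Counting `jz` blocks of size bigger than `j`. -/
def gS (j : ℕ) : Summand → ℕ
  | .jz k => if j < k then 1 else 0
  | _ => 0

open Classical in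
/-- Counting `jl` blocks of size bigger than `j`. -/
noncomputable def hS (c : ℂ) (j : ℕ) : Summand → ℕ
  | .jl k a => if a = c ∧ j < k then 1 else 0
  | _ => 0

theorem total_g (L : List Summand) (j : ℕ) :
    (ofL L).dimR (j + 1) = (ofL L).dimR j + (L.map (gS j)).sum := by
  rw [dimR_ofL, dimR_ofL]
  apply total_add
  intro s _
  cases s with
  | jz k => 
    rw [dimR_jz, dimR_jz, gS]
    split_ifs <;> omega
  | jl k c => simp [dimR_jl, gS]
  | zc => simp [dimR_zc, gS]

theorem total_h (L : List Summand) (c : ℂ) (j : ℕ) :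
    (ofL L).dimQ c j = (ofL L).dimQ c (j + 1) + (L.map (hS c j)).sum := by
  rw [dimQ_ofL, dimQ_ofL]
  apply total_add
  intro s _
  cases s with
  | jz k => simp [dimQ_jz, hS]
  | jl k a =>
    by_cases h : a = c
    · subst h
      rw [dimQ_jl_same, dimQ_jl_same, hS]
      simp only [true_and]
      split_ifs <;> omega
    · simp [dimQ_jl_ne, hS, h]
  | zc => simp [dimQ_zc, hS]

open Classical in
theorem total_g' (L : List Summand) (j : ℕ) :
    (L.map (gS j)).sum = (L.map (gS (j + 1))).sum + L.count (.jz (j + 1)) := by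
  rw [← total_count]
  apply total_add
  intro s _
  cases s with
  | jz k =>
    simp only [gS, Summand.jz.injEq]
    split_ifs <;> omega
  | jl k c => simp [gS]
  | zc => simp [gS]

open Classical in
theorem total_h' (L : List Summand) (c : ℂ) (j : ℕ) :
    (L.map (hS c j)).sum = (L.map (hS c (j + 1))).sum + L.count (.jl (j + 1) c) := by
  rw [← total_count]
  apply total_add
  intro s _
  cases s with
  | jz k => simp [hS]
  | jl k a =>
    simp only [hS, Summand.jl.injEq]
    by_cases h : a = c
    · simp only [h, true_and, and_true]
      split_ifs <;> omega
    · simp [h]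
  | zc => simp [hS]

open Classical in
theorem total_cols (L : List Summand) (hv : ∀ s ∈ L, validS s) :
    colsL L = (L.map (gS 0)).sum + L.count .zc := by
  rw [← total_count, colsL_total]
  apply total_add
  intro s hs
  have := hv s hs
  cases s with
  | jz k =>
    simp only [validS] at this
    simp [gS, colsS]; omega
  | jl k c => simp [gS, colsS]
  | zc => simp [gS, colsS]

theorem perm_of_feq {X : Sys} {L L' : List Summand} (hv : ∀ s ∈ L, validS s)
    (hv' : ∀ s ∈ L', validS s) (hc : colsL L = colsL L') (h : Feq X (ofL L))
    (h' : Feq X (ofL L')) : L.Perm L' := by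
  classical
  have hR : ∀ j, (ofL L).dimR j = (ofL L').dimR j := fun j => (h.dimR j).symm.trans (h'.dimR j)
  have hQ : ∀ c j, (ofL L).dimQ c j = (ofL L').dimQ c j :=
    fun c j => (h.dimQ c j).symm.trans (h'.dimQ c j)
  have hg : ∀ j, (L.map (gS j)).sum = (L'.map (gS j)).sum := by
    intro j
    have h1 := total_g L j
    have h2 := total_g L' j
    rw [hR, hR] at h1
    omega
  have hh : ∀ c j, (L.map (hS c j)).sum = (L'.map (hS c j)).sum := by
    intro c j
    have h1 := total_h L c j
    have h2 := total_h L' c j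
    rw [hQ, hQ] at h1
    omega
  rw [List.perm_iff_count]
  intro t
  cases t with
  | jz k =>
    cases k with
    | zero =>
      rw [List.count_eq_zero.2, List.count_eq_zero.2]
      · intro hm; exact absurd (hv' _ hm) (by simp [validS])
      · intro hm; exact absurd (hv _ hm) (by simp [validS])
    | succ j =>
      have h1 := total_g' L j
      have h2 := total_g' L' j
      rw [hg, hg] at h1
      omega
  | jl k c =>
    cases k with
    | zero =>
      rw [List.count_eq_zero.2, List.count_eq_zero.2]
      · intro hm; exact absurd (hv' _ hm) (by simp [validS])
      · intro hm; exact absurd (hv _ hm) (by simp [validS])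
    | succ j =>
      have h1 := total_h' L c j
      have h2 := total_h' L' c j
      rw [hh, hh] at h1
      omega
  | zc =>
    have h1 := total_cols L hv
    have h2 := total_cols L' hv'
    rw [hg, hc] at h1
    omega

end Sys

/-- Lemma 3 of the paper: every `m×(n,m)` pair is feedback similar to a
direct sum of pairs of the three indicated forms, and this direct sum is unique up to
permutation of the summands. -/
theorem stmt2 (m n : ℕ) (B : Matrix (Fin m) (Fin n) ℂ) (A : Matrix (Fin m) (Fin m) ℂ) :
    (∃ (L : List Summand) (hr : rowsL L = m) (hc : colsL L = n),
      (∀ s ∈ L, validS s) ∧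
      FSP (B, A)
        (Matrix.reindex (finCongr hr) (finCongr hc) (dsB L),
         Matrix.reindex (finCongr hr) (finCongr hr) (dsA L))) ∧
    (∀ (L L' : List Summand) (hr : rowsL L = m) (hc : colsL L = n)
        (hr' : rowsL L' = m) (hc' : colsL L' = n),
      (∀ s ∈ L, validS s) → (∀ s ∈ L', validS s) →
      FSP (B, A)
        (Matrix.reindex (finCongr hr) (finCongr hc) (dsB L),
         Matrix.reindex (finCongr hr) (finCongr hr) (dsA L)) →
      FSP (B, A)
        (Matrix.reindex (finCongr hr') (finCongr hc') (dsB L'),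
         Matrix.reindex (finCongr hr') (finCongr hr') (dsA L')) →
      L.Perm L') := by
  refine ⟨?_, ?_⟩
  · obtain ⟨L, hv, h⟩ := Sys.exists_form B A
    obtain ⟨hr, hc, h'⟩ := Sys.fsp_ofL h
    exact ⟨L, hr, hc, hv, h'⟩
  · intro L L' hr hc hr' hc' hv hv' h h'
    exact Sys.perm_of_feq hv hv' (hc.trans hc'.symm) (Sys.feq_ofL hr hc h)
      (Sys.feq_ofL hr' hc' h')
end

section
/- Let m ≥ 1 and n ≥ 1. In the space ℂ^{m×(n,m)} of all m×(n,m) pairs, the set of pairs that are feedback similar to 𝔉_{mn} is open and everywhere dense, and it coincides with the set of all m×(n,m) pairs that are rigid with respect to feedback similarity. -/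
open Matrix

/-- The canonical pair `𝔉_{mn}`.  Written entrywise, uniformly in `m, n`:
its `B`-part has entry 1 exactly when `i = j` (this is `F_{mn} = [I_m 0]` when `m ≤ n`,
and `[I_n; 0]` when `m > n`), and its `A`-part has entry 1 exactly when `i = j + n`
(this is `0_m` when `m ≤ n`, and `[0_{n,m}; F_{m-n,m}]` when `m > n`). -/
def Fpair (m n : ℕ) : PairT m n :=
  (fun i j => if (i:ℕ) = (j:ℕ) then 1 else 0,
   fun i j => if (i:ℕ) = (j:ℕ) + n then 1 else 0)

/-- A pair is rigid with respect to feedback similarity if all pairs in some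
`ε`-neighbourhood of it (in the norm `‖(B,A)‖ = ‖B‖+‖A‖`) are feedback similar to it. -/
def RigidP {m n : ℕ} (X : PairT m n) : Prop :=
  ∃ ε : ℝ, 0 < ε ∧ ∀ Y : PairT m n, pnorm (Y - X) < ε → FSP Y X


/-- Lower part of the solution of the linearised equation. -/
def loF (n : ℕ) (d1 d2 : ℕ → ℕ → ℂ) (a b : ℕ) : ℂ :=
  if h : 1 ≤ n ∧ n ≤ b then loF n d1 d2 (a - n) (b - n) - d2 a (b - n) else - d1 a b
termination_by b
decreasing_by omega

/-- Upper part of the solution of the linearised equation. -/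
def hiF (m n : ℕ) (d2 : ℕ → ℕ → ℂ) (a b : ℕ) : ℂ :=
  if h : 1 ≤ n ∧ a + n < m then
    (if b + n < m then hiF m n d2 (a + n) (b + n) else 0) + d2 (a + n) b else 0
termination_by m - a
decreasing_by omega

/-- The space of triples `(S, P, U)`. -/
abbrev SPU (m n : ℕ) :=
  Matrix (Fin m) (Fin m) ℂ × Matrix (Fin n) (Fin n) ℂ × Matrix (Fin n) (Fin m) ℂ

/-- The part of the intertwining equations depending on `X`. -/
def linX {m n : ℕ} (v : SPU m n) : PairT m n →ₗ[ℂ] PairT m n where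
  toFun X := (X.1 * v.2.1, X.2 * v.1 + X.1 * v.2.2)
  map_add' X Y := by
    ext <;> simp [Matrix.add_mul] <;> ring
  map_smul' c X := by
    ext <;> simp <;> ring

/-- The linear intertwining map. -/
def linM {m n : ℕ} (X : PairT m n) : SPU m n →ₗ[ℂ] PairT m n where
  toFun v := linX v X - (v.1 * (Fpair m n).1, v.1 * (Fpair m n).2)
  map_add' v w := by
    ext <;> simp [linX, Matrix.add_mul, Matrix.mul_add] <;> ring
  map_smul' c X := by
    ext <;> simp [linX] <;> ring

lemma F1_mul {m n p : ℕ} (P : Matrix (Fin n) (Fin p) ℂ) (i : Fin m) (j : Fin p) :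
    ((Fpair m n).1 * P) i j = if h : (i : ℕ) < n then P ⟨i, h⟩ j else 0 := by
  rw [Matrix.mul_apply]
  split_ifs with h
  · rw [Finset.sum_eq_single ⟨i, h⟩]
    · simp [Fpair]
    · intro k _ hk
      have : (i : ℕ) ≠ k := fun e => hk (Fin.ext e.symm)
      simp [Fpair, this]
    · simp
  · apply Finset.sum_eq_zero
    intro k _
    have : (i : ℕ) ≠ k := by omega
    simp [Fpair, this]

lemma mul_F1 {m n p : ℕ} (P : Matrix (Fin p) (Fin m) ℂ) (i : Fin p) (j : Fin n) :
    (P * (Fpair m n).1) i j = if h : (j : ℕ) < m then P i ⟨j, h⟩ else 0 := by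
  rw [Matrix.mul_apply]
  split_ifs with h
  · rw [Finset.sum_eq_single ⟨j, h⟩]
    · simp [Fpair]
    · intro k _ hk
      have : (k : ℕ) ≠ j := fun e => hk (Fin.ext e)
      simp [Fpair, this]
    · simp
  · apply Finset.sum_eq_zero
    intro k _
    have : (k : ℕ) ≠ j := by omega
    simp [Fpair, this]

lemma F2_mul {m n p : ℕ} (P : Matrix (Fin m) (Fin p) ℂ) (i : Fin m) (j : Fin p) :
    ((Fpair m n).2 * P) i j =
      if n ≤ (i : ℕ) then P ⟨i - n, by omega⟩ j else 0 := by
  rw [Matrix.mul_apply]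
  split_ifs with h
  · rw [Finset.sum_eq_single ⟨i - n, by omega⟩]
    · have : (i : ℕ) = i - n + n := by omega
      simp [Fpair, ← this]
    · intro k _ hk
      have : (i : ℕ) ≠ k + n := fun e => hk (Fin.ext (by simp; omega))
      simp [Fpair, this]
    · simp
  · apply Finset.sum_eq_zero
    intro k _
    have : (i : ℕ) ≠ k + n := by omega
    simp [Fpair, this]

lemma mul_F2 {m n p : ℕ} (P : Matrix (Fin p) (Fin m) ℂ) (i : Fin p) (j : Fin m) :
    (P * (Fpair m n).2) i j = if h : (j : ℕ) + n < m then P i ⟨j + n, h⟩ else 0 := by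
  rw [Matrix.mul_apply]
  split_ifs with h
  · rw [Finset.sum_eq_single ⟨j + n, h⟩]
    · simp [Fpair]
    · intro k _ hk
      have : (k : ℕ) ≠ j + n := fun e => hk (Fin.ext e)
      simp [Fpair, this]
    · simp
  · apply Finset.sum_eq_zero
    intro k _
    have : (k : ℕ) ≠ j + n := by omega
    simp [Fpair, this]

lemma linM_F_surj (m n : ℕ) (hn : 1 ≤ n) : Function.Surjective (linM (Fpair m n)) := by
  rintro ⟨D1, D2⟩
  let d1 : ℕ → ℕ → ℂ := fun a b => if h : a < m ∧ b < n then D1 ⟨a, h.1⟩ ⟨b, h.2⟩ else 0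
  let d2 : ℕ → ℕ → ℂ := fun a b => if h : a < m ∧ b < m then D2 ⟨a, h.1⟩ ⟨b, h.2⟩ else 0
  have hd1 : ∀ (i : Fin m) (j : Fin n), d1 i j = D1 i j := fun i j => by simp [d1]
  have hd2 : ∀ (i : Fin m) (j : Fin m), d2 i j = D2 i j := fun i j => by simp [d2]
  let s : ℕ → ℕ → ℂ := fun a b => if b < a then loF n d1 d2 a b else hiF m n d2 a b
  have e1 : ∀ i j, n ≤ i → j < n → s i j = - d1 i j := by
    intro i j hi hj
    have : j < i := by omega
    simp only [s, this, if_true]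
    rw [loF, dif_neg (by omega)]
  have e2 : ∀ i j, n ≤ i → i < m → j < m →
      s (i - n) j - (if j + n < m then s i (j + n) else 0) = d2 i j := by
    intro i j hi him hj
    by_cases h : j < i - n
    · have h1 : j + n < m := by omega
      have h2 : j + n < i := by omega
      simp only [s, h, h1, h2, if_true]
      conv_lhs => rw [loF.eq_def n d1 d2 i (j + n), dif_pos (by omega)]
      simp
    · have h2 : ¬ j + n < i := by omega
      simp only [s, h, h2, if_false]
      conv_lhs => rw [hiF.eq_def m n d2 (i - n) j, dif_pos (by omega)]
      rw [show i - n + n = i by omega]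
      ring
  let S : Matrix (Fin m) (Fin m) ℂ := fun i j => s i j
  let P : Matrix (Fin n) (Fin n) ℂ := fun i j => d1 i j + if (j : ℕ) < m then s i j else 0
  let U : Matrix (Fin n) (Fin m) ℂ := fun i j => d2 i j + if (j : ℕ) + n < m then s i (j + n) else 0
  refine ⟨(S, P, U), ?_⟩
  apply Prod.ext
  · ext i j
    simp only [linM, linX, LinearMap.coe_mk, AddHom.coe_mk, Prod.fst_sub, Matrix.sub_apply,
      F1_mul, mul_F1]
    rw [← hd1]
    by_cases h : (i : ℕ) < n
    · simp [h, P, S]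
    · have : (j : ℕ) < m := by omega
      simp [h, this, S, e1 i j (by omega) j.2]
  · ext i j
    simp only [linM, linX, LinearMap.coe_mk, AddHom.coe_mk, Prod.snd_sub, Matrix.sub_apply,
      Matrix.add_apply, F1_mul, mul_F2, F2_mul]
    rw [← hd2]
    by_cases h : (i : ℕ) < n
    · have h' : ¬ n ≤ (i : ℕ) := by omega
      simp [h, h', U, S]
    · have h' : n ≤ (i : ℕ) := by omega
      have := e2 i j h' i.2 j.2
      simp [h, h', S, ← this]

lemma FSP_iff {m n : ℕ} (X Y : PairT m n) : FSP X Y ↔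
    ∃ (S : Matrix (Fin m) (Fin m) ℂ) (P : Matrix (Fin n) (Fin n) ℂ)
    (U : Matrix (Fin n) (Fin m) ℂ),
    IsUnit S ∧ IsUnit P ∧ S * Y.1 = X.1 * P ∧ S * Y.2 = X.2 * S + X.1 * U := by
  have key : ∀ {p : ℕ} (S : Matrix (Fin m) (Fin m) ℂ) (M N : Matrix (Fin m) (Fin p) ℂ),
      IsUnit S → (M = S⁻¹ * N ↔ S * M = N) := by
    intro p S M N hS
    have hd := (Matrix.isUnit_iff_isUnit_det S).1 hS
    constructor
    · rintro rfl
      exact Matrix.mul_nonsing_inv_cancel_left S N hd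
    · rintro rfl
      exact (Matrix.nonsing_inv_mul_cancel_left S M hd).symm
  unfold FSP
  constructor
  · rintro ⟨S, P, U, hS, hP, h1, h2⟩
    rw [Matrix.mul_assoc] at h1
    exact ⟨S, P, U, hS, hP, (key S _ _ hS).1 h1, (key S _ _ hS).1 h2⟩
  · rintro ⟨S, P, U, hS, hP, h1, h2⟩
    refine ⟨S, P, U, hS, hP, ?_, (key S _ _ hS).2 h2⟩
    rw [Matrix.mul_assoc]
    exact (key S _ _ hS).2 h1

lemma FSP_symm {m n : ℕ} {X Y : PairT m n} (h : FSP X Y) : FSP Y X := by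
  rw [FSP_iff] at h ⊢
  obtain ⟨S, P, U, hS, hP, h1, h2⟩ := h
  obtain ⟨S, rfl⟩ := hS
  obtain ⟨P, rfl⟩ := hP
  refine ⟨(S⁻¹ : _ˣ).val, (P⁻¹ : _ˣ).val, - ((P⁻¹ : _ˣ).val * U * (S⁻¹ : _ˣ).val),
    Units.isUnit _, Units.isUnit _, ?_, ?_⟩
  · have a : Y.1 = (S⁻¹ : _ˣ).val * (S.val * Y.1) := by
      rw [← Matrix.mul_assoc, Units.inv_mul, Matrix.one_mul]
    rw [a, h1, Matrix.mul_assoc, Matrix.mul_assoc, Units.mul_inv, Matrix.mul_one]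
  · have a1 : Y.1 = (S⁻¹ : _ˣ).val * (X.1 * P.val) := by
      rw [← h1, ← Matrix.mul_assoc, Units.inv_mul, Matrix.one_mul]
    have a2 : Y.2 = (S⁻¹ : _ˣ).val * (X.2 * S.val + X.1 * U) := by
      rw [← h2, ← Matrix.mul_assoc, Units.inv_mul, Matrix.one_mul]
    have p : X.1 * P.val * ((P⁻¹ : _ˣ).val * U * (S⁻¹ : _ˣ).val) = X.1 * U * (S⁻¹ : _ˣ).val := by
      calc _ = X.1 * (P.val * (P⁻¹ : _ˣ).val) * U * (S⁻¹ : _ˣ).val := by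
            simp only [Matrix.mul_assoc]
        _ = _ := by rw [Units.mul_inv, Matrix.mul_one]
    have q : X.2 * S.val * (S⁻¹ : _ˣ).val = X.2 := by
      rw [Matrix.mul_assoc, Units.mul_inv, Matrix.mul_one]
    rw [a1, a2, Matrix.mul_neg, Matrix.mul_assoc, Matrix.mul_assoc, p, Matrix.add_mul, q,
      Matrix.mul_add]
    abel

lemma FSP_trans {m n : ℕ} {X Y Z : PairT m n} (h : FSP X Y) (h' : FSP Y Z) : FSP X Z := by
  rw [FSP_iff] at h h' ⊢
  obtain ⟨S, P, U, hS, hP, h1, h2⟩ := h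
  obtain ⟨S', P', U', hS', hP', h1', h2'⟩ := h'
  refine ⟨S * S', P * P', U * S' + P * U', hS.mul hS', hP.mul hP', ?_, ?_⟩
  · rw [Matrix.mul_assoc, h1', ← Matrix.mul_assoc, h1, Matrix.mul_assoc]
  · rw [Matrix.mul_assoc, h2', Matrix.mul_add, ← Matrix.mul_assoc, h2, ← Matrix.mul_assoc, h1]
    simp only [Matrix.add_mul, Matrix.mul_add, Matrix.mul_assoc]
    abel

section
attribute [local instance] Matrix.normedAddCommGroup Matrix.normedSpace

lemma diff_det {E : Type*} [NormedAddCommGroup E] [NormedSpace ℂ E] {k : Type*} [Fintype k]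
    [DecidableEq k] (f : E → Matrix k k ℂ) (hf : ∀ i j, Differentiable ℂ fun x => f x i j) :
    Differentiable ℂ fun x => (f x).det := by
  simp only [Matrix.det_apply']
  fun_prop

lemma diff_lin {m n : ℕ} (g : PairT m n →ₗ[ℂ] ℂ) : Differentiable ℂ fun x => g x :=
  (LinearMap.toContinuousLinearMap g).differentiable

/-- A holomorphic function, nonzero at the canonical pair, whose nonvanishing implies
similarity to the canonical pair. -/
lemma exists_q (m n : ℕ) (hn : 1 ≤ n) : ∃ q : PairT m n → ℂ, Differentiable ℂ q ∧
    q (Fpair m n) ≠ 0 ∧ ∀ X, q X ≠ 0 → FSP X (Fpair m n) := by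
  obtain ⟨R, hR⟩ := LinearMap.exists_rightInverse_of_surjective (linM (Fpair m n))
    (LinearMap.range_eq_top.2 (linM_F_surj m n hn))
  let b := Module.finBasis ℂ (PairT m n)
  let v0 : SPU m n := (1, 1, 0)
  let N : PairT m n → Matrix _ _ ℂ := fun X => LinearMap.toMatrix b b (linM X ∘ₗ R)
  let c : PairT m n → _ → ℂ := fun X => b.repr (linM X v0)
  let w : PairT m n → SPU m n := fun X =>
    (N X).det • v0 - ∑ i, ((N X).adjugate *ᵥ c X) i • R (b i)
  have hlin : ∀ v i, Differentiable ℂ fun X : PairT m n => b.repr (linM X v) i := by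
    intro v i
    have : (fun X : PairT m n => b.repr (linM X v) i) = fun X =>
        (b.coord i ∘ₗ linX v) X - b.repr (v.1 * (Fpair m n).1, v.1 * (Fpair m n).2) i := by
      funext X
      simp [linM]
    rw [this]
    exact (diff_lin _).sub_const _
  have hN : ∀ i j, Differentiable ℂ fun X => N X i j := by
    intro i j
    simp only [N, LinearMap.toMatrix_apply, LinearMap.comp_apply]
    exact hlin _ _
  have hadj : ∀ i j, Differentiable ℂ fun X => (N X).adjugate i j := by
    intro i j
    simp only [Matrix.adjugate_apply]
    apply diff_det
    intro k l
    simp only [Matrix.updateRow_apply]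
    split_ifs
    · fun_prop
    · exact hN k l
  have hdet : Differentiable ℂ fun X => (N X).det := diff_det _ hN
  have hcoef : ∀ i, Differentiable ℂ fun X => ((N X).adjugate *ᵥ c X) i := by
    intro i
    simp only [Matrix.mulVec, dotProduct]
    apply Differentiable.fun_sum
    intro j _
    exact (hadj i j).mul (hlin _ _)
  have hker : ∀ X, linM X (w X) = 0 := by
    intro X
    apply b.repr.injective
    ext i
    have e1 : ∀ v, linM X (R v) = (linM X ∘ₗ R) v := fun v => rfl
    have e2 : (N X *ᵥ ((N X).adjugate *ᵥ c X)) i = (N X).det * c X i := by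
      rw [Matrix.mulVec_mulVec, Matrix.mul_adjugate, Matrix.smul_mulVec, Matrix.one_mulVec]
      rfl
    have e3 : ∀ j, b.repr (linM X (R (b j))) i = N X i j := by
      intro j
      simp only [N, LinearMap.toMatrix_apply, LinearMap.comp_apply]
    simp only [w, map_sub, map_sum, map_smul, map_zero, Finsupp.sub_apply, Finsupp.smul_apply,
      Finsupp.finsetSum_apply, e3, smul_eq_mul, Finsupp.zero_apply]
    have e4 : ∑ x, ((N X).adjugate *ᵥ c X) x * N X i x = (N X).det * c X i := by
      rw [← e2]
      simp only [Matrix.mulVec, dotProduct]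
      exact Finset.sum_congr rfl fun _ _ => mul_comm _ _
    rw [e4]
    simp [c]
  have hwF : w (Fpair m n) = v0 := by
    have h1 : N (Fpair m n) = 1 := by
      simp only [N, hR]
      exact LinearMap.toMatrix_id b
    have h2 : linM (Fpair m n) v0 = 0 := by
      ext <;> simp [linM, linX, v0]
    have h3 : c (Fpair m n) = 0 := by
      simp [c, h2]
    simp [w, h1, h3]
  have hw1 : ∀ i j, Differentiable ℂ fun X => (w X).1 i j := by
    intro i j
    have : (fun X => (w X).1 i j) = fun X => (N X).det * v0.1 i j -
        ∑ k, ((N X).adjugate *ᵥ c X) k * (R (b k)).1 i j := by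
      funext X
      simp [w, Prod.fst_sum, Matrix.sum_apply]
    rw [this]
    exact (hdet.mul_const _).sub (Differentiable.fun_sum fun k _ => (hcoef k).mul_const _)
  have hw2 : ∀ i j, Differentiable ℂ fun X => (w X).2.1 i j := by
    intro i j
    have : (fun X => (w X).2.1 i j) = fun X => (N X).det * v0.2.1 i j -
        ∑ k, ((N X).adjugate *ᵥ c X) k * (R (b k)).2.1 i j := by
      funext X
      simp [w, Prod.fst_sum, Prod.snd_sum, Matrix.sum_apply]
    rw [this]
    exact (hdet.mul_const _).sub (Differentiable.fun_sum fun k _ => (hcoef k).mul_const _)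
  refine ⟨fun X => (w X).1.det * (w X).2.1.det, (diff_det _ hw1).mul (diff_det _ hw2), ?_, ?_⟩
  · simp [hwF, v0]
  · intro X hX
    rw [FSP_iff]
    have hk := hker X
    refine ⟨(w X).1, (w X).2.1, (w X).2.2, ?_, ?_, ?_, ?_⟩
    · rw [Matrix.isUnit_iff_isUnit_det]
      exact (left_ne_zero_of_mul hX).isUnit
    · rw [Matrix.isUnit_iff_isUnit_det]
      exact (right_ne_zero_of_mul hX).isUnit
    · have := congrArg Prod.fst hk
      exact (sub_eq_zero.1 this).symm
    · have := congrArg Prod.snd hk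
      exact (sub_eq_zero.1 this).symm

lemma entry_le_fnorm {p q : ℕ} (M : Matrix (Fin p) (Fin q) ℂ) (i : Fin p) (j : Fin q) :
    ‖M i j‖ ≤ fnorm M := by
  apply Real.le_sqrt_of_sq_le
  calc ‖M i j‖ ^ 2 ≤ ∑ j, ‖M i j‖ ^ 2 :=
        Finset.single_le_sum (f := fun j => ‖M i j‖ ^ 2) (fun _ _ => by positivity)
          (Finset.mem_univ j)
    _ ≤ _ := Finset.single_le_sum (f := fun i => ∑ j, ‖M i j‖ ^ 2) (fun _ _ => by positivity)
          (Finset.mem_univ i)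

lemma norm_le_pnorm {m n : ℕ} (X : PairT m n) : ‖X‖ ≤ pnorm X := by
  have h1 : 0 ≤ fnorm X.1 := Real.sqrt_nonneg _
  have h2 : 0 ≤ fnorm X.2 := Real.sqrt_nonneg _
  unfold pnorm
  rw [Prod.norm_def]
  apply max_le
  · exact ((Matrix.norm_le_iff h1).2 (entry_le_fnorm _)).trans (by linarith)
  · exact ((Matrix.norm_le_iff h2).2 (entry_le_fnorm _)).trans (by linarith)

lemma part_open (m n : ℕ) (hn : 1 ≤ n) (X : PairT m n) (h : FSP X (Fpair m n)) :
    ∃ ε : ℝ, 0 < ε ∧ ∀ Y : PairT m n, pnorm (Y - X) < ε → FSP Y (Fpair m n) := by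
  obtain ⟨q, hq, hqF, hqX⟩ := exists_q m n hn
  obtain ⟨S, P, U, hS, hP, h1, h2⟩ := h
  let T : PairT m n → PairT m n := fun Y => (S⁻¹ * Y.1 * P, S⁻¹ * (Y.2 * S + Y.1 * U))
  have hT : Continuous T := by
    dsimp only [T]
    fun_prop
  have hTX : T X = Fpair m n := Prod.ext h1.symm h2.symm
  have hc : Continuous fun Y => q (T Y) := hq.continuous.comp hT
  have hev : ∀ᶠ Y in nhds X, q (T Y) ≠ 0 :=
    hc.continuousAt.eventually_ne (by simpa [hTX] using hqF)
  obtain ⟨ε, hε, hY⟩ := Metric.eventually_nhds_iff.1 hev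
  refine ⟨ε, hε, fun Y hYX => ?_⟩
  have : dist Y X < ε := by
    rw [dist_eq_norm]
    exact (norm_le_pnorm _).trans_lt hYX
  exact FSP_trans ⟨S, P, U, hS, hP, rfl, rfl⟩ (hqX _ (hY this))

lemma part_dense (m n : ℕ) (hn : 1 ≤ n) (X : PairT m n) (ε : ℝ) (hε : 0 < ε) :
    ∃ Y : PairT m n, FSP Y (Fpair m n) ∧ pnorm (Y - X) < ε := by
  obtain ⟨q, hq, hqF, hqX⟩ := exists_q m n hn
  let L : ℂ → PairT m n := fun t => X + t • (Fpair m n - X)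
  have hL : Differentiable ℂ L := by
    dsimp only [L]
    fun_prop
  have hf : Differentiable ℂ fun t => q (L t) := hq.comp hL
  have hp : ∀ᶠ t in nhds (0 : ℂ), pnorm (L t - X) < ε := by
    have hc : Continuous fun t => pnorm (L t - X) := by
      simp only [L, pnorm, fnorm, add_sub_cancel_left, Prod.smul_fst, Prod.smul_snd,
        Matrix.smul_apply]
      fun_prop
    have h0 : pnorm (L 0 - X) < ε := by
      simpa [L, pnorm, fnorm] using hε
    exact hc.continuousAt.eventually_lt continuousAt_const h0
  by_contra hcon
  push Not at hcon
  have hz : (fun t => q (L t)) =ᶠ[nhds 0] fun _ => 0 := by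
    filter_upwards [hp] with t ht
    by_contra hne
    exact absurd ht (not_lt.2 (hcon _ (hqX _ hne)))
  have ha : AnalyticOnNhd ℂ (fun t => q (L t)) Set.univ :=
    fun t _ => hf.analyticAt t
  have := ha.eq_of_eventuallyEq (fun t _ => analyticAt_const) hz
  apply hqF
  have h1 := congrFun this 1
  simpa [L] using h1

end

/-- Theorem 6(a) of the paper: the set of pairs feedback similar to
`𝔉_{mn}` is open, everywhere dense, and coincides with the set of rigid pairs. -/
theorem stmt4 (m n : ℕ) (hm : 1 ≤ m) (hn : 1 ≤ n) :
    (∀ X : PairT m n, FSP X (Fpair m n) →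
      ∃ ε : ℝ, 0 < ε ∧ ∀ Y : PairT m n, pnorm (Y - X) < ε → FSP Y (Fpair m n)) ∧
    (∀ X : PairT m n, ∀ ε : ℝ, 0 < ε →
      ∃ Y : PairT m n, FSP Y (Fpair m n) ∧ pnorm (Y - X) < ε) ∧
    (∀ X : PairT m n, FSP X (Fpair m n) ↔ RigidP X) := by
  refine ⟨part_open m n hn, part_dense m n hn, fun X => ⟨fun h => ?_, fun h => ?_⟩⟩
  · obtain ⟨ε, hε, hY⟩ := part_open m n hn X h
    exact ⟨ε, hε, fun Y hYX => FSP_trans (hY Y hYX) (FSP_symm h)⟩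
  · obtain ⟨ε, hε, hY⟩ := h
    obtain ⟨Y, hYF, hYX⟩ := part_dense m n hn X ε hε
    exact FSP_trans (FSP_symm (hY Y hYX)) hYF
end

section
/- Let (C,B,A) be an m×(n,m,m) triple with n ≥ 1, and let ε > 0. Then there exists an m×(n,m,m) triple Δ with ‖Δ‖ < ε such that (C,B,A) + Δ is feedback similar to: (G_{mn}, 0_m, 0_m) if m ≤ n; and 𝒦(N) for some matrix N ∈ ℂ^{(m−n)×m} if m > n. -/
open Matrix

/-- `G_{mn} = [0_{m,n-m} I_m]` (for `m ≤ n`), entrywise: entry 1 iff `j = i + (n-m)`. -/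
def Gmat (m n : ℕ) : Matrix (Fin m) (Fin n) ℂ := fun i j =>
  if (j:ℕ) = (i:ℕ) + (n - m) then 1 else 0

/-- For `m > n`, `m = αn + β` with `0 < β ≤ n`, and `N ∈ ℂ^{(m-n)×m}`, the triple
`𝒦(N) = ([I_n; 0], [0_{n,m}; H_{m-n,m}], [0_{n,m}; N])`, where
`H_{m-n,m} = [[I_{(α-1)n}, 0, 0], [0, G_{βn}, 0_β]]`, written entrywise. -/
def Ktriple (m n α β : ℕ) (N : Matrix (Fin (m - n)) (Fin m) ℂ) : TripleT m n :=
  (fun i j => if (i:ℕ) = (j:ℕ) then 1 else 0,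
   fun i j =>
     if (i:ℕ) < n then 0
     else if (i:ℕ) - n < (α - 1) * n then (if (j:ℕ) = (i:ℕ) - n then 1 else 0)
     else (if (j:ℕ) = (i:ℕ) - β then 1 else 0),
   fun i j =>
     if h : (i:ℕ) < n then 0
     else N ⟨(i:ℕ) - n, by have := i.isLt; omega⟩ j)


/-- `W r = ∑_{i<r} B^i im C`. -/
noncomputable def Wlin {m n : ℕ} (C : Matrix (Fin m) (Fin n) ℂ) (B : Matrix (Fin m) (Fin m) ℂ)
    (r : ℕ) : (ℕ → Fin n → ℂ) →ₗ[ℂ] (Fin m → ℂ) :=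
  ∑ i ∈ Finset.range r, (B ^ i * C).mulVecLin ∘ₗ LinearMap.proj i

lemma Wlin_apply {m n : ℕ} (C : Matrix (Fin m) (Fin n) ℂ) (B : Matrix (Fin m) (Fin m) ℂ)
    (r : ℕ) (w : ℕ → Fin n → ℂ) :
    Wlin C B r w = ∑ i ∈ Finset.range r, (B ^ i * C) *ᵥ w i := by
  simp [Wlin, LinearMap.sum_apply]

lemma Wlin_mem {m n : ℕ} (C : Matrix (Fin m) (Fin n) ℂ) (B : Matrix (Fin m) (Fin m) ℂ)
    {r i : ℕ} (hi : i < r) (x : Fin n → ℂ) :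
    (B ^ i * C) *ᵥ x ∈ LinearMap.range (Wlin C B r) := by
  refine ⟨Pi.single i x, ?_⟩
  rw [Wlin_apply, Finset.sum_eq_single i]
  · simp
  · intro j _ hj
    simp [Pi.single_eq_of_ne hj]
  · intro h; simp at h; omega

/-- The chain of vectors generated by feedback. -/
noncomputable def chainS {m n : ℕ} (C : Matrix (Fin m) (Fin n) ℂ) (B : Matrix (Fin m) (Fin m) ℂ)
    (d : Fin n → ℂ) (v : ℕ → Fin n → ℂ) : ℕ → Fin m → ℂ
  | 0 => C *ᵥ d
  | i + 1 => B *ᵥ chainS C B d v i + C *ᵥ v i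

lemma chainS_eq {m n : ℕ} (C : Matrix (Fin m) (Fin n) ℂ) (B : Matrix (Fin m) (Fin m) ℂ)
    (d : Fin n → ℂ) (v : ℕ → Fin n → ℂ) (i : ℕ) :
    chainS C B d v i = (B ^ i * C) *ᵥ d
      + ∑ t ∈ Finset.range i, (B ^ (i - 1 - t) * C) *ᵥ v t := by
  induction i with
  | zero => simp [chainS]
  | succ i ih =>
    rw [chainS, ih, Finset.sum_range_succ, Matrix.mulVec_add, Matrix.mulVec_mulVec,
      ← Matrix.mul_assoc, ← pow_succ', add_assoc]
    congr 1
    rw [Matrix.mulVec_sum]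
    congr 1
    · apply Finset.sum_congr rfl
      intro t ht
      rw [Finset.mem_range] at ht
      rw [Matrix.mulVec_mulVec, ← Matrix.mul_assoc, ← pow_succ']
      congr 3
      omega
    · simp

lemma exists_feedback {m n : ℕ} (C : Matrix (Fin m) (Fin n) ℂ) (B : Matrix (Fin m) (Fin m) ℂ)
    (d : Fin n → ℂ) (l : ℕ) (h : (B ^ l * C) *ᵥ d ∈ LinearMap.range (Wlin C B l)) :
    ∃ v : ℕ → Fin n → ℂ, chainS C B d v l = 0 := by
  obtain ⟨w, hw⟩ := h
  refine ⟨fun t => - w (l - 1 - t), ?_⟩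
  rw [chainS_eq, ← hw, Wlin_apply,
    ← Finset.sum_range_reflect (fun i => (B ^ i * C) *ᵥ w i), ← Finset.sum_add_distrib]
  apply Finset.sum_eq_zero
  intro t _
  simp [Matrix.mulVec_neg]

/-- Chain length. -/
def lenF {n : ℕ} (α β : ℕ) (k : Fin n) : ℕ := if (k : ℕ) < n - β then α else α + 1

lemma main_reduction {m n : ℕ} (α β : ℕ) (C : Matrix (Fin m) (Fin n) ℂ)
    (B : Matrix (Fin m) (Fin m) ℂ)
    (kk : Fin m → Fin n) (ii : Fin m → ℕ)
    (h1 : ∀ p, ii p < lenF α β (kk p))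
    (h2 : ∀ k r, r < lenF α β k → ∃ p, kk p = k ∧ ii p = r)
    (hR : IsUnit (Matrix.of fun a p => (B ^ ii p * C) a (kk p) : Matrix (Fin m) (Fin m) ℂ)) :
    ∃ (S : Matrix (Fin m) (Fin m) ℂ) (P : Matrix (Fin n) (Fin n) ℂ)
      (V : Matrix (Fin n) (Fin m) ℂ) (s : Fin n → ℕ → Fin m → ℂ),
      IsUnit S ∧ IsUnit P ∧ (∀ p, S.col p = s (kk p) (ii p)) ∧
      (∀ k, (C * P).col k = s k 0) ∧
      (∀ p, (B * S + C * V).col p = s (kk p) (ii p + 1)) ∧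
      (∀ k, s k (lenF α β k) = 0) := by
  classical
  set R : Matrix (Fin m) (Fin m) ℂ := Matrix.of fun a p => (B ^ ii p * C) a (kk p) with hRdef
  -- spanning
  have hspan : ∀ x : Fin m → ℂ, ∃ u : Fin n → ℂ, (∀ k : Fin n, (k : ℕ) < n - β → u k = 0) ∧
      x - (B ^ α * C) *ᵥ u ∈ LinearMap.range (Wlin C B α) := by
    intro x
    set y := R⁻¹ *ᵥ x with hy
    have hx : x = R *ᵥ y := by
      rw [hy, Matrix.mulVec_mulVec, Matrix.mul_nonsing_inv _ ((Matrix.isUnit_iff_isUnit_det _).1 hR),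
        Matrix.one_mulVec]
    have hx2 : x = ∑ p, y p • ((B ^ ii p * C) *ᵥ Pi.single (kk p) 1) := by
      rw [hx]
      ext a
      simp [Matrix.mulVec, dotProduct, R, mul_comm]
    refine ⟨∑ p, if ii p < α then 0 else y p • Pi.single (kk p) 1, ?_, ?_⟩
    · intro k hk
      rw [Finset.sum_apply]
      apply Finset.sum_eq_zero
      intro p _
      split_ifs with h
      · rfl
      · have hne : k ≠ kk p := by
          rintro rfl
          have := h1 p
          rw [lenF, if_pos hk] at this
          omega
        simp [Pi.single_eq_of_ne hne]
    · rw [hx2, Matrix.mulVec_sum, ← Finset.sum_sub_distrib]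
      apply Submodule.sum_mem
      intro p _
      split_ifs with h
      · rw [Matrix.mulVec_zero, sub_zero]
        exact Submodule.smul_mem _ _ (Wlin_mem C B h _)
      · have : ii p = α := by
          have := h1 p
          rw [lenF] at this
          split_ifs at this <;> omega
        rw [this, Matrix.mulVec_smul, sub_self]
        exact Submodule.zero_mem _
  have hd : ∀ k : Fin n, ∃ u : Fin n → ℂ, (∀ j : Fin n, (j : ℕ) < n - β → u j = 0) ∧
      (¬ (k : ℕ) < n - β → u = 0) ∧
      (B ^ lenF α β k * C) *ᵥ (Pi.single k 1 - u) ∈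
        LinearMap.range (Wlin C B (lenF α β k)) := by
    intro k
    by_cases hk : (k : ℕ) < n - β
    · obtain ⟨u, hu, hu2⟩ := hspan ((B ^ α * C) *ᵥ Pi.single k 1)
      refine ⟨u, hu, fun h => absurd hk h, ?_⟩
      rw [lenF, if_pos hk, Matrix.mulVec_sub]
      exact hu2
    · refine ⟨0, fun _ _ => rfl, fun _ => rfl, ?_⟩
      rw [lenF, if_neg hk]
      obtain ⟨u, hu, w, hw⟩ := hspan ((B ^ (α + 1) * C) *ᵥ (Pi.single k 1 - 0))
      have : (B ^ (α + 1) * C) *ᵥ (Pi.single k 1 - 0) = Wlin C B α w + (B ^ α * C) *ᵥ u := by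
        rw [hw]; abel
      rw [this]
      refine Submodule.add_mem _ ?_ (Wlin_mem C B (Nat.lt_succ_self _) _)
      rw [Wlin_apply]
      apply Submodule.sum_mem
      intro i hi
      rw [Finset.mem_range] at hi
      exact Wlin_mem C B (by omega) _
  choose u hu1 hu2 hu3 using hd
  choose v hv using fun k => exists_feedback C B _ _ (hu3 k)
  set Q : Matrix (Fin n) (Fin n) ℂ := Matrix.of fun a k => u k a with hQ
  have hQQ : Q * Q = 0 := by
    ext a b
    rw [Matrix.mul_apply]
    apply Finset.sum_eq_zero
    intro c _
    by_cases hc : (c : ℕ) < n - β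
    · simp [Q, hu1 b c hc]
    · simp [Q, hu2 c hc]
  have hPinv : (1 - Q) * (1 + Q) = 1 := by
    rw [Matrix.sub_mul, Matrix.mul_add, Matrix.mul_add, hQQ]; simp
  have hPcol : ∀ k, (1 - Q) *ᵥ Pi.single k 1 = Pi.single k 1 - u k := by
    intro k
    rw [Matrix.sub_mulVec, Matrix.one_mulVec]
    congr 1
    ext a
    simp [Q]
  set s : Fin n → ℕ → Fin m → ℂ := fun k => chainS C B (Pi.single k 1 - u k) (v k) with hs
  set S : Matrix (Fin m) (Fin m) ℂ := Matrix.of fun a p => s (kk p) (ii p) a with hS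
  set V : Matrix (Fin n) (Fin m) ℂ := Matrix.of fun a p => v (kk p) (ii p) a with hV
  have hSmem : ∀ k r, r < lenF α β k → s k r ∈ LinearMap.range S.mulVecLin := by
    intro k r hr
    obtain ⟨p, rfl, rfl⟩ := h2 k r hr
    refine ⟨Pi.single p 1, ?_⟩
    ext a
    simp [S]
  have key : ∀ k r, r < lenF α β k →
      LinearMap.range (Wlin C B r) ≤ LinearMap.range S.mulVecLin →
      (B ^ r * C) *ᵥ (Pi.single k 1 - u k) ∈ LinearMap.range S.mulVecLin := by
    intro k r hr hW
    have h := hSmem k r hr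
    simp only [hs] at h
    rw [chainS_eq] at h
    refine (Submodule.add_mem_iff_left _ ?_).1 h
    apply Submodule.sum_mem
    intro t ht
    rw [Finset.mem_range] at ht
    exact hW (Wlin_mem C B (by omega) _)
  have hW : ∀ r, r ≤ α → LinearMap.range (Wlin C B r) ≤ LinearMap.range S.mulVecLin := by
    intro r
    induction r with
    | zero =>
      rintro _ _ ⟨w, rfl⟩
      simp [Wlin_apply]
    | succ r ih =>
      intro hr
      have ih := ih (by omega)
      rintro _ ⟨w, rfl⟩
      rw [Wlin_apply, Finset.sum_range_succ, ← Wlin_apply]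
      refine Submodule.add_mem _ (ih ⟨w, rfl⟩) ?_
      have : w r = ∑ k, ((1 + Q) *ᵥ w r) k • (Pi.single k 1 - u k) := by
        have e : w r = (1 - Q) *ᵥ ((1 + Q) *ᵥ w r) := by
          rw [Matrix.mulVec_mulVec, hPinv, Matrix.one_mulVec]
        conv_lhs => rw [e]
        generalize (1 + Q) *ᵥ w r = z
        simp_rw [← hPcol, ← Matrix.mulVec_smul]
        rw [← Matrix.mulVec_sum]
        congr 1
        ext a
        simp [Finset.sum_apply, Pi.single_apply]
      rw [this, Matrix.mulVec_sum]
      apply Submodule.sum_mem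
      intro k _
      rw [Matrix.mulVec_smul]
      refine Submodule.smul_mem _ _ (key k r ?_ ih)
      rw [lenF]; split_ifs <;> omega
  have hsurj : Function.Surjective S.mulVec := by
    intro x
    have : x ∈ LinearMap.range S.mulVecLin := by
      obtain ⟨z, hz, hz2⟩ := hspan x
      have e : x = (x - (B ^ α * C) *ᵥ z) + (B ^ α * C) *ᵥ z := by abel
      rw [e]
      refine Submodule.add_mem _ (hW α le_rfl hz2) ?_
      have : z = ∑ k, z k • (Pi.single k 1 : Fin n → ℂ) := by
        ext a
        simp [Finset.sum_apply, Pi.single_apply]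
      rw [this, Matrix.mulVec_sum]
      apply Submodule.sum_mem
      intro k _
      by_cases hk : (k : ℕ) < n - β
      · rw [hz k hk]; simp
      · rw [Matrix.mulVec_smul]
        refine Submodule.smul_mem _ _ ?_
        have := key k α (by rw [lenF, if_neg hk]; omega) (hW α le_rfl)
        rwa [hu2 k hk, sub_zero] at this
    exact this
  refine ⟨S, 1 - Q, V, s, Matrix.mulVec_surjective_iff_isUnit.1 hsurj,
    ?_, ?_, ?_, ?_, ?_⟩
  · rw [Matrix.isUnit_iff_isUnit_det]
    exact Matrix.isUnit_det_of_right_inverse hPinv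
  · intro p; ext a; simp [S]
  · intro k
    rw [← Matrix.mulVec_single_one, ← Matrix.mulVec_mulVec, hPcol]
    rfl
  · intro p
    have hSc : S.col p = s (kk p) (ii p) := by ext a; simp [S]
    have hVc : V.col p = v (kk p) (ii p) := by ext a; simp [V]
    rw [← Matrix.mulVec_single_one, Matrix.add_mulVec, ← Matrix.mulVec_mulVec,
      ← Matrix.mulVec_mulVec, Matrix.mulVec_single_one, Matrix.mulVec_single_one, hSc, hVc]
    rfl
  · intro k; exact hv k

/-- Truncated controllability matrix. -/
def ctrb {R : Type*} [CommRing R] {m n : ℕ} (kk : Fin m → Fin n) (ii : Fin m → ℕ)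
    (C : Matrix (Fin m) (Fin n) R) (B : Matrix (Fin m) (Fin m) R) : Matrix (Fin m) (Fin m) R :=
  Matrix.of fun a p => (B ^ ii p * C) a (kk p)

lemma ctrb_map {R R' : Type*} [CommRing R] [CommRing R'] (f : R →+* R') {m n : ℕ}
    (kk : Fin m → Fin n) (ii : Fin m → ℕ)
    (C : Matrix (Fin m) (Fin n) R) (B : Matrix (Fin m) (Fin m) R) :
    (ctrb kk ii C B).map f = ctrb kk ii (C.map f) (B.map f) := by
  ext a p
  have : (B.map f) ^ ii p * C.map f = (B ^ ii p * C).map f := by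
    rw [Matrix.map_mul]
    congr 1
    exact (map_pow f.mapMatrix B (ii p)).symm
  simp only [ctrb, Matrix.map_apply, Matrix.of_apply, this]

lemma exists_small {m n : ℕ} (kk : Fin m → Fin n) (ii : Fin m → ℕ)
    (C D : Matrix (Fin m) (Fin n) ℂ) (B E : Matrix (Fin m) (Fin m) ℂ)
    (h : IsUnit (ctrb kk ii (C + D) (B + E))) (δ : ℝ) (hδ : 0 < δ) :
    ∃ t : ℝ, 0 < t ∧ t < δ ∧ IsUnit (ctrb kk ii (C + (t : ℂ) • D) (B + (t : ℂ) • E)) := by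
  set CX : Matrix (Fin m) (Fin n) (Polynomial ℂ) :=
    Matrix.of fun a b => Polynomial.C (C a b) + Polynomial.X * Polynomial.C (D a b) with hCX
  set BX : Matrix (Fin m) (Fin m) (Polynomial ℂ) :=
    Matrix.of fun a b => Polynomial.C (B a b) + Polynomial.X * Polynomial.C (E a b) with hBX
  set q : Polynomial ℂ := (ctrb kk ii CX BX).det with hq
  have hev : ∀ t : ℂ, q.eval t = (ctrb kk ii (C + t • D) (B + t • E)).det := by
    intro t
    have e := RingHom.map_det (Polynomial.evalRingHom t) (ctrb kk ii CX BX)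
    rw [Polynomial.coe_evalRingHom] at e
    rw [hq, e, RingHom.mapMatrix_apply, ctrb_map]
    congr 2
    · ext a b; simp [CX]; ring
    · ext a b; simp [BX]; ring
  have hq0 : q ≠ 0 := by
    intro h0
    have := hev 1
    rw [h0, one_smul, one_smul, Polynomial.eval_zero] at this
    rw [Matrix.isUnit_iff_isUnit_det, ← this] at h
    simp at h
  have hfin : {t : ℝ | q.eval (t : ℂ) = 0}.Finite := by
    have h1 : {z : ℂ | q.IsRoot z}.Finite := Polynomial.finite_setOfPred_isRoot hq0
    exact h1.preimage (Complex.ofReal_injective.injOn)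
  obtain ⟨t, ht, ht2⟩ := (Set.Ioo_infinite hδ).exists_notMem_finite hfin
  refine ⟨t, ht.1, ht.2, ?_⟩
  rw [Matrix.isUnit_iff_isUnit_det, ← hev]
  exact isUnit_iff_ne_zero.2 ht2

lemma exists_model {m n α β : ℕ} (hn : 1 ≤ n)
    (hdec : m = α * n + β) (hβn : β ≤ n) (kk : Fin m → Fin n) (ii : Fin m → ℕ)
    (h2 : ∀ k r, r < lenF α β k → ∃ p, kk p = k ∧ ii p = r) :
    ∃ C0 B0, IsUnit (ctrb (R := ℂ) kk ii C0 B0) := by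
  set C0 : Matrix (Fin m) (Fin n) ℂ :=
    Matrix.of fun a k => if (a : ℕ) = (k + β) % n then 1 else 0 with hC0
  set B0 : Matrix (Fin m) (Fin m) ℂ :=
    Matrix.of fun a p => if (a : ℕ) = p + n then 1 else 0 with hB0
  have hpow : ∀ (i : ℕ) (a : Fin m) (k : Fin n),
      (B0 ^ i * C0) a k = if (a : ℕ) = (k + β) % n + i * n then 1 else 0 := by
    intro i
    induction i with
    | zero => intro a k; simp [C0]
    | succ i ih =>
      intro a k
      rw [pow_succ', Matrix.mul_assoc, Matrix.mul_apply]
      simp only [ih, B0, Matrix.of_apply]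
      have e : (i + 1) * n = i * n + n := by ring
      rw [e]
      split_ifs with h
      · have ha := a.isLt
        rw [Finset.sum_eq_single ⟨(k + β) % n + i * n, by omega⟩]
        · rw [if_pos (by simp only; omega), if_pos rfl, one_mul]
        · intro b _ hb
          rw [if_neg (fun h' => hb (Fin.ext h')), mul_zero]
        · simp
      · apply Finset.sum_eq_zero
        intro b _
        by_cases h1 : (a : ℕ) = b + n
        · rw [if_neg (c := (b : ℕ) = _) (by omega), mul_zero]
        · rw [if_neg h1, zero_mul]
  refine ⟨C0, B0, ?_⟩
  have hf : ∀ q : Fin m, ∃ p, ∀ a, ctrb kk ii C0 B0 a p = if a = q then 1 else 0 := by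
    intro q
    have hr : (q : ℕ) % n < n := Nat.mod_lt _ (by omega)
    have hdm : n * ((q : ℕ) / n) + (q : ℕ) % n = q := Nat.div_add_mod _ _
    have hkn : ((q : ℕ) % n + (n - β)) % n < n := Nat.mod_lt _ (by omega)
    have hq := q.isLt
    obtain ⟨p, hp1, hp2⟩ := h2 ⟨((q : ℕ) % n + (n - β)) % n, hkn⟩ ((q : ℕ) / n) (by
      have hle : (q : ℕ) / n ≤ α := by
        by_contra hc
        have : n * (α + 1) ≤ n * ((q : ℕ) / n) := Nat.mul_le_mul_left _ (by omega)
        have e : n * (α + 1) = α * n + n := by ring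
        omega
      rw [lenF]
      split_ifs with h
      · simp only at h
        rcases hle.lt_or_eq with h' | h'
        · exact h'
        · exfalso
          rw [h', mul_comm] at hdm
          rw [Nat.mod_eq_of_lt (by omega)] at h
          omega
      · omega)
    refine ⟨p, fun a => ?_⟩
    simp only [ctrb, Matrix.of_apply, hp1, hp2, hpow]
    have e : (((q : ℕ) % n + (n - β)) % n + β) % n = (q : ℕ) % n := by
      rw [Nat.mod_add_mod, add_assoc, Nat.sub_add_cancel hβn, Nat.add_mod_right, Nat.mod_mod]
    rw [e]
    have : ((a : ℕ) = (q : ℕ) % n + (q : ℕ) / n * n) ↔ a = q := by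
      rw [Fin.ext_iff, mul_comm, add_comm, hdm]
    simp only [this]
  choose f hf using hf
  rw [Matrix.isUnit_iff_isUnit_det]
  refine Matrix.isUnit_det_of_right_inverse (B := Matrix.of fun p q => if p = f q then 1 else 0) ?_
  ext a q
  rw [Matrix.mul_apply]
  simp [hf, Matrix.one_apply]

lemma fnorm_smul {p q : ℕ} (t : ℝ) (ht : 0 ≤ t) (M : Matrix (Fin p) (Fin q) ℂ) :
    fnorm ((t : ℂ) • M) = t * fnorm M := by
  rw [fnorm, fnorm]
  simp only [Matrix.smul_apply, smul_eq_mul, norm_mul, mul_pow, ← Finset.mul_sum]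
  rw [Real.sqrt_mul (by positivity), Complex.norm_real, Real.norm_eq_abs, sq_abs, Real.sqrt_sq ht]

lemma fnorm_nonneg {p q : ℕ} (M : Matrix (Fin p) (Fin q) ℂ) : 0 ≤ fnorm M := Real.sqrt_nonneg _

lemma exists_index {m n : ℕ} (α β : ℕ) (hn : 1 ≤ n)
    (hdec : m = α * n + β) (hβn : β ≤ n) :
    ∃ (kk : Fin m → Fin n) (ii : Fin m → ℕ),
      (∀ p, ii p < lenF α β (kk p)) ∧
      (∀ p : Fin m, (p : ℕ) = if ii p < α then ii p * n + kk p else α * n + (kk p - (n - β))) ∧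
      (∀ (k : Fin n) (r : ℕ) (p : Fin m), r < lenF α β k →
        (p : ℕ) = (if r < α then r * n + k else α * n + (k - (n - β))) → kk p = k ∧ ii p = r) ∧
      (∀ k r, r < lenF α β k → ∃ p, kk p = k ∧ ii p = r) := by
  have h3 : ∀ (k : Fin n) (r : ℕ) (p : Fin m), r < lenF α β k →
      (p : ℕ) = (if r < α then r * n + k else α * n + (k - (n - β))) →
      (if (p : ℕ) < α * n then (p : ℕ) % n else p - α * n + (n - β)) = k ∧
      (if (p : ℕ) < α * n then (p : ℕ) / n else α) = r := by
    intro k r p hr hp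
    have hk := k.isLt
    by_cases h : r < α
    · rw [if_pos h] at hp
      have : (r + 1) * n ≤ α * n := Nat.mul_le_mul_right _ h
      have e : (r + 1) * n = r * n + n := by ring
      rw [if_pos (by omega), if_pos (by omega), hp]
      constructor
      · rw [Nat.mul_add_mod_self_right, Nat.mod_eq_of_lt hk]
      · rw [add_comm, Nat.add_mul_div_right _ _ (by omega), Nat.div_eq_of_lt hk, zero_add]
    · rw [if_neg h] at hp
      rw [if_neg (by omega), if_neg (by omega)]
      rw [lenF] at hr
      split_ifs at hr <;> omega
  refine ⟨fun p => ⟨if (p : ℕ) < α * n then (p : ℕ) % n else p - α * n + (n - β), ?_⟩,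
    fun p => if (p : ℕ) < α * n then (p : ℕ) / n else α, ?_, ?_, ?_, ?_⟩
  · have := p.isLt
    split_ifs
    · exact Nat.mod_lt _ (by omega)
    · omega
  · intro p
    have := p.isLt
    by_cases h : (p : ℕ) < α * n
    · have h' : (p : ℕ) / n < α := Nat.div_lt_of_lt_mul (by rwa [mul_comm])
      simp only [lenF, if_pos h]
      split_ifs <;> omega
    · simp only [lenF, if_neg h]
      split_ifs <;> omega
  · intro p
    have := p.isLt
    by_cases h : (p : ℕ) < α * n
    · have h' : (p : ℕ) / n < α := Nat.div_lt_of_lt_mul (by rwa [mul_comm])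
      simp only [if_pos h, if_pos h']
      rw [mul_comm, Nat.div_add_mod]
    · simp only [if_neg h, lt_irrefl, if_false]
      omega
  · intro k r p hr hp
    obtain ⟨a, b⟩ := h3 k r p hr hp
    exact ⟨Fin.ext a, b⟩
  · intro k r hr
    have hlt : (if r < α then r * n + k else α * n + (k - (n - β))) < m := by
      have hk := k.isLt
      split_ifs with h
      · have : (r + 1) * n ≤ α * n := Nat.mul_le_mul_right _ h
        have e : (r + 1) * n = r * n + n := by ring
        omega
      · rw [lenF] at hr
        split_ifs at hr <;> omega
    obtain ⟨a, b⟩ := h3 k r ⟨_, hlt⟩ hr rfl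
    exact ⟨⟨_, hlt⟩, Fin.ext a, b⟩

lemma fst_of_eqs {m n : ℕ} (C : Matrix (Fin m) (Fin n) ℂ) (B A : Matrix (Fin m) (Fin m) ℂ)
    (C' : Matrix (Fin m) (Fin n) ℂ) (B' A' : Matrix (Fin m) (Fin m) ℂ)
    (S : Matrix (Fin m) (Fin m) ℂ) (P : Matrix (Fin n) (Fin n) ℂ) (V M : Matrix (Fin n) (Fin m) ℂ)
    (hS : IsUnit S) (hP : IsUnit P) (h1 : C * P = S * C') (h2 : B * S + C * V = S * B')
    (h3 : A' = S⁻¹ * (A * S) + C' * M) : FST (C, B, A) (C', B', A') := by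
  have hd := (Matrix.isUnit_iff_isUnit_det _).1 hS
  refine ⟨S, P, P * M, V, hS, hP, ?_, ?_, ?_⟩
  · simp only
    rw [Matrix.mul_assoc, h1, Matrix.nonsing_inv_mul_cancel_left _ _ hd]
  · simp only
    rw [h2, Matrix.nonsing_inv_mul_cancel_left _ _ hd]
  · simp only
    rw [h3, Matrix.mul_add, ← Matrix.mul_assoc C, h1, Matrix.mul_assoc S,
      Matrix.nonsing_inv_mul_cancel_left _ _ hd]

lemma col_mul_single {m l : ℕ} (S : Matrix (Fin m) (Fin m) ℂ) (M : Matrix (Fin m) (Fin l) ℂ)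
    (j : Fin l) (p : Fin m) (h : ∀ q, M q j = if q = p then 1 else 0) :
    (S * M).col j = S.col p := by
  ext a
  simp [Matrix.mul_apply, h]

lemma col_mul_zero {m l : ℕ} (S : Matrix (Fin m) (Fin m) ℂ) (M : Matrix (Fin m) (Fin l) ℂ)
    (j : Fin l) (h : ∀ q, M q j = 0) :
    (S * M).col j = 0 := by
  ext a
  simp [Matrix.mul_apply, h]

lemma ext_col' {m l : ℕ} {M N : Matrix (Fin m) (Fin l) ℂ} (h : ∀ j, M.col j = N.col j) :
    M = N := by
  ext a b
  exact congrFun (h b) a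

/-- first part of Lemma 8 of the paper: every `m×(n,m,m)` triple with
`n ≥ 1` is transformed by an arbitrarily small perturbation into a triple that is feedback
similar to `(G_{mn}, 0, 0)` if `m ≤ n`, and to `𝒦(N)` for some `N ∈ ℂ^{(m-n)×m}` if
`m > n`. -/
theorem stmt7 (m n α β : ℕ) (hm : 1 ≤ m) (hn : 1 ≤ n)
    (hdec : m = α * n + β) (hβ0 : 0 < β) (hβn : β ≤ n)
    (T : TripleT m n) (ε : ℝ) (hε : 0 < ε) :
    ∃ Δ : TripleT m n, tnorm Δ < ε ∧
      (m ≤ n → FST (T + Δ) (Gmat m n, 0, 0)) ∧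
      (n < m → ∃ N : Matrix (Fin (m - n)) (Fin m) ℂ, FST (T + Δ) (Ktriple m n α β N)) := by

  classical
  obtain ⟨kk, ii, h1, hpos, huniq, h2⟩ := exists_index α β hn hdec hβn
  obtain ⟨C0, B0, hunit⟩ := exists_model hn hdec hβn kk ii h2
  obtain ⟨C, B, A⟩ := T
  set K : ℝ := fnorm (C0 - C) + fnorm (B0 - B) with hK
  have hK0 : 0 ≤ K := add_nonneg (fnorm_nonneg _) (fnorm_nonneg _)
  obtain ⟨t, ht0, ht1, hu⟩ := exists_small kk ii C (C0 - C) B (B0 - B)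
    (by rwa [add_sub_cancel, add_sub_cancel]) (ε / (K + 1)) (by positivity)
  refine ⟨((t : ℂ) • (C0 - C), (t : ℂ) • (B0 - B), 0), ?_, ?_⟩
  · have h0 : fnorm (0 : Matrix (Fin m) (Fin m) ℂ) = 0 := by simp [fnorm]
    rw [tnorm, fnorm_smul _ ht0.le, fnorm_smul _ ht0.le, h0, add_zero, ← mul_add, ← hK]
    rw [lt_div_iff₀ (by positivity)] at ht1
    nlinarith
  have hT : ((C, B, A) : TripleT m n) + ((t : ℂ) • (C0 - C), (t : ℂ) • (B0 - B), 0)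
      = (C + (t : ℂ) • (C0 - C), B + (t : ℂ) • (B0 - B), A) := by
    simp
  rw [hT]
  generalize C + (t : ℂ) • (C0 - C) = C at hu
  generalize B + (t : ℂ) • (B0 - B) = B at hu
  obtain ⟨S, P, V, s, hS, hP, hSs, hCs, hBs, hs0⟩ := main_reduction α β C B kk ii h1 h2 hu
  constructor
  · intro hmn
    have hα : α = 0 := by
      by_contra h
      have : 1 * n ≤ α * n := Nat.mul_le_mul_right _ (by omega)
      omega
    subst hα
    have hmβ : m = β := by omega
    refine fst_of_eqs C B A _ _ _ S P V (-((Gmat m n)ᵀ * (S⁻¹ * (A * S)))) hS hP ?_ ?_ ?_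
    · apply ext_col'
      intro k
      rw [hCs]
      have hk := k.isLt
      by_cases hk' : (k : ℕ) < n - β
      · rw [col_mul_zero]
        · have := hs0 k
          rwa [lenF, if_pos hk'] at this
        · intro q
          rw [Gmat, if_neg (by omega)]
      · have hlt : (k : ℕ) - (n - β) < m := by omega
        obtain ⟨e1, e2⟩ := huniq k 0 ⟨_, hlt⟩ (by rw [lenF, if_neg hk']; omega) (by simp)
        rw [col_mul_single S _ k ⟨_, hlt⟩, hSs, e1, e2]
        intro q
        rw [Gmat]
        congr 1
        rw [Fin.ext_iff, eq_iff_iff]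
        simp only
        omega
    · rw [Matrix.mul_zero]
      apply ext_col'
      intro p
      rw [hBs]
      have h := h1 p
      have h' := hs0 (kk p)
      have e : ii p + 1 = lenF 0 β (kk p) := by
        rw [lenF] at h ⊢
        split_ifs at h ⊢ <;> omega
      rw [e, h']
      rfl
    · have hG : Gmat m n * (Gmat m n)ᵀ = 1 := by
        ext a b
        have ha := a.isLt
        rw [Matrix.mul_apply, Finset.sum_eq_single ⟨(a : ℕ) + (n - m), by omega⟩]
        · simp only [Gmat, Matrix.transpose_apply, Matrix.one_apply, Fin.ext_iff]
          simp
        · intro c _ hc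
          rw [Gmat, if_neg (fun h => hc (Fin.ext h)), zero_mul]
        · simp
      rw [Matrix.mul_neg, ← Matrix.mul_assoc (Gmat m n), hG, Matrix.one_mul, add_neg_cancel]
  · intro hmn
    obtain ⟨a, rfl⟩ : ∃ a, α = a + 1 := by
      refine ⟨α - 1, ?_⟩
      rcases Nat.eq_zero_or_pos α with h | h
      · subst h; omega
      · omega
    have ean : (a + 1) * n = a * n + n := by ring
    obtain ⟨A1, hA1⟩ : ∃ A1, A1 = S⁻¹ * (A * S) := ⟨_, rfl⟩
    refine ⟨Matrix.of fun i j => A1 ⟨i + n, by omega⟩ j, ?_⟩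
    obtain ⟨C', B', A', hK', hC', hB', hA'⟩ : ∃ (C' : Matrix (Fin m) (Fin n) ℂ)
        (B' A' : Matrix (Fin m) (Fin m) ℂ),
        Ktriple m n (a + 1) β (Matrix.of fun i j => A1 ⟨i + n, by omega⟩ j) = (C', B', A') ∧
        (∀ i j, C' i j = if (i:ℕ) = (j:ℕ) then 1 else 0) ∧
        (∀ i j, B' i j = if (i:ℕ) < n then 0
          else if (i:ℕ) - n < (a + 1 - 1) * n then (if (j:ℕ) = (i:ℕ) - n then 1 else 0)
          else (if (j:ℕ) = (i:ℕ) - β then 1 else 0)) ∧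
        (∀ i j, A' i j = if h : (i:ℕ) < n then 0
          else A1 ⟨(i:ℕ) - n + n, by have := i.isLt; omega⟩ j) :=
      ⟨_, _, _, rfl, fun _ _ => rfl, fun _ _ => rfl, fun _ _ => rfl⟩
    rw [hK']
    refine fst_of_eqs C B A _ _ _ S P V
      (-(Matrix.of fun (i : Fin n) j => A1 ⟨i, by omega⟩ j)) hS hP ?_ ?_ ?_
    · apply ext_col'
      intro k
      rw [hCs]
      have hk := k.isLt
      obtain ⟨e1, e2⟩ := huniq k 0 ⟨k, by omega⟩
        (by rw [lenF]; split_ifs <;> omega) (by simp)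
      rw [col_mul_single S _ k ⟨k, by omega⟩, hSs, e1, e2]
      intro q
      simp only [hC', Fin.ext_iff]
    · apply ext_col'
      intro p
      rw [hBs]
      have hp := hpos p
      have h := h1 p
      have hk := (kk p).isLt
      have hpm := p.isLt
      by_cases hl : ii p + 1 < lenF (a + 1) β (kk p)
      · obtain ⟨q, hq1, hq2⟩ := h2 (kk p) (ii p + 1) hl
        rw [col_mul_single S _ p q, hSs, hq1, hq2]
        intro x
        have hq := hpos q
        rw [hq1, hq2] at hq
        have hx := x.isLt
        have hpa : ii p < a + 1 := by
          rw [lenF] at hl; split_ifs at hl <;> omega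
        rw [if_pos hpa] at hp
        have e : (ii p + 1) * n = ii p * n + n := by ring
        by_cases hc : ii p < a
        · have hmul : (ii p + 1) * n ≤ a * n := Nat.mul_le_mul_right _ hc
          rw [if_pos (by omega)] at hq
          simp only [hB', Nat.add_sub_cancel, Fin.ext_iff]
          split_ifs <;> first | rfl | omega
        · have hia : ii p = a := by omega
          rw [if_neg (by omega)] at hq
          have hkb : ¬ ((kk p : ℕ) < n - β) := by
            intro hh
            rw [lenF, if_pos hh] at hl
            omega
          rw [hia] at hp
          simp only [hB', Nat.add_sub_cancel, Fin.ext_iff]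
          split_ifs <;> first | rfl | omega
      · have e : ii p + 1 = lenF (a + 1) β (kk p) := by omega
        rw [col_mul_zero, e, hs0]
        intro x
        have hx := x.isLt
        rw [lenF] at e
        by_cases hkb : (kk p : ℕ) < n - β
        · rw [if_pos hkb] at e
          have hia : ii p = a := by omega
          rw [hia, if_pos (by omega)] at hp
          simp only [hB', Nat.add_sub_cancel]
          split_ifs <;> first | rfl | omega
        · rw [if_neg hkb] at e
          rw [if_neg (by omega)] at hp
          simp only [hB', Nat.add_sub_cancel]
          split_ifs <;> first | rfl | omega
    · ext i j
      rw [hA', Matrix.mul_neg, Matrix.add_apply, Matrix.neg_apply, ← hA1, Matrix.mul_apply]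
      by_cases hi : (i : ℕ) < n
      · rw [dif_pos hi, Finset.sum_eq_single ⟨i, hi⟩]
        · simp [hC']
        · intro b _ hb
          rw [hC', if_neg (fun h => hb (Fin.ext h.symm)), zero_mul]
        · simp
      · rw [dif_neg hi, Finset.sum_eq_zero]
        · rw [neg_zero, add_zero]
          congr 1
          apply Fin.ext
          simp only
          omega
        · intro b _
          rw [hC', if_neg (by have := b.isLt; omega), zero_mul]
end

section
/- Let m > n ≥ 1, write m = αn + β with α ≥ 0 and 0 < β ≤ n, and let N, N' ∈ ℂ^{(m−n)×m}. The triples 𝒦(N) and 𝒦(N') are feedback similar if and only if there exist invertible matrices S_1 ∈ ℂ^{(n−β)×(n−β)} and S_3 ∈ ℂ^{β×β} and matrices S_2, S_4 ∈ ℂ^{(n−β)×β} such that N' = R_α(S_1,S_2,S_3,S_4)⁻¹ · N · R_{α+1}(S_1,S_2,S_3,S_4). -/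
open Matrix

/-- Entry of a matrix at natural-number indices, defaulting to `0` out of range. -/
def get' {p q : ℕ} (M : Matrix (Fin p) (Fin q) ℂ) (i j : ℕ) : ℂ :=
  if h : i < p ∧ j < q then M ⟨i, h.1⟩ ⟨j, h.2⟩ else 0

/-- The matrix `R_γ(S₁,S₂,S₃,S₄)` of the paper: square of size `(γ-1)n + β`,
block upper bidiagonal with respect to `γ-1` blocks of size `n` followed by one block of
size `β`; diagonal blocks `[[S₁,S₂],[0,S₃]]` (the last one `S₃`), superdiagonal blocks
`[[0,S₄],[0,0]]` (the last one `[S₄; 0]`). -/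
def Rmat (n β γ : ℕ) (S1 : Matrix (Fin (n - β)) (Fin (n - β)) ℂ)
    (S2 : Matrix (Fin (n - β)) (Fin β) ℂ) (S3 : Matrix (Fin β) (Fin β) ℂ)
    (S4 : Matrix (Fin (n - β)) (Fin β) ℂ) :
    Matrix (Fin ((γ - 1) * n + β)) (Fin ((γ - 1) * n + β)) ℂ := fun t u =>
  let N := n - β
  let bi := if (t:ℕ) < (γ - 1) * n then (t:ℕ) / n else γ - 1
  let bj := if (u:ℕ) < (γ - 1) * n then (u:ℕ) / n else γ - 1
  let p := (t:ℕ) - bi * n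
  let q := (u:ℕ) - bj * n
  if bi = bj then
    if bi = γ - 1 then get' S3 p q
    else if p < N ∧ q < N then get' S1 p q
    else if p < N ∧ N ≤ q then get' S2 p (q - N)
    else if N ≤ p ∧ N ≤ q then get' S3 (p - N) (q - N)
    else 0
  else if bj = bi + 1 then
    if bj = γ - 1 then (if p < N then get' S4 p q else 0)
    else if p < N ∧ N ≤ q then get' S4 p (q - N)
    else 0
  else 0

lemma absF {ν κ : Type} [Fintype ν] [Fintype κ] [DecidableEq ν] [DecidableEq κ]
    (H N N' : Matrix κ (ν ⊕ κ) ℂ) :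
    (∃ (S : Matrix (ν ⊕ κ) (ν ⊕ κ) ℂ) (P : Matrix ν ν ℂ) (U V : Matrix ν (ν ⊕ κ) ℂ),
      IsUnit S ∧ IsUnit P ∧
      (fromRows 1 0 : Matrix (ν ⊕ κ) ν ℂ) = S⁻¹ * (fromRows 1 0 : Matrix (ν ⊕ κ) ν ℂ) * P ∧
      (fromRows 0 H) = S⁻¹ * (fromRows 0 H * S + (fromRows 1 0 : Matrix (ν ⊕ κ) ν ℂ) * V) ∧
      (fromRows 0 N') = S⁻¹ * (fromRows 0 N * S + (fromRows 1 0 : Matrix (ν ⊕ κ) ν ℂ) * U)) ↔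
    ∃ (P : Matrix ν ν ℂ) (Q : Matrix ν κ ℂ) (T : Matrix κ κ ℂ), IsUnit P ∧ IsUnit T ∧
      T * H = H * fromBlocks P Q 0 T ∧ T * N' = N * fromBlocks P Q 0 T := by
  have key : ∀ (S : Matrix (ν ⊕ κ) (ν ⊕ κ) ℂ), IsUnit S → ∀ {τ : Type}
      (X Y : Matrix (ν ⊕ κ) τ ℂ), X = S⁻¹ * Y ↔ S * X = Y := by
    intro S hS τ X Y
    have hd := (Matrix.isUnit_iff_isUnit_det S).1 hS
    constructor
    · rintro rfl
      exact Matrix.mul_nonsing_inv_cancel_left _ _ hd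
    · rintro rfl
      exact (Matrix.nonsing_inv_mul_cancel_left _ _ hd).symm
  constructor
  · rintro ⟨S, P, U, V, hS, hP, h1, h2, h3⟩
    rw [Matrix.mul_assoc, key S hS] at h1
    rw [key S hS] at h2 h3
    obtain ⟨P', Q, R, T, rfl⟩ : ∃ P' Q R T, S = fromBlocks P' Q R T :=
      ⟨_, _, _, _, (Matrix.fromBlocks_toBlocks S).symm⟩
    rw [fromBlocks_mul_fromRows, fromRows_mul, fromRows_ext_iff] at h1
    simp at h1
    obtain ⟨rfl, rfl⟩ := h1
    have hd : IsUnit T := by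
      rw [Matrix.isUnit_iff_isUnit_det, Matrix.det_fromBlocks_zero₂₁] at hS
      rw [Matrix.isUnit_iff_isUnit_det]
      exact isUnit_of_mul_isUnit_right hS
    have hr : ∀ X Y : Matrix (ν ⊕ κ) (ν ⊕ κ) ℂ, (X + Y).toRows₂ = X.toRows₂ + Y.toRows₂ :=
      fun _ _ => rfl
    refine ⟨_, Q, T, hP, hd, ?_, ?_⟩
    · simpa [hr, fromBlocks_mul_fromRows, fromRows_mul] using congrArg Matrix.toRows₂ h2
    · simpa [hr, fromBlocks_mul_fromRows, fromRows_mul] using congrArg Matrix.toRows₂ h3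
  · rintro ⟨P, Q, T, hP, hT, h1, h2⟩
    have hS : IsUnit (fromBlocks P Q 0 T) := by
      rw [Matrix.isUnit_iff_isUnit_det] at *
      rw [Matrix.det_fromBlocks_zero₂₁]
      exact hP.mul hT
    refine ⟨fromBlocks P Q 0 T, P, Q * N', Q * H, hS, hP, ?_, ?_, ?_⟩
    · rw [Matrix.mul_assoc, key _ hS, fromBlocks_mul_fromRows, fromRows_mul]
      simp
    · rw [key _ hS, fromBlocks_mul_fromRows, fromRows_mul, fromRows_mul, ← h1]
      ext (i|i) j <;> simp
    · rw [key _ hS, fromBlocks_mul_fromRows, fromRows_mul, fromRows_mul, ← h2]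
      ext (i|i) j <;> simp

/-- the splitting of the index set -/
def spl (m n : ℕ) (h : n < m) : Fin n ⊕ Fin (m - n) ≃ Fin m :=
  finSumFinEquiv.trans (finCongr (by omega))

lemma spl_inl (m n : ℕ) (h : n < m) (i : Fin n) : (spl m n h (Sum.inl i) : ℕ) = i := by
  simp [spl]

lemma spl_inr (m n : ℕ) (h : n < m) (i : Fin (m - n)) : (spl m n h (Sum.inr i) : ℕ) = n + i := by
  simp [spl]

/-- the index of the unique one in each row of H -/
def sg (n β c r : ℕ) : ℕ := if r < c * n then r else r + n - β

/-- the matrix H -/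
def Hm (m n β c : ℕ) : Matrix (Fin (m - n)) (Fin m) ℂ := fun r j =>
  if (j : ℕ) = sg n β c r then 1 else 0

lemma sub_inv {ι κ : Type*} [Fintype ι] [Fintype κ] [DecidableEq ι] [DecidableEq κ] (e : κ ≃ ι)
    (S : Matrix ι ι ℂ) : S⁻¹.submatrix e e = (S.submatrix e e)⁻¹ := by
  simp [Matrix.inv_submatrix_equiv]

lemma fst_iff (m n c β : ℕ) (h : n < m)
    (N N' : Matrix (Fin (m - n)) (Fin m) ℂ) :
    FST (Ktriple m n (c + 1) β N) (Ktriple m n (c + 1) β N') ↔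
    ∃ (S : Matrix (Fin m) (Fin m) ℂ),
      IsUnit (S.submatrix (spl m n h ∘ Sum.inl) (spl m n h ∘ Sum.inl)) ∧
      IsUnit (S.submatrix (spl m n h ∘ Sum.inr) (spl m n h ∘ Sum.inr)) ∧
      (S.submatrix (spl m n h ∘ Sum.inr) (spl m n h ∘ Sum.inl)) = 0 ∧
      (S.submatrix (spl m n h ∘ Sum.inr) (spl m n h ∘ Sum.inr)) * Hm m n β c = Hm m n β c * S ∧
      (S.submatrix (spl m n h ∘ Sum.inr) (spl m n h ∘ Sum.inr)) * N' = N * S := by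
  set e := spl m n h with he
  have hC : ∀ N, (Ktriple m n (c + 1) β N).1.submatrix e id = fromRows 1 0 := by
    intro N
    ext (i|i) j <;> rw [submatrix_apply]
    · simp [Ktriple, he, spl_inl, Matrix.one_apply, Fin.ext_iff]
    · simp [Ktriple, he, spl_inr]
      intro h; have := j.2; omega
  have hB : ∀ N, (Ktriple m n (c + 1) β N).2.1.submatrix e e
      = fromRows 0 ((Hm m n β c).submatrix id e) := by
    intro N
    ext (i|i) j <;> rw [submatrix_apply]
    · simp [Ktriple, he, spl_inl]
    · simp only [Ktriple, he, Hm, sg, spl_inr, submatrix_apply, fromRows_apply_inr, id]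
      rw [if_neg (by omega)]
      simp only [Nat.add_sub_cancel, Nat.add_sub_cancel_left, Nat.add_comm n]
      split_ifs <;> rfl
  have hA : ∀ N, (Ktriple m n (c + 1) β N).2.2.submatrix e e
      = fromRows 0 (N.submatrix id e) := by
    intro N
    ext (i|i) j <;> rw [submatrix_apply]
    · simp [Ktriple, he, spl_inl]
    · simp [Ktriple, he, spl_inr]
  have expd : ∀ (S X : Matrix (Fin m) (Fin m) ℂ) (C : Matrix (Fin m) (Fin n) ℂ)
      (V : Matrix (Fin n) (Fin m) ℂ), (S⁻¹ * (X * S + C * V)).submatrix e e =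
      (S.submatrix e e)⁻¹ * (X.submatrix e e * S.submatrix e e
        + C.submatrix e id * V.submatrix id e) := by
    intro S X C V
    rw [← sub_inv, Matrix.submatrix_mul_equiv, ← Matrix.submatrix_mul_equiv _ _ e e e]
    rfl
  have hT : FST (Ktriple m n (c + 1) β N) (Ktriple m n (c + 1) β N') ↔
    (∃ (S : Matrix (Fin n ⊕ Fin (m - n)) (Fin n ⊕ Fin (m - n)) ℂ) (P : Matrix (Fin n) (Fin n) ℂ)
      (U V : Matrix (Fin n) (Fin n ⊕ Fin (m - n)) ℂ),
      IsUnit S ∧ IsUnit P ∧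
      (fromRows 1 0 : Matrix (Fin n ⊕ Fin (m - n)) (Fin n) ℂ)
        = S⁻¹ * (fromRows 1 0 : Matrix (Fin n ⊕ Fin (m - n)) (Fin n) ℂ) * P ∧
      (fromRows 0 ((Hm m n β c).submatrix id e)) = S⁻¹ * (fromRows 0 ((Hm m n β c).submatrix id e) * S
        + (fromRows 1 0 : Matrix (Fin n ⊕ Fin (m - n)) (Fin n) ℂ) * V) ∧
      (fromRows 0 (N'.submatrix id e)) = S⁻¹ * (fromRows 0 (N.submatrix id e) * S
        + (fromRows 1 0 : Matrix (Fin n ⊕ Fin (m - n)) (Fin n) ℂ) * U)) := by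
    have inj : ∀ {τ τ' : Type} (f : τ' ≃ τ) (X Y : Matrix (Fin m) τ ℂ),
        X = Y ↔ X.submatrix e f = Y.submatrix e f := by
      intro τ τ' f X Y
      exact ((Matrix.reindex e.symm f.symm).apply_eq_iff_eq).symm
    constructor
    · rintro ⟨S, P, U, V, hS, hP, h1, h2, h3⟩
      refine ⟨S.submatrix e e, P, U.submatrix id e, V.submatrix id e, ?_, hP, ?_, ?_, ?_⟩
      · exact (Matrix.isUnit_submatrix_equiv e e).2 hS
      · rw [inj (Equiv.refl _)] at h1
        rw [← hC N, ← sub_inv, Matrix.submatrix_mul_equiv, hC N, ← hC N']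
        exact h1
      · rw [inj e] at h2
        rw [hB, expd, hB, hC] at h2
        exact h2
      · rw [inj e] at h3
        rw [hA, expd, hA, hC] at h3
        exact h3
    · rintro ⟨S, P, U, V, hS, hP, h1, h2, h3⟩
      obtain ⟨S, rfl⟩ : ∃ S' : Matrix (Fin m) (Fin m) ℂ, S = S'.submatrix e e :=
        ⟨S.submatrix e.symm e.symm, by simp⟩
      obtain ⟨U, rfl⟩ : ∃ S' : Matrix (Fin n) (Fin m) ℂ, U = S'.submatrix id e :=
        ⟨U.submatrix id e.symm, by simp⟩
      obtain ⟨V, rfl⟩ : ∃ S' : Matrix (Fin n) (Fin m) ℂ, V = S'.submatrix id e :=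
        ⟨V.submatrix id e.symm, by simp⟩
      refine ⟨S, P, U, V, ?_, hP, ?_, ?_, ?_⟩
      · exact (Matrix.isUnit_submatrix_equiv e e).1 hS
      · rw [inj (Equiv.refl _)]
        rw [← hC N, ← sub_inv, Matrix.submatrix_mul_equiv, hC N, ← hC N'] at h1
        exact h1
      · rw [inj e]
        rw [hB, expd, hB, hC]
        exact h2
      · rw [inj e]
        rw [hA, expd, hA, hC]
        exact h3
  rw [hT, absF]
  have inj : ∀ (X Y : Matrix (Fin (m - n)) (Fin m) ℂ),
        X = Y ↔ X.submatrix id e = Y.submatrix id e := by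
      intro X Y
      exact ((Matrix.reindex (Equiv.refl _) e.symm).apply_eq_iff_eq).symm
  have hmul : ∀ (X : Matrix (Fin (m - n)) (Fin m) ℂ) (S : Matrix (Fin m) (Fin m) ℂ),
      (X * S).submatrix id e = X.submatrix id e * S.submatrix e e := by
    intro X S; simp
  have hmul' : ∀ (X : Matrix (Fin (m - n)) (Fin m) ℂ) (S : Matrix (Fin (m - n)) (Fin (m - n)) ℂ),
      (S * X).submatrix id e = S * X.submatrix id e := by
    intro X S; rfl
  constructor
  · rintro ⟨P, Q, T, hP, hT, h1, h2⟩
    refine ⟨(fromBlocks P Q 0 T).submatrix e.symm e.symm, ?_, ?_, ?_, ?_, ?_⟩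
    · convert hP; ext i j; simp
    · convert hT; ext i j; simp
    · ext i j; simp
    · rw [inj, hmul, hmul']; convert h1 using 2
      · ext i j; simp
      · simp
    · rw [inj, hmul, hmul']; convert h2 using 2
      · ext i j; simp
      · simp
  · rintro ⟨S, hP, hT, h0, h1, h2⟩
    refine ⟨_, S.submatrix (e ∘ Sum.inl) (e ∘ Sum.inr), _, hP, hT, ?_, ?_⟩
    · rw [inj, hmul, hmul'] at h1; convert h1 using 2
      rw [← h0]; ext (i|i) (j|j) <;> simp
    · rw [inj, hmul, hmul'] at h2; convert h2 using 2
      rw [← h0]; ext (i|i) (j|j) <;> simp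

/-- entries of `R` in block coordinates; `d` is the index of the last block -/
def Rf (N d : ℕ) (s1 s2 s3 s4 : ℕ → ℕ → ℂ) (a p b q : ℕ) : ℂ :=
  if a = b then
    if a = d then s3 p q
    else if p < N ∧ q < N then s1 p q
    else if p < N ∧ N ≤ q then s2 p (q - N)
    else if N ≤ p ∧ N ≤ q then s3 (p - N) (q - N)
    else 0
  else if b = a + 1 then
    if b = d then (if p < N then s4 p q else 0)
    else if p < N ∧ N ≤ q then s4 p (q - N)
    else 0
  else 0

lemma core (n β c N : ℕ) (hN : N + β = n) (f : ℕ → ℕ → ℕ → ℕ → ℂ)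
    (L1 : ∀ a p q, 1 ≤ a → a ≤ c + 1 → p < n → (a = c + 1 → p < β) → q < n → f a p 0 q = 0)
    (L2 : ∀ a p b q, a < c → b < c → p < n → q < n → f a p b q = f (a + 1) p (b + 1) q)
    (L3 : ∀ a p q, a < c → p < n → q < β → f a p c (N + q) = f (a + 1) p (c + 1) q)
    (L3' : ∀ a p q, a < c → p < n → q < N → f a p c q = 0)
    (L4 : ∀ a p q, a < c → p < n → q < β → f a p (c + 1) q = 0)
    (L5 : ∀ p b q, p < β → b < c → q < n → f c (N + p) b q = f (c + 1) p (b + 1) q)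
    (L6 : ∀ p q, p < β → q < β → f c (N + p) c (N + q) = f (c + 1) p (c + 1) q)
    (L6' : ∀ p q, p < β → q < N → f c (N + p) c q = 0)
    (L7 : ∀ p q, p < β → q < β → f c (N + p) (c + 1) q = 0)
    (a p b q : ℕ) (ha : a ≤ c + 1) (hb : b ≤ c + 1) (hp : p < n) (hq : q < n)
    (hap : a = c + 1 → p < β) (hbq : b = c + 1 → q < β) :
    f a p b q = Rf N (c + 1) (fun p q => f 0 p 0 q) (fun p q => f 0 p 0 (N + q))
      (fun p q => f (c + 1) p (c + 1) q) (fun p q => f c p (c + 1) q) a p b q := by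
  have shift : ∀ k a p b q, a + k ≤ c → b + k ≤ c → p < n → q < n →
      f a p b q = f (a + k) p (b + k) q := by
    intro k
    induction k with
    | zero => intros; rfl
    | succ k ih =>
      intro a p b q h1 h2 h3 h4
      rw [ih a p b q (by omega) (by omega) h3 h4, L2 _ _ _ _ (by omega) (by omega) h3 h4]
      rfl
  have D1 : ∀ a p b q, b < a → a ≤ c → p < n → q < n → f a p b q = 0 := by
    intro a p b q h1 h2 h3 h4
    have := shift b (a - b) p 0 q (by omega) (by omega) h3 h4
    rw [Nat.sub_add_cancel h1.le, Nat.zero_add] at this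
    rw [← this]
    exact L1 _ _ _ (by omega) (by omega) h3 (by omega) h4
  unfold Rf
  by_cases hab : a = b
  · subst hab
    rw [if_pos rfl]
    by_cases hac : a = c + 1
    · subst hac; simp
    · rw [if_neg hac]
      have e0 := shift a 0 p 0 q (by omega) (by omega) hp hq
      have e1 := shift (c - a) a p a q (by omega) (by omega) hp hq
      rw [Nat.zero_add] at e0
      rw [Nat.add_sub_cancel' (by omega)] at e1
      by_cases hpN : p < N
      · by_cases hqN : q < N
        · simp [hpN, hqN, e0]
        · simp only [hpN, hqN, not_lt.1 hqN, and_true, and_false, if_false, if_true]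
          rw [Nat.add_sub_cancel' (not_lt.1 hqN), e0]
      · obtain ⟨p', rfl⟩ := Nat.exists_eq_add_of_le (not_lt.1 hpN)
        by_cases hqN : q < N
        · have : ¬ N ≤ q := by omega
          simp only [hpN, this, and_false, false_and, if_false]
          rw [e1]; exact L6' _ _ (by omega) hqN
        · obtain ⟨q', rfl⟩ := Nat.exists_eq_add_of_le (not_lt.1 hqN)
          simp only [hpN, false_and, if_false]
          rw [e1, L6 _ _ (by omega) (by omega)]
          simp
  rw [if_neg hab]
  by_cases hba : b = a + 1
  · subst hba
    rw [if_pos rfl]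
    by_cases hac : a = c
    · subst hac
      simp only [if_true]
      split_ifs with h
      · rfl
      · obtain ⟨p', rfl⟩ := Nat.exists_eq_add_of_le (not_lt.1 h)
        exact L7 _ _ (by omega) (hbq rfl)
    · rw [if_neg (by omega)]
      have e1 := shift (c - (a + 1)) a p (a + 1) q (by omega) (by omega) hp hq
      rw [Nat.add_sub_cancel' (by omega)] at e1
      by_cases hqN : q < N
      · rw [if_neg (by omega), e1]
        exact L3' _ _ _ (by omega) hp hqN
      · obtain ⟨q', rfl⟩ := Nat.exists_eq_add_of_le (not_lt.1 hqN)
        rw [e1, L3 _ _ _ (by omega) hp (by omega), show a + (c - (a + 1)) + 1 = c by omega]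
        split_ifs with h
        · simp
        · obtain ⟨p', rfl⟩ := Nat.exists_eq_add_of_le (show N ≤ p by omega)
          exact L7 _ _ (by omega) (by omega)
  · rw [if_neg hba]
    by_cases hlt : b < a
    · by_cases hac : a = c + 1
      · subst hac
        obtain _ | b := b
        · exact L1 _ _ _ (by omega) le_rfl hp hap hq
        · rw [← L5 _ _ _ (hap rfl) (by omega) hq]
          exact D1 _ _ _ _ (by omega) le_rfl (by have := hap rfl; omega) hq
      · exact D1 _ _ _ _ hlt (by omega) hp hq
    · by_cases hbc : b = c + 1
      · subst hbc
        exact L4 _ _ _ (by omega) hp (hbq rfl)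
      · have e1 := shift (c - b) a p b q (by omega) (by omega) hp hq
        rw [Nat.add_sub_cancel' (by omega)] at e1
        rw [e1]
        by_cases hqN : q < N
        · exact L3' _ _ _ (by omega) hp hqN
        · obtain ⟨q', rfl⟩ := Nat.exists_eq_add_of_le (not_lt.1 hqN)
          rw [L3 _ _ _ (by omega) hp (by omega)]
          exact L4 _ _ _ (by omega) hp (by omega)

lemma sg_lt (n β c N a p : ℕ) (ha : a < c) (hp : p < n) :
    sg n β c (a * n + p) = a * n + p := by
  have : (a + 1) * n ≤ c * n := Nat.mul_le_mul_right _ ha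
  rw [Nat.add_mul] at this
  unfold sg; rw [if_pos (by omega)]

lemma sg_eq (n β c N p : ℕ) (hN : N + β = n) :
    sg n β c (c * n + p) = c * n + (N + p) := by
  unfold sg; rw [if_neg (by omega)]; omega

lemma core2 (n β c N : ℕ) (hβ : 0 < β) (hN : N + β = n) (s : ℕ → ℕ → ℂ)
    (c0 : ∀ i j, n ≤ i → i < c * n + n + β → j < n → s i j = 0)
    (c1 : ∀ r k, r < c * n + β → k < c * n + β → s (sg n β c r) (sg n β c k) = s (n + r) (n + k))
    (c2 : ∀ r j, r < c * n + β → j < c * n + n + β → (∀ k < c * n + β, j ≠ sg n β c k) →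
      s (sg n β c r) j = 0)
    (a p b q : ℕ) (ha : a ≤ c + 1) (hb : b ≤ c + 1) (hp : p < n) (hq : q < n)
    (hap : a = c + 1 → p < β) (hbq : b = c + 1 → q < β) :
    s (a * n + p) (b * n + q) = Rf N (c + 1) (fun p q => s p q) (fun p q => s p (N + q))
      (fun p q => s ((c + 1) * n + p) ((c + 1) * n + q))
      (fun p q => s (c * n + p) ((c + 1) * n + q)) a p b q := by
  have lt : ∀ a p, a < c → p < n → a * n + p < c * n := by
    intro a p ha hp
    have : (a + 1) * n ≤ c * n := Nat.mul_le_mul_right _ ha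
    rw [Nat.add_mul] at this
    omega
  have sc : ∀ a p, (a + 1) * n + p = n + (a * n + p) := by intros; ring
  have nc : ∀ q, q < N → ∀ k < c * n + β, c * n + q ≠ sg n β c k := by
    intro q hq k hk
    unfold sg; split_ifs <;> omega
  have nc1 : ∀ q, q < β → ∀ k < c * n + β, (c + 1) * n + q ≠ sg n β c k := by
    intro q hq k hk
    unfold sg; rw [Nat.add_mul]; split_ifs <;> omega
  have e1 := fun a p (h : a < c) (h' : p < n) => sg_lt n β c N a p h h'
  have e2 := fun p => sg_eq n β c N p hN
  have := core n β c N hN (fun a p b q => s (a * n + p) (b * n + q)) ?_ ?_ ?_ ?_ ?_ ?_ ?_ ?_ ?_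
    a p b q ha hb hp hq hap hbq
  · simpa using this
  · intro a p q h1 h2 h3 h4 h5
    simp only [Nat.zero_mul, Nat.zero_add]
    obtain ⟨a, rfl⟩ : ∃ a', a = a' + 1 := ⟨a - 1, by omega⟩
    refine c0 _ _ (by rw [sc]; omega) ?_ h5
    rw [sc]
    rcases Nat.lt_or_ge a c with h | h
    · have := lt a p h h3; omega
    · obtain rfl : a = c := by omega
      have := h4 rfl; omega
  · intro a p b q h1 h2 h3 h4
    have := lt a p h1 h3
    have := lt b q h2 h4
    have := c1 (a * n + p) (b * n + q) (by omega) (by omega)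
    rw [e1 _ _ h1 h3, e1 _ _ h2 h4] at this
    simp only [sc, this]
  · intro a p q h1 h3 h4
    have := lt a p h1 h3
    have := c1 (a * n + p) (c * n + q) (by omega) (by omega)
    rw [e1 _ _ h1 h3, e2] at this
    simp only [sc, this]
  · intro a p q h1 h3 h4
    have := lt a p h1 h3
    have := c2 (a * n + p) (c * n + q) (by omega) (by omega) (nc _ h4)
    rwa [e1 _ _ h1 h3] at this
  · intro a p q h1 h3 h4
    have := lt a p h1 h3
    have := c2 (a * n + p) ((c + 1) * n + q) (by omega) (by rw [Nat.add_mul]; omega) (nc1 _ h4)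
    rwa [e1 _ _ h1 h3] at this
  · intro p b q h1 h2 h3
    have := lt b q h2 h3
    have := c1 (c * n + p) (b * n + q) (by omega) (by omega)
    rw [e1 _ _ h2 h3, e2] at this
    simp only [sc, this]
  · intro p q h1 h2
    have := c1 (c * n + p) (c * n + q) (by omega) (by omega)
    rw [e2, e2] at this
    simp only [sc, this]
  · intro p q h1 h2
    have := c2 (c * n + p) (c * n + q) (by omega) (by omega) (nc _ h2)
    rwa [e2] at this
  · intro p q h1 h2
    have := c2 (c * n + p) ((c + 1) * n + q) (by omega) (by rw [Nat.add_mul]; omega) (nc1 _ h2)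
    rwa [e2] at this

/-- ℕ-indexed entries of `R` -/
def Rg (n N d : ℕ) (s1 s2 s3 s4 : ℕ → ℕ → ℂ) (i j : ℕ) : ℂ :=
  Rf N d s1 s2 s3 s4 (i / n) (i % n) (j / n) (j % n)

lemma Rg_block (n N d : ℕ) (s1 s2 s3 s4 : ℕ → ℕ → ℂ) (a p b q : ℕ) (hp : p < n) (hq : q < n) :
    Rg n N d s1 s2 s3 s4 (a * n + p) (b * n + q) = Rf N d s1 s2 s3 s4 a p b q := by
  have h : ∀ a p, p < n → (a * n + p) / n = a ∧ (a * n + p) % n = p := by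
    intro a p h
    constructor
    · rw [Nat.add_comm, Nat.add_mul_div_right _ _ (by omega), Nat.div_eq_of_lt h, Nat.zero_add]
    · rw [Nat.add_comm, Nat.add_mul_mod_self_right, Nat.mod_eq_of_lt h]
  unfold Rg
  rw [(h a p hp).1, (h a p hp).2, (h b q hq).1, (h b q hq).2]

lemma Rg_shift (n N c : ℕ) (hn : 0 < n) (s1 s2 s3 s4 : ℕ → ℕ → ℂ) (r k : ℕ) :
    Rg n N (c + 1) s1 s2 s3 s4 (n + r) (n + k) = Rg n N c s1 s2 s3 s4 r k := by
  unfold Rg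
  rw [Nat.add_div_left _ hn, Nat.add_div_left _ hn, Nat.add_mod_left, Nat.add_mod_left]
  unfold Rf
  simp only [Nat.add_right_cancel_iff]

lemma dec (n β c i : ℕ) (hβ : 0 < β) (hβn : β ≤ n) (hi : i < c * n + β) :
    ∃ a p, i = a * n + p ∧ a ≤ c ∧ p < n ∧ (a = c → p < β) := by
  have hn : 0 < n := by omega
  refine ⟨i / n, i % n, ?_, ?_, Nat.mod_lt _ hn, ?_⟩
  · rw [Nat.mul_comm]; exact (Nat.div_add_mod i n).symm
  · rw [← Nat.lt_succ_iff, Nat.div_lt_iff_lt_mul hn, Nat.succ_mul]; omega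
  · intro h
    have := Nat.div_add_mod i n
    rw [h, Nat.mul_comm] at this; omega

lemma Rg_c0 (n β c N : ℕ) (hβ : 0 < β) (hN : N + β = n) (s1 s2 s3 s4 : ℕ → ℕ → ℂ)
    (i j : ℕ) (hi : n ≤ i) (hj : j < n) : Rg n N c s1 s2 s3 s4 i j = 0 := by
  have h1 : 1 ≤ i / n := by rw [Nat.one_le_div_iff (by omega)]; exact hi
  have h2 : j / n = 0 := Nat.div_eq_of_lt hj
  unfold Rg Rf
  rw [h2, if_neg (by omega), if_neg (by omega)]

lemma Rg_c1 (n β c N : ℕ) (hβ : 0 < β) (hN : N + β = n) (s1 s2 s3 s4 : ℕ → ℕ → ℂ)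
    (r k : ℕ) (hr : r < c * n + β) (hk : k < c * n + β) :
    Rg n N (c + 1) s1 s2 s3 s4 (sg n β c r) (sg n β c k) =
      Rg n N (c + 1) s1 s2 s3 s4 (n + r) (n + k) := by
  rw [Rg_shift n N c (by omega)]
  obtain ⟨a, p, rfl, ha, hp, hap⟩ := dec n β c r hβ (by omega) hr
  obtain ⟨b, q, rfl, hb, hq, hbq⟩ := dec n β c k hβ (by omega) hk
  rw [Rg_block _ _ _ _ _ _ _ _ _ _ _ hp hq]
  rcases Nat.lt_or_ge a c with h | h
  · rw [sg_lt n β c N a p h hp]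
    rcases Nat.lt_or_ge b c with h' | h'
    · rw [sg_lt n β c N b q h' hq, Rg_block _ _ _ _ _ _ _ _ _ _ _ hp hq]
      unfold Rf
      rw [if_neg (show a ≠ c + 1 by omega), if_neg (show a ≠ c by omega),
        if_neg (show b ≠ c + 1 by omega), if_neg (show b ≠ c by omega)]
    · obtain rfl : b = c := by omega
      have := hbq rfl
      rw [sg_eq n β b N q hN, Rg_block _ _ _ _ _ _ _ _ _ _ _ hp (by omega)]
      unfold Rf
      rw [if_neg (show a ≠ b by omega), if_neg (show a ≠ b by omega)]
      simp
  · obtain rfl : a = c := by omega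
    have := hap rfl
    rw [sg_eq n β a N p hN]
    rcases Nat.lt_or_ge b a with h' | h'
    · rw [sg_lt n β a N b q h' hq, Rg_block _ _ _ _ _ _ _ _ _ _ _ (by omega) hq]
      unfold Rf
      rw [if_neg (show a ≠ b by omega), if_neg (show a ≠ b by omega),
        if_neg (show b ≠ a + 1 by omega), if_neg (show b ≠ a + 1 by omega)]
    · obtain rfl : a = b := by omega
      have := hbq rfl
      rw [sg_eq n β a N q hN, Rg_block _ _ _ _ _ _ _ _ _ _ _ (by omega) (by omega)]
      unfold Rf
      simp

lemma Rg_c2 (n β c N : ℕ) (hβ : 0 < β) (hN : N + β = n) (s1 s2 s3 s4 : ℕ → ℕ → ℂ)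
    (r j : ℕ) (hr : r < c * n + β) (hj : j < c * n + n + β)
    (hk : ∀ k < c * n + β, j ≠ sg n β c k) :
    Rg n N (c + 1) s1 s2 s3 s4 (sg n β c r) j = 0 := by
  obtain ⟨a, p, rfl, ha, hp, hap⟩ := dec n β c r hβ (by omega) hr
  obtain ⟨b, q, rfl, hb, hq, hbq⟩ := dec n β (c + 1) j hβ (by omega) (by rw [Nat.add_mul]; omega)
  have hb' : b = c + 1 ∨ (b = c ∧ q < N) := by
    by_contra hcon
    rcases Nat.lt_or_ge b c with h' | h'
    · refine hk (b * n + q) ?_ (sg_lt n β c N b q h' hq).symm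
      have : (b + 1) * n ≤ c * n := Nat.mul_le_mul_right _ h'
      rw [Nat.add_mul] at this
      omega
    · obtain rfl : b = c := by omega
      refine hk (b * n + (q - N)) (by omega) ?_
      rw [sg_eq n β b N _ hN]; omega
  rcases Nat.lt_or_ge a c with h | h
  · rw [sg_lt n β c N a p h hp, Rg_block _ _ _ _ _ _ _ _ _ _ _ hp hq]
    unfold Rf
    rw [if_neg (by omega)]
    split_ifs <;> first | rfl | omega
  · obtain rfl : a = c := by omega
    have := hap rfl
    rw [sg_eq n β a N p hN, Rg_block _ _ _ _ _ _ _ _ _ _ _ (by omega) hq]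
    unfold Rf
    split_ifs <;> first | rfl | omega

lemma get_in {p q : ℕ} (M : Matrix (Fin p) (Fin q) ℂ) (i j : ℕ) (hi : i < p) (hj : j < q) :
    get' M i j = M ⟨i, hi⟩ ⟨j, hj⟩ := by
  unfold get'
  rw [dif_pos ⟨hi, hj⟩]

/-- `R` as a matrix of free size -/
def Rm (M n β d : ℕ) (S1 : Matrix (Fin (n - β)) (Fin (n - β)) ℂ)
    (S2 : Matrix (Fin (n - β)) (Fin β) ℂ) (S3 : Matrix (Fin β) (Fin β) ℂ)
    (S4 : Matrix (Fin (n - β)) (Fin β) ℂ) : Matrix (Fin M) (Fin M) ℂ := fun i j =>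
  Rg n (n - β) d (get' S1) (get' S2) (get' S3) (get' S4) i j

lemma rmat_eq (M n β d : ℕ) (hβ : 0 < β) (hβn : β ≤ n) (h : (d + 1 - 1) * n + β = M)
    (S1 : Matrix (Fin (n - β)) (Fin (n - β)) ℂ)
    (S2 : Matrix (Fin (n - β)) (Fin β) ℂ) (S3 : Matrix (Fin β) (Fin β) ℂ)
    (S4 : Matrix (Fin (n - β)) (Fin β) ℂ) :
    Matrix.reindex (finCongr h) (finCongr h) (Rmat n β (d + 1) S1 S2 S3 S4)
      = Rm M n β d S1 S2 S3 S4 := by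
  subst h
  ext i j
  have key : ∀ t : ℕ, t < (d + 1 - 1) * n + β →
      (if t < (d + 1 - 1) * n then t / n else d + 1 - 1) = t / n := by
    intro t ht
    split_ifs with h
    · rfl
    · rw [Nat.add_sub_cancel] at *
      symm
      rw [Nat.div_eq_iff (by omega)]
      constructor <;> omega
  have key2 : ∀ t : ℕ, t - t / n * n = t % n := by
    intro t
    have := Nat.div_add_mod t n
    rw [Nat.mul_comm] at this
    omega
  simp only [reindex_apply, finCongr_symm, submatrix_apply, finCongr_apply, Fin.cast_refl, id]
  unfold Rmat Rm Rg Rf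
  have k1 := key i i.2
  have k2 := key j j.2
  simp only [Nat.add_sub_cancel] at k1 k2 ⊢
  simp only [k1, k2, key2]

lemma unitP (n β d : ℕ) (hβn : β ≤ n)
    (S1 : Matrix (Fin (n - β)) (Fin (n - β)) ℂ)
    (S2 : Matrix (Fin (n - β)) (Fin β) ℂ) (S3 : Matrix (Fin β) (Fin β) ℂ)
    (S4 : Matrix (Fin (n - β)) (Fin β) ℂ) :
    IsUnit (Rm n n β (d + 1) S1 S2 S3 S4) ↔ IsUnit S1 ∧ IsUnit S3 := by
  let e : Fin (n - β) ⊕ Fin β ≃ Fin n := finSumFinEquiv.trans (finCongr (by omega))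
  have he1 : ∀ i, (e (Sum.inl i) : ℕ) = i := by intro i; simp [e]
  have he2 : ∀ i, (e (Sum.inr i) : ℕ) = (n - β) + i := by intro i; simp [e]
  have : (Rm n n β (d + 1) S1 S2 S3 S4).submatrix e e = fromBlocks S1 S2 0 S3 := by
    ext i j
    have h1 : Rm n n β (d + 1) S1 S2 S3 S4 (e i) (e j) =
      Rf (n - β) (d + 1) (get' S1) (get' S2) (get' S3) (get' S4) 0 (e i) 0 (e j) := by
      rw [← Rg_block n _ _ _ _ _ _ _ _ _ _ (e i).2 (e j).2]
      simp [Rm]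
    rw [submatrix_apply, h1]
    unfold Rf
    rcases i with i | i <;> rcases j with j | j <;> simp [he1, he2, get']
    intro h; omega
  rw [← Matrix.isUnit_submatrix_equiv e e, this, Matrix.isUnit_iff_isUnit_det,
    Matrix.det_fromBlocks_zero₂₁, IsUnit.mul_iff, ← Matrix.isUnit_iff_isUnit_det,
    ← Matrix.isUnit_iff_isUnit_det]

lemma sub_ll (m n β d : ℕ) (h : n < m)
    (S1 : Matrix (Fin (n - β)) (Fin (n - β)) ℂ)
    (S2 : Matrix (Fin (n - β)) (Fin β) ℂ) (S3 : Matrix (Fin β) (Fin β) ℂ)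
    (S4 : Matrix (Fin (n - β)) (Fin β) ℂ) :
    (Rm m n β d S1 S2 S3 S4).submatrix (spl m n h ∘ Sum.inl) (spl m n h ∘ Sum.inl)
      = Rm n n β d S1 S2 S3 S4 := by
  ext i j
  simp [Rm, spl_inl]

lemma sub_rr (m n β c : ℕ) (h : n < m) (hn : 0 < n)
    (S1 : Matrix (Fin (n - β)) (Fin (n - β)) ℂ)
    (S2 : Matrix (Fin (n - β)) (Fin β) ℂ) (S3 : Matrix (Fin β) (Fin β) ℂ)
    (S4 : Matrix (Fin (n - β)) (Fin β) ℂ) :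
    (Rm m n β (c + 1) S1 S2 S3 S4).submatrix (spl m n h ∘ Sum.inr) (spl m n h ∘ Sum.inr)
      = Rm (m - n) n β c S1 S2 S3 S4 := by
  ext i j
  simp [Rm, spl_inr, Rg_shift n _ c hn]

lemma sub_rl (m n β c : ℕ) (h : n < m) (hβ : 0 < β) (hβn : β ≤ n)
    (S1 : Matrix (Fin (n - β)) (Fin (n - β)) ℂ)
    (S2 : Matrix (Fin (n - β)) (Fin β) ℂ) (S3 : Matrix (Fin β) (Fin β) ℂ)
    (S4 : Matrix (Fin (n - β)) (Fin β) ℂ) :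
    (Rm m n β c S1 S2 S3 S4).submatrix (spl m n h ∘ Sum.inr) (spl m n h ∘ Sum.inl) = 0 := by
  ext i j
  simp only [Rm, submatrix_apply, Function.comp, spl_inr, spl_inl, Matrix.zero_apply]
  exact Rg_c0 n β c _ hβ (by omega) _ _ _ _ _ _ (by omega) j.2

lemma unitR (n β : ℕ) (hβ : 0 < β) (hβn : β ≤ n)
    (S1 : Matrix (Fin (n - β)) (Fin (n - β)) ℂ)
    (S2 : Matrix (Fin (n - β)) (Fin β) ℂ) (S3 : Matrix (Fin β) (Fin β) ℂ)
    (S4 : Matrix (Fin (n - β)) (Fin β) ℂ) (h1 : IsUnit S1) (h3 : IsUnit S3) (c : ℕ) :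
    ∀ M, M = c * n + β → IsUnit (Rm M n β c S1 S2 S3 S4) := by
  induction c with
  | zero =>
    intro M hM
    obtain rfl : M = β := by omega
    convert h3
    ext i j
    have hi := i.2
    have hj := j.2
    have e1 := Rg_block n (n - M) 0 (get' S1) (get' S2) (get' S3) (get' S4) 0 i 0 j
      (by omega) (by omega)
    simp only [Nat.zero_mul, Nat.zero_add] at e1
    unfold Rm
    rw [e1]
    simp [Rf, get']
  | succ c ih =>
    intro M hM
    rw [Nat.add_mul] at hM
    have h : n < M := by omega
    have hT := ih (M - n) (by omega)
    have hP := (unitP n β c hβn S1 S2 S3 S4).2 ⟨h1, h3⟩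
    rw [← Matrix.isUnit_submatrix_equiv (spl M n h) (spl M n h)]
    have : (Rm M n β (c + 1) S1 S2 S3 S4).submatrix (spl M n h) (spl M n h) =
        fromBlocks (Rm n n β (c + 1) S1 S2 S3 S4)
          ((Rm M n β (c + 1) S1 S2 S3 S4).submatrix (spl M n h ∘ Sum.inl) (spl M n h ∘ Sum.inr))
          0 (Rm (M - n) n β c S1 S2 S3 S4) := by
      rw [← sub_ll M n β _ h, ← sub_rr M n β c h (by omega), ← sub_rl M n β (c + 1) h hβ hβn S1 S2 S3 S4]
      ext (i|i) (j|j) <;> rfl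
    rw [this]
    rw [Matrix.isUnit_iff_isUnit_det] at *
    rw [Matrix.det_fromBlocks_zero₂₁]
    exact hP.mul hT

lemma sg_lt_m (m n β c r : ℕ) (hm : m = c * n + n + β) (hβn : β ≤ n) (hr : r < m - n) :
    sg n β c r < m := by
  unfold sg; split_ifs <;> omega

lemma sg_inj (n β c r k : ℕ) (hβn : β ≤ n) (h : sg n β c r = sg n β c k) : r = k := by
  unfold sg at h; split_ifs at h <;> omega

lemma H_mul (m n β c : ℕ) (hm : m = c * n + n + β) (hβn : β ≤ n) (S : Matrix (Fin m) (Fin m) ℂ)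
    (r : Fin (m - n)) (j : Fin m) :
    (Hm m n β c * S) r j = S ⟨sg n β c r, sg_lt_m m n β c r hm hβn r.2⟩ j := by
  rw [Matrix.mul_apply, Finset.sum_eq_single ⟨sg n β c r, sg_lt_m m n β c r hm hβn r.2⟩]
  · simp [Hm]
  · intro b _ hb
    have : (b : ℕ) ≠ sg n β c r := fun h => hb (Fin.ext h)
    simp [Hm, this]
  · simp

lemma mul_H (m n β c : ℕ) (hβn : β ≤ n)
    (T : Matrix (Fin (m - n)) (Fin (m - n)) ℂ)
    (r k : Fin (m - n)) (j : Fin m) (hj : (j : ℕ) = sg n β c k) :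
    (T * Hm m n β c) r j = T r k := by
  rw [Matrix.mul_apply, Finset.sum_eq_single k]
  · simp [Hm, hj]
  · intro b _ hb
    have : (j : ℕ) ≠ sg n β c b := fun h => hb (Fin.ext (sg_inj n β c _ _ hβn (h.symm.trans hj)))
    simp [Hm, this]
  · simp

lemma mul_H_zero (m n β c : ℕ)
    (T : Matrix (Fin (m - n)) (Fin (m - n)) ℂ)
    (r : Fin (m - n)) (j : Fin m) (hj : ∀ k : Fin (m - n), (j : ℕ) ≠ sg n β c k) :
    (T * Hm m n β c) r j = 0 := by
  rw [Matrix.mul_apply, Finset.sum_eq_zero]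
  intro b _
  simp [Hm, hj b]

lemma back (m n β c : ℕ) (h : n < m) (hm : m = c * n + n + β) (hβ : 0 < β) (hβn : β ≤ n)
    (S1 : Matrix (Fin (n - β)) (Fin (n - β)) ℂ)
    (S2 : Matrix (Fin (n - β)) (Fin β) ℂ) (S3 : Matrix (Fin β) (Fin β) ℂ)
    (S4 : Matrix (Fin (n - β)) (Fin β) ℂ) :
    Rm (m - n) n β c S1 S2 S3 S4 * Hm m n β c = Hm m n β c * Rm m n β (c + 1) S1 S2 S3 S4 := by
  ext r j
  rw [H_mul m n β c hm hβn]
  by_cases hj : ∃ k : Fin (m - n), (j : ℕ) = sg n β c k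
  · obtain ⟨k, hk⟩ := hj
    rw [mul_H m n β c hβn _ r k j hk]
    unfold Rm
    rw [hk]
    rw [Rg_c1 n β c _ hβ (by omega) _ _ _ _ _ _ (by omega) (by omega), Rg_shift n _ c (by omega)]
  · push Not at hj
    rw [mul_H_zero m n β c _ r j hj]
    unfold Rm
    symm
    refine Rg_c2 n β c _ hβ (by omega) _ _ _ _ _ _ (by omega) (by omega) ?_
    intro k hk
    exact hj ⟨k, by omega⟩

lemma Rf_congr (N β d : ℕ) (s1 s2 s3 s4 t1 t2 t3 t4 : ℕ → ℕ → ℂ)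
    (h1 : ∀ p q, p < N → q < N → s1 p q = t1 p q)
    (h2 : ∀ p q, p < N → q < β → s2 p q = t2 p q)
    (h3 : ∀ p q, p < β → q < β → s3 p q = t3 p q)
    (h4 : ∀ p q, p < N → q < β → s4 p q = t4 p q)
    (a p b q : ℕ) (hp : p < N + β) (hq : q < N + β)
    (hap : a = d → p < β) (hbq : b = d → q < β) :
    Rf N d s1 s2 s3 s4 a p b q = Rf N d t1 t2 t3 t4 a p b q := by
  unfold Rf
  split_ifs with h5 h6 h7 h8 h9 h10 h11 h12 h13
  · exact h3 _ _ (hap h6) (hbq (by omega))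
  · exact h1 _ _ h7.1 h7.2
  · exact h2 _ _ h8.1 (by omega)
  · exact h3 _ _ (by omega) (by omega)
  · rfl
  · exact h4 _ _ (by omega) (hbq (by omega))
  · rfl
  · exact h4 _ _ (by omega) (by omega)
  · rfl
  · rfl

lemma forw (m n β c : ℕ) (h : n < m) (hm : m = c * n + n + β) (hβ : 0 < β) (hβn : β ≤ n)
    (S : Matrix (Fin m) (Fin m) ℂ)
    (h0 : (S.submatrix (spl m n h ∘ Sum.inr) (spl m n h ∘ Sum.inl)) = 0)
    (h1 : (S.submatrix (spl m n h ∘ Sum.inr) (spl m n h ∘ Sum.inr)) * Hm m n β c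
      = Hm m n β c * S) :
    ∃ (S1 : Matrix (Fin (n - β)) (Fin (n - β)) ℂ)
        (S2 S4 : Matrix (Fin (n - β)) (Fin β) ℂ) (S3 : Matrix (Fin β) (Fin β) ℂ),
        S = Rm m n β (c + 1) S1 S2 S3 S4 := by
  have hg : ∀ i j (hi : i < m) (hj : j < m), get' S i j = S ⟨i, hi⟩ ⟨j, hj⟩ := by
    intro i j hi hj; simp [get', hi, hj]
  have er : ∀ (r : ℕ) (hr : r < m - n), spl m n h (Sum.inr ⟨r, hr⟩) = ⟨n + r, by omega⟩ := by
    intro r hr; apply Fin.ext; rw [spl_inr]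
  have el : ∀ (r : ℕ) (hr : r < n), spl m n h (Sum.inl ⟨r, hr⟩) = ⟨r, by omega⟩ := by
    intro r hr; apply Fin.ext; rw [spl_inl]
  have C := core2 n β c (n - β) hβ (by omega) (get' S) ?_ ?_ ?_
  · refine ⟨fun p q => get' S p q, fun p q => get' S p ((n - β) + q),
      fun p q => get' S (c * n + p) ((c + 1) * n + q),
      fun p q => get' S ((c + 1) * n + p) ((c + 1) * n + q), ?_⟩
    ext i j
    have hi := i.2
    have hj := j.2
    obtain ⟨a, p, hi', ha, hp, hap⟩ :=
      dec n β (c + 1) i hβ (by omega) (by rw [Nat.add_mul]; omega)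
    obtain ⟨b, q, hj', hb, hq, hbq⟩ :=
      dec n β (c + 1) j hβ (by omega) (by rw [Nat.add_mul]; omega)
    have e := C a p b q ha hb hp hq hap hbq
    rw [← hi', ← hj', hg _ _ hi hj] at e
    unfold Rm
    rw [hi', hj', Rg_block _ _ _ _ _ _ _ _ _ _ _ hp hq]
    refine e.trans ?_
    apply Rf_congr (n - β) β <;> first | omega | skip
    all_goals
      intro p q hp hq
      refine Eq.trans ?_ (get_in _ _ _ hp hq).symm; rfl
  · intro i j hi hi' hj
    have := congrFun (congrFun h0 ⟨i - n, by omega⟩) ⟨j, hj⟩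
    simp only [submatrix_apply, Function.comp, er, el, Matrix.zero_apply] at this
    rw [hg _ _ (by omega) (by omega), ← this]
    congr 2; omega
  · intro r k hr hk
    have hr' : r < m - n := by omega
    have hk' : k < m - n := by omega
    have := congrFun (congrFun h1 ⟨r, hr'⟩) ⟨sg n β c k, sg_lt_m m n β c k hm hβn hk'⟩
    rw [H_mul m n β c hm hβn, mul_H m n β c hβn _ _ ⟨k, hk'⟩ _ rfl] at this
    simp only [submatrix_apply, Function.comp, er] at this
    rw [hg _ _ (sg_lt_m m n β c r hm hβn hr') (sg_lt_m m n β c k hm hβn hk'), hg _ _ (by omega) (by omega), this]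
  · intro r j hr hj hk
    have hr' : r < m - n := by omega
    have := congrFun (congrFun h1 ⟨r, hr'⟩) ⟨j, by omega⟩
    rw [H_mul m n β c hm hβn, mul_H_zero m n β c _ _ _ (fun k => hk k (by omega))] at this
    rw [hg _ _ (sg_lt_m m n β c r hm hβn hr') (by omega), ← this]

/-- second part of Lemma 8 of the paper: `𝒦(N)` and `𝒦(N')` are
feedback similar if and only if `N' = R_α(S₁,S₂,S₃,S₄)⁻¹ · N · R_{α+1}(S₁,S₂,S₃,S₄)`
for some `S₂, S₄` and nonsingular `S₁, S₃`. -/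
theorem stmt8 (m n α β : ℕ) (hn : 1 ≤ n) (hnm : n < m)
    (hdec : m = α * n + β) (hβ0 : 0 < β) (hβn : β ≤ n)
    (N N' : Matrix (Fin (m - n)) (Fin m) ℂ) :
    FST (Ktriple m n α β N) (Ktriple m n α β N') ↔
      ∃ (S1 : Matrix (Fin (n - β)) (Fin (n - β)) ℂ)
        (S2 S4 : Matrix (Fin (n - β)) (Fin β) ℂ) (S3 : Matrix (Fin β) (Fin β) ℂ),
        IsUnit S1 ∧ IsUnit S3 ∧
        N' =
          (Matrix.reindex
              (finCongr (show (α - 1) * n + β = m - n by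
                rcases Nat.eq_zero_or_pos α with h0 | h1
                · subst h0; omega
                · obtain ⟨a, rfl⟩ : ∃ a, α = a + 1 := ⟨α - 1, by omega⟩
                  have e1 : (a + 1 - 1) * n = a * n := by
                    rw [show a + 1 - 1 = a from rfl]
                  have e2 : (a + 1) * n = a * n + n := by ring
                  omega))
              (finCongr (show (α - 1) * n + β = m - n by
                rcases Nat.eq_zero_or_pos α with h0 | h1
                · subst h0; omega
                · obtain ⟨a, rfl⟩ : ∃ a, α = a + 1 := ⟨α - 1, by omega⟩
                  have e1 : (a + 1 - 1) * n = a * n := by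
                    rw [show a + 1 - 1 = a from rfl]
                  have e2 : (a + 1) * n = a * n + n := by ring
                  omega))
              (Rmat n β α S1 S2 S3 S4))⁻¹ *
            N *
            Matrix.reindex
              (finCongr (show (α + 1 - 1) * n + β = m by
                have e1 : (α + 1 - 1) * n = α * n := by
                  rw [show α + 1 - 1 = α from rfl]
                omega))
              (finCongr (show (α + 1 - 1) * n + β = m by
                have e1 : (α + 1 - 1) * n = α * n := by
                  rw [show α + 1 - 1 = α from rfl]
                omega))
              (Rmat n β (α + 1) S1 S2 S3 S4) := by
  obtain ⟨c, rfl⟩ : ∃ c, α = c + 1 := by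
    refine ⟨α - 1, ?_⟩
    rcases Nat.eq_zero_or_pos α with h0 | h0
    · subst h0; omega
    · omega
  have hm : m = c * n + n + β := by rw [hdec]; ring
  rw [fst_iff m n c β hnm]
  simp only [rmat_eq _ n β _ hβ0 hβn]
  constructor
  · rintro ⟨S, hP, hT, h0, h1, h2⟩
    obtain ⟨S1, S2, S4, S3, rfl⟩ := forw m n β c hnm hm hβ0 hβn S h0 h1
    rw [sub_rr m n β c hnm (by omega)] at hT h2
    rw [sub_ll, unitP n β c hβn] at hP
    refine ⟨S1, S2, S4, S3, hP.1, hP.2, ?_⟩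
    rw [Matrix.mul_assoc, ← h2, Matrix.nonsing_inv_mul_cancel_left _ _
      ((Matrix.isUnit_iff_isUnit_det _).1 hT)]
  · rintro ⟨S1, S2, S4, S3, hS1, hS3, rfl⟩
    have hT := unitR n β hβ0 hβn S1 S2 S3 S4 hS1 hS3 c (m - n) (by omega)
    refine ⟨Rm m n β (c + 1) S1 S2 S3 S4, ?_, ?_, ?_, ?_, ?_⟩
    · rw [sub_ll, unitP n β c hβn]; exact ⟨hS1, hS3⟩
    · rw [sub_rr m n β c hnm (by omega)]; exact hT
    · exact sub_rl m n β (c + 1) hnm hβ0 hβn S1 S2 S3 S4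
    · rw [sub_rr m n β c hnm (by omega)]; exact back m n β c hnm hm hβ0 hβn S1 S2 S3 S4
    · rw [sub_rr m n β c hnm (by omega), Matrix.mul_assoc, Matrix.mul_nonsing_inv_cancel_left _ _
        ((Matrix.isUnit_iff_isUnit_det _).1 hT)]
end
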